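/- arXiv:2409.20088 — 2 statements merged into one kernel-verified Lean document; each statement's English description precedes it below -/
import Mathlib

section
/- If φ ∈ SO(V,Q) is reversible in SO(V,Q), i.e. conjugate within SO(V,Q) to φ⁻¹, then φ is a product of two involutions of SO(V,Q). -/
open Polynomial Module

variable {K V : Type*}

section Defs

variable [Field K] [AddCommGroup V] [Module K V]

/-- The polar form `f_Q(u,w) = Q(u+w) - Q u - Q w` of a quadratic form. -/
def polarF (Q : QuadraticForm K V) (u w : V) : K := Q (u + w) - Q u - Q w

/-- `Q` is nondefective: its polar form is nondegenerate. -/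
def Nondefective (Q : QuadraticForm K V) : Prop :=
  ∀ u : V, (∀ w : V, polarF Q u w = 0) → u = 0

/-- Membership in the orthogonal group `O(V,Q)`. -/
def InO (Q : QuadraticForm K V) (φ : V ≃ₗ[K] V) : Prop := ∀ v : V, Q (φ v) = Q v

/-- Membership in the special orthogonal group `SO(V,Q)`:
orthogonal and `dim im(φ - 1)` is even. -/
def InSO (Q : QuadraticForm K V) (φ : V ≃ₗ[K] V) : Prop :=
  InO Q φ ∧ Even (Module.finrank K (LinearMap.range (φ.toLinearMap - LinearMap.id)))

/-- `φ` is a product of two involutions of `SO(V,Q)`. -/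
def BireflSO (Q : QuadraticForm K V) (φ : V ≃ₗ[K] V) : Prop :=
  ∃ σ τ : V ≃ₗ[K] V, InSO Q σ ∧ InSO Q τ ∧ σ * σ = 1 ∧ τ * τ = 1 ∧ φ = σ * τ

/-- A subspace is totally isotropic if `Q` vanishes on it. -/
def TotIsotropic (Q : QuadraticForm K V) (U : Submodule K V) : Prop := ∀ u ∈ U, Q u = 0

/-- A subspace invariant under a linear map. -/
def Invariant (f : V →ₗ[K] V) (U : Submodule K V) : Prop := ∀ u ∈ U, f u ∈ U

/-- The restriction of the polar form of `Q` to `U` is nondegenerate. -/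
def NondegOn (Q : QuadraticForm K V) (U : Submodule K V) : Prop :=
  ∀ u ∈ U, (∀ w ∈ U, polarF Q u w = 0) → u = 0

/-- `f` is orthogonally indecomposable: no invariant subspace `W` with
`0 < dim W < dim V` on which the polar form of `Q` is nondegenerate. -/
def OrthIndec (Q : QuadraticForm K V) (f : V →ₗ[K] V) : Prop :=
  ¬ ∃ W : Submodule K V, Invariant f W ∧ 0 < Module.finrank K W ∧
      Module.finrank K W < Module.finrank K V ∧ NondegOn Q W

/-- The subspace spanned by the `f`-orbit of `x`. -/
def cyclicSpan (f : V →ₗ[K] V) (x : V) : Submodule K V :=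
  Submodule.span K (Set.range fun k : ℕ => (f ^ k) x)

/-- `f` is a cyclic linear map. -/
def IsCyclicEnd (f : V →ₗ[K] V) : Prop := ∃ x : V, cyclicSpan f x = ⊤

/-- `f` is of type 1 with exponent `m`: orthogonally indecomposable, bicyclic, and
with minimal polynomial `(X - 1) ^ m`. -/
def IsType1 (Q : QuadraticForm K V) (f : V →ₗ[K] V) (m : ℕ) : Prop :=
  OrthIndec Q f ∧ 1 ≤ m ∧ minpoly K f = (X - 1) ^ m ∧
    ∃ x z : V, IsCompl (cyclicSpan f x) (cyclicSpan f z)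

/-- Type 1o: type 1 with odd exponent. -/
def IsType1o (Q : QuadraticForm K V) (f : V →ₗ[K] V) : Prop :=
  ∃ m : ℕ, IsType1 Q f m ∧ Odd m

/-- Type 1e: type 1 with even exponent. -/
def IsType1e (Q : QuadraticForm K V) (f : V →ₗ[K] V) : Prop :=
  ∃ m : ℕ, IsType1 Q f m ∧ Even m

/-- The quadratic space `(V,Q)` is hyperbolic. -/
def HyperbolicSpace (Q : QuadraticForm K V) : Prop :=
  ∃ U W : Submodule K V, TotIsotropic Q U ∧ TotIsotropic Q W ∧ IsCompl U W

/-- The transformation `f` is hyperbolic: `V` is a direct sum of two totally isotropic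
`f`-invariant subspaces. -/
def HyperbolicMap (Q : QuadraticForm K V) (f : V →ₗ[K] V) : Prop :=
  ∃ U W : Submodule K V, TotIsotropic Q U ∧ TotIsotropic Q W ∧
    Invariant f U ∧ Invariant f W ∧ IsCompl U W

/-- `f` is semisimple: every invariant subspace has an invariant complement. -/
def SemisimpleEnd (f : V →ₗ[K] V) : Prop :=
  ∀ U : Submodule K V, Invariant f U → ∃ W : Submodule K V, Invariant f W ∧ IsCompl U W

end Defs

section LaurentAction

open LaurentPolynomial

/-- A localization of a principal ideal domain, for Laurent polynomials over a field. -/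
theorem laurent_isPrincipalIdealRing [Field K] : IsPrincipalIdealRing K[T;T⁻¹] where
  principal J := by
    obtain ⟨g, hg⟩ :=
      (IsPrincipalIdealRing.principal (J.comap (algebraMap K[X] K[T;T⁻¹]))).principal
    refine ⟨algebraMap K[X] K[T;T⁻¹] g, ?_⟩
    have h := IsLocalization.map_under (Submonoid.powers (X : K[X])) K[T;T⁻¹] J
    have h2 : Ideal.under K[X] J = Ideal.span {g} := hg
    rw [← h, h2, Ideal.map_span, Set.image_singleton]

theorem irreducible_dvd_or_isCoprime [Field K] {P : K[T;T⁻¹]} (hP : Irreducible P) (r : K[T;T⁻¹]) :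
    P ∣ r ∨ IsCoprime r P := by
  have := laurent_isPrincipalIdealRing (K := K)
  by_cases h : P ∣ r
  · exact Or.inl h
  · exact Or.inr ((hP.coprime_iff_not_dvd.2 h).symm)

theorem T_sub_one_dvd_sub_C [Field K] (r : K[T;T⁻¹]) :
    ∃ c : K, (T 1 - 1 : K[T;T⁻¹]) ∣ r - LaurentPolynomial.C c := by
  have key : ∀ n : ℕ, (T 1 - 1 : K[T;T⁻¹]) ∣ T (n : ℤ) - 1 := by
    intro n
    have := sub_dvd_pow_sub_pow (T 1 : K[T;T⁻¹]) 1 n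
    simpa [T_pow] using this
  have key' : ∀ n : ℤ, (T 1 - 1 : K[T;T⁻¹]) ∣ T n - 1 := by
    intro n
    obtain ⟨m, rfl | rfl⟩ := n.eq_nat_or_neg
    · exact key m
    · have h : (T (-(m : ℤ)) - 1 : K[T;T⁻¹]) = (T (m : ℤ) - 1) * (-T (-(m : ℤ))) := by
        have : (T (m : ℤ) * T (-(m : ℤ)) : K[T;T⁻¹]) = 1 := by rw [← T_add]; simp
        linear_combination this
      rw [h]
      exact (key m).mul_right _
  induction r using LaurentPolynomial.induction_on' with
  | add p q hp hq =>
    obtain ⟨c, hc⟩ := hp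
    obtain ⟨d, hd⟩ := hq
    refine ⟨c + d, ?_⟩
    have := dvd_add hc hd
    rw [map_add]
    convert this using 1
    ring
  | C_mul_T n a =>
    refine ⟨a, ?_⟩
    have h : (LaurentPolynomial.C a * T n - LaurentPolynomial.C a : K[T;T⁻¹])
        = (T n - 1) * LaurentPolynomial.C a := by ring
    rw [h]
    exact (key' n).mul_right _

theorem T_sub_one_dvd_or_isCoprime [Field K] (r : K[T;T⁻¹]) :
    (T 1 - 1 : K[T;T⁻¹]) ∣ r ∨ IsCoprime r (T 1 - 1 : K[T;T⁻¹]) := by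
  obtain ⟨c, d, hd⟩ := T_sub_one_dvd_sub_C r
  by_cases hc : c = 0
  · left
    exact ⟨d, by simpa [hc] using hd⟩
  · right
    refine ⟨LaurentPolynomial.C c⁻¹, -LaurentPolynomial.C c⁻¹ * d, ?_⟩
    have h1 : (LaurentPolynomial.C c⁻¹ * LaurentPolynomial.C c : K[T;T⁻¹]) = 1 := by
      rw [← map_mul, inv_mul_cancel₀ hc, map_one]
    linear_combination LaurentPolynomial.C c⁻¹ * hd + h1

theorem invert_invert_apply [Field K] (r : K[T;T⁻¹]) :
    LaurentPolynomial.invert (LaurentPolynomial.invert r) = r :=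
  LaurentPolynomial.involutive_invert r

variable [Field K] [AddCommGroup V] [Module K V]

/-- The action of Laurent polynomials on `V` through an automorphism `φ`, with `T` acting
as `φ`. -/
noncomputable def laurentAct (φ : V ≃ₗ[K] V) : K[T;T⁻¹] →ₐ[K] Module.End K V :=
  AddMonoidAlgebra.lift K (Module.End K V) ℤ
    ((LinearEquiv.automorphismGroup.toLinearMapMonoidHom (R := K) (M := V)).comp
      (zpowersHom (V ≃ₗ[K] V) φ))

theorem laurentAct_C_mul_T (φ : V ≃ₗ[K] V) (a : K) (n : ℤ) (x : V) :
    laurentAct φ (LaurentPolynomial.C a * T n) x = a • (φ ^ n) x := by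
  rw [← LaurentPolynomial.single_eq_C_mul_T, laurentAct, AddMonoidAlgebra.lift_single]
  rfl

theorem laurentAct_T (φ : V ≃ₗ[K] V) (n : ℤ) (x : V) : laurentAct φ (T n) x = (φ ^ n) x := by
  simpa using laurentAct_C_mul_T φ 1 n x

theorem laurentAct_T_one (φ : V ≃ₗ[K] V) (x : V) : laurentAct φ (T 1) x = φ x := by
  simpa using laurentAct_T φ 1 x

theorem laurentAct_C (φ : V ≃ₗ[K] V) (a : K) (x : V) :
    laurentAct φ (LaurentPolynomial.C a) x = a • x := by
  simpa using laurentAct_C_mul_T φ a 0 x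

theorem laurentAct_mul (φ : V ≃ₗ[K] V) (a b : K[T;T⁻¹]) (x : V) :
    laurentAct φ (a * b) x = laurentAct φ a (laurentAct φ b x) := by
  rw [map_mul]; rfl

theorem laurentAct_comm (φ : V ≃ₗ[K] V) (a b : K[T;T⁻¹]) (x : V) :
    laurentAct φ a (laurentAct φ b x) = laurentAct φ b (laurentAct φ a x) := by
  rw [← laurentAct_mul, ← laurentAct_mul, mul_comm]

theorem laurentAct_add (φ : V ≃ₗ[K] V) (a b : K[T;T⁻¹]) (x : V) :
    laurentAct φ (a + b) x = laurentAct φ a x + laurentAct φ b x := by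
  rw [map_add]; rfl

theorem laurentAct_sub (φ : V ≃ₗ[K] V) (a b : K[T;T⁻¹]) (x : V) :
    laurentAct φ (a - b) x = laurentAct φ a x - laurentAct φ b x := by
  rw [map_sub]; rfl

theorem laurentAct_one (φ : V ≃ₗ[K] V) (x : V) : laurentAct φ 1 x = x := by
  rw [map_one]; rfl

theorem laurentAct_zero (φ : V ≃ₗ[K] V) (x : V) : laurentAct φ 0 x = 0 := by
  rw [map_zero]; rfl

theorem laurentAct_smul (φ : V ≃ₗ[K] V) (c : K) (a : K[T;T⁻¹]) (x : V) :
    laurentAct φ (c • a) x = c • laurentAct φ a x := by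
  rw [map_smul]; rfl

/-- An endomorphism commuting with `φ` commutes with the action of Laurent polynomials in `φ`. -/
theorem laurentAct_commute (φ : V ≃ₗ[K] V) (g : V →ₗ[K] V) (h : ∀ x, g (φ x) = φ (g x))
    (r : K[T;T⁻¹]) (x : V) : g (laurentAct φ r x) = laurentAct φ r (g x) := by
  have hinv : ∀ x, g (φ⁻¹ x) = φ⁻¹ (g x) := by
    intro x
    apply φ.injective
    rw [← h, ← LinearEquiv.mul_apply, ← LinearEquiv.mul_apply, mul_inv_cancel]; rfl
  have hn : ∀ (n : ℤ) x, g ((φ ^ n) x) = (φ ^ n) (g x) := by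
    intro n
    induction n with
    | zero => intro x; simp
    | succ n ih =>
      intro x
      rw [zpow_add_one, LinearEquiv.mul_apply, ih, h, ← LinearEquiv.mul_apply]
    | pred n ih =>
      intro x
      rw [zpow_sub_one, LinearEquiv.mul_apply, ih, hinv, ← LinearEquiv.mul_apply]
  induction r using LaurentPolynomial.induction_on' with
  | add p q hp hq => rw [laurentAct_add, laurentAct_add, map_add, hp, hq]
  | C_mul_T n a => simp only [laurentAct_C_mul_T, map_smul, hn]

variable {Q : QuadraticForm K V} {φ : V ≃ₗ[K] V}

theorem Nondefective.eq_zero (hQ : Nondefective Q) {u : V} (h : ∀ w, Q.polarBilin u w = 0) :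
    u = 0 := hQ u h

theorem polarBilin_comm (Q : QuadraticForm K V) (u v : V) :
    Q.polarBilin u v = Q.polarBilin v u := QuadraticMap.polar_comm Q u v

theorem map_add_polarBilin (Q : QuadraticForm K V) (u v : V) :
    Q (u + v) = Q u + Q v + Q.polarBilin u v := by
  simp [QuadraticMap.polar]

theorem polarBilin_self_two (Q : QuadraticForm K V) (u : V) :
    Q.polarBilin u u = 2 * Q u := by
  simp

theorem InO.polarBilin_map (h : InO Q φ) (u v : V) :
    Q.polarBilin (φ u) (φ v) = Q.polarBilin u v := by
  simp only [QuadraticMap.polarBilin_apply_apply, QuadraticMap.polar, ← map_add, h _]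

theorem InO.mul {ψ : V ≃ₗ[K] V} (h : InO Q φ) (h' : InO Q ψ) : InO Q (φ * ψ) := by
  intro v
  rw [LinearEquiv.mul_apply, h, h']

theorem InO.inv (h : InO Q φ) : InO Q φ⁻¹ := by
  intro v
  rw [← h (φ⁻¹ v), ← LinearEquiv.mul_apply, mul_inv_cancel]; rfl

theorem InO.zpow (h : InO Q φ) (n : ℤ) : InO Q (φ ^ n) := by
  induction n with
  | zero => intro v; simp
  | succ n ih => rw [zpow_add_one]; exact ih.mul h
  | pred n ih => rw [zpow_sub_one]; exact ih.mul h.inv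

/-- The adjoint of a Laurent polynomial in an isometry. -/
theorem InO.polarBilin_laurentAct (h : InO Q φ) (r : K[T;T⁻¹]) (u v : V) :
    Q.polarBilin (laurentAct φ r u) v = Q.polarBilin u (laurentAct φ (invert r) v) := by
  induction r using LaurentPolynomial.induction_on' with
  | add p q hp hq =>
    rw [laurentAct_add, map_add, LinearMap.add_apply, map_add invert, laurentAct_add, map_add,
      hp, hq]
  | C_mul_T n a =>
    rw [laurentAct_C_mul_T, map_mul, invert_C, invert_T, laurentAct_C_mul_T, map_smul, map_smul,
      LinearMap.smul_apply, ← (h.zpow n).polarBilin_map u, ← LinearEquiv.mul_apply, ← zpow_add,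
      add_neg_cancel, zpow_zero, LinearEquiv.coe_one, id]

theorem InO.polarBilin_laurentAct_laurentAct (h : InO Q φ) (a b : K[T;T⁻¹]) (u v : V) :
    Q.polarBilin (laurentAct φ a u) (laurentAct φ b v)
      = Q.polarBilin (laurentAct φ (a * invert b) u) v := by
  rw [mul_comm, laurentAct_mul, h.polarBilin_laurentAct (invert b), invert_invert_apply]

theorem InO.polarBilin_laurentAct_comm (h : InO Q φ) (r : K[T;T⁻¹]) (u v : V) :
    Q.polarBilin (laurentAct φ r u) v = Q.polarBilin (laurentAct φ (invert r) v) u := by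
  rw [h.polarBilin_laurentAct, polarBilin_comm]

/-- The values of `Q` on a cyclic subspace are determined by the autocorrelations of the
generator, and they are invariant under `T ↦ T⁻¹`. -/
theorem InO.map_laurentAct_invert (h : InO Q φ) {x y : V} (h0 : Q x = Q y)
    (hxy : ∀ r, Q.polarBilin (laurentAct φ r x) x = Q.polarBilin (laurentAct φ r y) y)
    (r : K[T;T⁻¹]) : Q (laurentAct φ (invert r) y) = Q (laurentAct φ r x) := by
  induction r using LaurentPolynomial.induction_on' with
  | add p q hp hq =>
    rw [map_add, laurentAct_add, laurentAct_add, map_add_polarBilin, map_add_polarBilin, hp, hq,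
      h.polarBilin_laurentAct_laurentAct, h.polarBilin_laurentAct_laurentAct, hxy,
      h.polarBilin_laurentAct_comm (p * invert q)]
    simp [invert_invert_apply, mul_comm]
  | C_mul_T n a =>
    rw [map_mul, invert_C, invert_T, laurentAct_C_mul_T, laurentAct_C_mul_T,
      QuadraticMap.map_smul, QuadraticMap.map_smul, h.zpow, h.zpow, h0]

theorem InO.map_laurentAct_invert_self (h : InO Q φ) (x : V) (r : K[T;T⁻¹]) :
    Q (laurentAct φ (invert r) x) = Q (laurentAct φ r x) :=
  h.map_laurentAct_invert rfl (fun _ => rfl) r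

end LaurentAction

section Parity

theorem finrank_map_of_injective [Field K] [AddCommGroup V] [Module K V] {W : Type*}
    [AddCommGroup W] [Module K W] {f : V →ₗ[K] W} (hf : Function.Injective f)
    (p : Submodule K V) : finrank K (p.map f) = finrank K p :=
  (LinearEquiv.finrank_eq (Submodule.equivMapOfInjective f hf p)).symm

/-- An alternating form has even rank. -/
theorem LinearMap.IsAlt.even_finrank_range [Field K] [AddCommGroup V] [Module K V]
    [FiniteDimensional K V] {ω : V →ₗ[K] V →ₗ[K] K} (hω : ω.IsAlt) :
    Even (finrank K (LinearMap.range ω)) := by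
  have hwf : WellFounded ((· > ·) : Submodule K V → Submodule K V → Prop) := wellFounded_gt
  obtain ⟨M, hM, hmax⟩ := hwf.has_min
    {M : Submodule K V | ∀ x ∈ M, ∀ y ∈ M, ω x y = 0} ⟨⊥, by
      intro x hx y _
      rw [(Submodule.mem_bot K).1 hx, map_zero, LinearMap.zero_apply]⟩
  have horth : LinearMap.BilinForm.orthogonal ω M = M := by
    apply le_antisymm
    · intro v hv
      by_contra hvM
      refine hmax (M ⊔ K ∙ v) ?_ ?_
      · intro x hx y hy
        obtain ⟨m, hm, a, ha, rfl⟩ := Submodule.mem_sup.1 hx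
        obtain ⟨n, hn, b, hb, rfl⟩ := Submodule.mem_sup.1 hy
        obtain ⟨c, rfl⟩ := Submodule.mem_span_singleton.1 ha
        obtain ⟨d, rfl⟩ := Submodule.mem_span_singleton.1 hb
        have h1 : ω m v = 0 := hv m hm
        have h2 : ω n v = 0 := hv n hn
        have h3 : ω v n = 0 := by rw [← hω.neg, h2, neg_zero]
        simp [hM m hm n hn, h1, h3, hω v]
      · refine lt_of_le_of_ne le_sup_left fun h => hvM ?_
        rw [h]
        exact Submodule.mem_sup_right (Submodule.mem_span_singleton_self v)
    · intro x hx y hy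
      exact hM y hy x hx
  have hker : M ⊓ LinearMap.ker ω = LinearMap.ker ω := by
    refine inf_eq_right.2 fun v hv => ?_
    rw [← horth]
    intro n _
    change ω n v = 0
    rw [← hω.neg, LinearMap.mem_ker.1 hv, LinearMap.zero_apply, neg_zero]
  have h1 := LinearMap.BilinForm.finrank_add_finrank_orthogonal' (B := ω) M
  rw [horth, hker] at h1
  have h2 := LinearMap.finrank_range_add_finrank_ker ω
  exact (Nat.even_iff).2 (by omega)

variable [Field K] [AddCommGroup V] [Module K V] {Q : QuadraticForm K V}

/-- The orthogonal of a subspace for the polar form. -/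
def polarOrth (Q : QuadraticForm K V) (A : Submodule K V) : Submodule K V :=
  LinearMap.BilinForm.orthogonal Q.polarBilin A

theorem mem_polarOrth {A : Submodule K V} {v : V} :
    v ∈ polarOrth Q A ↔ ∀ a ∈ A, Q.polarBilin a v = 0 := Iff.rfl

theorem Nondefective.finrank_polarOrth [FiniteDimensional K V] (hQ : Nondefective Q)
    (A : Submodule K V) : finrank K A + finrank K (polarOrth Q A) = finrank K V := by
  have h := LinearMap.BilinForm.finrank_add_finrank_orthogonal' (B := Q.polarBilin) A
  have hk : LinearMap.ker Q.polarBilin = ⊥ := by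
    rw [LinearMap.ker_eq_bot']
    intro u hu
    exact hQ.eq_zero fun w => by rw [hu, LinearMap.zero_apply]
  rw [hk, inf_bot_eq, finrank_bot] at h
  exact h

theorem polarOrth_sup (A B : Submodule K V) :
    polarOrth Q (A ⊔ B) = polarOrth Q A ⊓ polarOrth Q B := by
  ext v
  constructor
  · intro h
    exact ⟨fun a ha => h a (Submodule.mem_sup_left ha),
      fun b hb => h b (Submodule.mem_sup_right hb)⟩
  · rintro ⟨h1, h2⟩ x hx
    obtain ⟨a, ha, b, hb, rfl⟩ := Submodule.mem_sup.1 hx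
    change Q.polarBilin (a + b) v = 0
    rw [map_add, LinearMap.add_apply, mem_polarOrth.1 h1 a ha, mem_polarOrth.1 h2 b hb, add_zero]

theorem Nondefective.polarOrth_polarOrth [FiniteDimensional K V] (hQ : Nondefective Q)
    (A : Submodule K V) : polarOrth Q (polarOrth Q A) = A := by
  symm
  apply Submodule.eq_of_le_of_finrank_eq
  · intro a ha b hb
    change Q.polarBilin b a = 0
    rw [polarBilin_comm]
    exact hb a ha
  · have h1 := hQ.finrank_polarOrth A
    have h2 := hQ.finrank_polarOrth (polarOrth Q A)
    omega

/-- A totally singular subspace that contains its orthogonal. -/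
def IsLagrangian (Q : QuadraticForm K V) (A : Submodule K V) : Prop :=
  (∀ a ∈ A, Q a = 0) ∧ polarOrth Q A ≤ A

theorem polarBilin_eq_zero_of_singular {A : Submodule K V} (hA : ∀ a ∈ A, Q a = 0) {a b : V}
    (ha : a ∈ A) (hb : b ∈ A) : Q.polarBilin a b = 0 := by
  have h := map_add_polarBilin Q a b
  rw [hA a ha, hA b hb, hA _ (A.add_mem ha hb)] at h
  linear_combination -h

theorem IsLagrangian.polarOrth_eq {A : Submodule K V} (hA : IsLagrangian Q A) :
    polarOrth Q A = A :=
  le_antisymm hA.2 fun _ ha _ hb => polarBilin_eq_zero_of_singular hA.1 hb ha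

theorem IsLagrangian.two_mul_finrank [FiniteDimensional K V] (hQ : Nondefective Q)
    {A : Submodule K V} (hA : IsLagrangian Q A) : 2 * finrank K A = finrank K V := by
  have h := hQ.finrank_polarOrth A
  rw [hA.polarOrth_eq] at h
  omega

/-- The parity relation for the intersections of three Lagrangians. -/
theorem IsLagrangian.even_finrank_inf [FiniteDimensional K V] (hQ : Nondefective Q)
    {A B C : Submodule K V} (hA : IsLagrangian Q A) (hB : IsLagrangian Q B)
    (hC : IsLagrangian Q C) :
    Even (finrank K ↥(A ⊓ B) + finrank K ↥(B ⊓ C) + finrank K ↥(A ⊓ C) + finrank K A) := by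
  classical
  let Y : Submodule K (V × V) :=
    (B.prod C) ⊓ A.comap (LinearMap.fst K V V + LinearMap.snd K V V)
  have memY : ∀ b c, (b, c) ∈ Y ↔ (b ∈ B ∧ c ∈ C) ∧ b + c ∈ A := fun b c => Iff.rfl
  let ω : Y →ₗ[K] Y →ₗ[K] K :=
    Q.polarBilin.compl₁₂ (LinearMap.fst K V V ∘ₗ Y.subtype) (LinearMap.snd K V V ∘ₗ Y.subtype)
  have hωapp : ∀ y y' : Y, ω y y' = Q.polarBilin y.1.1 y'.1.2 := fun _ _ => rfl
  have hω : ω.IsAlt := by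
    rintro ⟨⟨b, c⟩, h⟩
    obtain ⟨⟨hb, hc⟩, ha⟩ := (memY b c).1 h
    rw [hωapp]
    have h1 := map_add_polarBilin Q b c
    rw [hB.1 b hb, hC.1 c hc, hA.1 _ ha] at h1
    change Q.polarBilin b c = 0
    linear_combination -h1
  have hrk := hω.even_finrank_range
  have hrn := LinearMap.finrank_range_add_finrank_ker ω
  -- the dimension of `Y`
  let h : Y →ₗ[K] V := (LinearMap.fst K V V + LinearMap.snd K V V) ∘ₗ Y.subtype
  have hrange : LinearMap.range h = A ⊓ (B ⊔ C) := by
    ext v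
    constructor
    · rintro ⟨⟨⟨b, c⟩, hy⟩, rfl⟩
      obtain ⟨⟨hb, hc⟩, ha⟩ := (memY b c).1 hy
      exact ⟨ha, Submodule.add_mem_sup hb hc⟩
    · rintro ⟨ha, hbc⟩
      obtain ⟨b, hb, c, hc, rfl⟩ := Submodule.mem_sup.1 hbc
      exact ⟨⟨(b, c), (memY b c).2 ⟨⟨hb, hc⟩, ha⟩⟩, rfl⟩
  have hker : finrank K (LinearMap.ker h) = finrank K ↥(B ⊓ C) := by
    let i : LinearMap.ker h →ₗ[K] V := LinearMap.fst K V V ∘ₗ Y.subtype ∘ₗ (LinearMap.ker h).subtype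
    have hinj : Function.Injective i := by
      rintro ⟨⟨⟨b, c⟩, hy⟩, hk⟩ ⟨⟨⟨b', c'⟩, hy'⟩, hk'⟩ h0
      have hb : b = b' := h0
      have hbc : b + c = 0 := hk
      have hbc' : b' + c' = 0 := hk'
      subst hb
      obtain rfl : c = c' := add_left_cancel (hbc.trans hbc'.symm)
      rfl
    rw [← LinearMap.finrank_range_of_inj hinj]
    suffices hi : LinearMap.range i = B ⊓ C by rw [hi]
    ext v
    constructor
    · rintro ⟨⟨⟨⟨b, c⟩, hy⟩, hk⟩, rfl⟩
      obtain ⟨⟨hb, hc⟩, ha⟩ := (memY b c).1 hy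
      have hbc : b + c = 0 := hk
      refine ⟨hb, ?_⟩
      change b ∈ C
      rw [eq_neg_of_add_eq_zero_left hbc]
      exact C.neg_mem hc
    · rintro ⟨hb, hc⟩
      have h1 : v + -v = 0 := add_neg_cancel v
      exact ⟨⟨⟨(v, -v), (memY _ _).2 ⟨⟨hb, C.neg_mem hc⟩, by rw [h1]; exact A.zero_mem⟩⟩, h1⟩, rfl⟩
  have hrn2 := LinearMap.finrank_range_add_finrank_ker h
  rw [hrange, hker] at hrn2
  -- the radical of `ω`
  let f : ↥(A ⊓ B) × ↥(B ⊓ C) × ↥(A ⊓ C) →ₗ[K] V × V :=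
    LinearMap.prod
      ((A ⊓ B).subtype ∘ₗ LinearMap.fst K _ _
        + (B ⊓ C).subtype ∘ₗ LinearMap.fst K _ _ ∘ₗ LinearMap.snd K _ _)
      ((A ⊓ C).subtype ∘ₗ LinearMap.snd K _ _ ∘ₗ LinearMap.snd K _ _
        - (B ⊓ C).subtype ∘ₗ LinearMap.fst K _ _ ∘ₗ LinearMap.snd K _ _)
  have hfapp : ∀ p q r, f (p, q, r) = ((p : V) + q, (r : V) - q) := fun _ _ _ => rfl
  have hBC : polarOrth Q (B ⊓ C) = B ⊔ C := by
    rw [← hQ.polarOrth_polarOrth (B ⊔ C), polarOrth_sup, hB.polarOrth_eq, hC.polarOrth_eq]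
  have hABC : polarOrth Q (A ⊓ (B ⊔ C)) = A ⊔ (B ⊓ C) := by
    rw [← hQ.polarOrth_polarOrth (A ⊔ (B ⊓ C)), polarOrth_sup, hA.polarOrth_eq, hBC]
  have hkω : (LinearMap.ker ω).map Y.subtype = LinearMap.range f := by
    ext v
    constructor
    · rintro ⟨⟨⟨b, c⟩, hy⟩, hk, rfl⟩
      obtain ⟨⟨hb, hc⟩, ha⟩ := (memY b c).1 hy
      have hb2 : b ∈ A ⊔ (B ⊓ C) := by
        rw [← hABC]
        rintro a ⟨haA, haBC⟩
        obtain ⟨b', hb', c', hc', rfl⟩ := Submodule.mem_sup.1 haBC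
        have h1 : ω ⟨(b, c), hy⟩ ⟨(b', c'), (memY _ _).2 ⟨⟨hb', hc'⟩, haA⟩⟩ = 0 := by
          rw [LinearMap.mem_ker.1 hk]; rfl
        change Q.polarBilin (b' + c') b = 0
        rw [polarBilin_comm, map_add, polarBilin_eq_zero_of_singular hB.1 hb hb', zero_add]
        exact h1
      obtain ⟨p, hp, q, hq, rfl⟩ := Submodule.mem_sup.1 hb2
      have hpB : p ∈ B := by simpa using B.sub_mem hb hq.1
      have hr : c + q ∈ A ⊓ C := by
        refine ⟨?_, C.add_mem hc hq.2⟩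
        have := A.sub_mem ha hp
        rwa [show p + q + c - p = c + q by abel] at this
      refine ⟨(⟨p, hp, hpB⟩, ⟨q, hq⟩, ⟨c + q, hr⟩), ?_⟩
      rw [hfapp]
      simp
    · rintro ⟨⟨⟨p, hpA, hpB⟩, ⟨q, hqB, hqC⟩, ⟨r, hrA, hrC⟩⟩, rfl⟩
      rw [hfapp]
      have hy : (p + q, r - q) ∈ Y := by
        refine (memY _ _).2 ⟨⟨B.add_mem hpB hqB, C.sub_mem hrC hqC⟩, ?_⟩
        rw [show p + q + (r - q) = p + r by abel]
        exact A.add_mem hpA hrA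
      refine ⟨⟨(p + q, r - q), hy⟩, ?_, rfl⟩
      refine LinearMap.mem_ker.2 (LinearMap.ext ?_)
      rintro ⟨⟨b', c'⟩, hy'⟩
      obtain ⟨⟨hb', hc'⟩, ha'⟩ := (memY b' c').1 hy'
      have h1 : Q.polarBilin p (b' + c') = 0 := polarBilin_eq_zero_of_singular hA.1 hpA ha'
      rw [map_add, polarBilin_eq_zero_of_singular hB.1 hpB hb', zero_add] at h1
      change Q.polarBilin (p + q) c' = 0
      rw [map_add, LinearMap.add_apply, h1, polarBilin_eq_zero_of_singular hC.1 hqC hc', add_zero]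
  have hkω' : finrank K (LinearMap.ker ω) = finrank K (LinearMap.range f) := by
    rw [← hkω, finrank_map_of_injective Y.injective_subtype]
  have hkf : finrank K (LinearMap.ker f) = finrank K ↥(A ⊓ (B ⊓ C)) := by
    let i : LinearMap.ker f →ₗ[K] V :=
      (B ⊓ C).subtype ∘ₗ LinearMap.fst K _ _ ∘ₗ LinearMap.snd K _ _ ∘ₗ (LinearMap.ker f).subtype
    have hk : ∀ p q r, (p, q, r) ∈ LinearMap.ker f → (p : V) + q = 0 ∧ (r : V) - q = 0 := by
      intro p q r hk
      rw [LinearMap.mem_ker, hfapp] at hk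
      exact ⟨congrArg Prod.fst hk, congrArg Prod.snd hk⟩
    have hinj : Function.Injective i := by
      refine (injective_iff_map_eq_zero i).2 ?_
      rintro ⟨⟨⟨p, hp⟩, ⟨q, hq⟩, ⟨r, hr⟩⟩, hm⟩ h0
      have hq0 : q = 0 := h0
      obtain ⟨h1, h2⟩ := hk _ _ _ hm
      simp only at h1 h2
      subst hq0
      rw [add_zero] at h1
      rw [sub_zero] at h2
      subst h1 h2
      rfl
    rw [← LinearMap.finrank_range_of_inj hinj]
    suffices hi : LinearMap.range i = A ⊓ (B ⊓ C) by rw [hi]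
    ext v
    constructor
    · rintro ⟨⟨⟨⟨p, hp⟩, ⟨q, hq⟩, ⟨r, hr⟩⟩, hm⟩, rfl⟩
      obtain ⟨h1, h2⟩ := hk _ _ _ hm
      refine ⟨?_, hq⟩
      change q ∈ A
      simp only at h2
      rw [← sub_eq_zero.1 h2]
      exact hr.1
    · rintro ⟨hA', hB', hC'⟩
      refine ⟨⟨(⟨-v, A.neg_mem hA', B.neg_mem hB'⟩, ⟨v, hB', hC'⟩, ⟨v, hA', hC'⟩), ?_⟩, rfl⟩
      rw [LinearMap.mem_ker, hfapp]
      simp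
  have hrn3 := LinearMap.finrank_range_add_finrank_ker f
  rw [hkf] at hrn3
  simp only [Module.finrank_prod] at hrn3
  have e1 := Submodule.finrank_sup_add_finrank_inf_eq A (B ⊔ C)
  have e2 := Submodule.finrank_sup_add_finrank_inf_eq B C
  have e3 := hQ.finrank_polarOrth (A ⊔ (B ⊔ C))
  rw [polarOrth_sup, polarOrth_sup, hA.polarOrth_eq, hB.polarOrth_eq, hC.polarOrth_eq] at e3
  have dA := hA.two_mul_finrank hQ
  have dB := hB.two_mul_finrank hQ
  have dC := hC.two_mul_finrank hQ
  obtain ⟨k, hk⟩ := hrk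
  exact Nat.even_iff.2 (by omega)

end Parity

section Dickson

variable [Field K] [AddCommGroup V] [Module K V] {Q : QuadraticForm K V}

/-- The Dickson invariant: the parity of the rank of `g - 1`. -/
noncomputable def dicksonInv (g : V ≃ₗ[K] V) : ZMod 2 :=
  (finrank K (LinearMap.range (g.toLinearMap - LinearMap.id)) : ZMod 2)

theorem inSO_iff {g : V ≃ₗ[K] V} : InSO Q g ↔ InO Q g ∧ dicksonInv g = 0 := by
  rw [InSO, dicksonInv, ZMod.natCast_eq_zero_iff_even]

theorem dicksonInv_eq_add [FiniteDimensional K V] (g : V ≃ₗ[K] V) :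
    dicksonInv g = finrank K V + finrank K (LinearMap.ker (g.toLinearMap - LinearMap.id)) := by
  have h := LinearMap.finrank_range_add_finrank_ker (g.toLinearMap - LinearMap.id)
  rw [← h, Nat.cast_add, add_assoc, CharTwo.add_self_eq_zero, add_zero]
  rfl

/-- The form `Q x - Q y` on `V × V`. -/
noncomputable def doubleForm (Q : QuadraticForm K V) : QuadraticForm K (V × V) := Q.prod (-Q)

theorem doubleForm_apply (p : V × V) : doubleForm Q p = Q p.1 - Q p.2 := by
  rw [doubleForm, QuadraticMap.prod_apply, neg_apply, sub_eq_add_neg]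

theorem polarBilin_doubleForm (p q : V × V) :
    (doubleForm Q).polarBilin p q = Q.polarBilin p.1 q.1 - Q.polarBilin p.2 q.2 := by
  have h := map_add_polarBilin (doubleForm Q) p q
  rw [doubleForm_apply, doubleForm_apply, doubleForm_apply, Prod.fst_add, Prod.snd_add,
    map_add_polarBilin, map_add_polarBilin] at h
  linear_combination -h

theorem Nondefective.doubleForm (hQ : Nondefective Q) : Nondefective (doubleForm Q) := by
  rintro ⟨u, v⟩ h
  have h1 : u = 0 := hQ.eq_zero fun w => by
    have : (_root_.doubleForm Q).polarBilin (u, v) (w, 0) = 0 := h (w, 0)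
    simpa only [polarBilin_doubleForm, map_zero, sub_zero] using this
  have h2 : v = 0 := hQ.eq_zero fun w => by
    have : (_root_.doubleForm Q).polarBilin (u, v) (0, w) = 0 := h (0, w)
    simpa only [polarBilin_doubleForm, map_zero, zero_sub, neg_eq_zero] using this
  rw [h1, h2]; rfl

theorem id_prod_injective (g : V →ₗ[K] V) : Function.Injective (LinearMap.id.prod g) :=
  fun _ _ h => congrArg Prod.fst h

theorem InO.isLagrangian_graph {g : V ≃ₗ[K] V} (hQ : Nondefective Q) (hg : InO Q g) :
    IsLagrangian (doubleForm Q) (LinearMap.range (LinearMap.id.prod g.toLinearMap)) := by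
  refine ⟨?_, ?_⟩
  · rintro _ ⟨x, rfl⟩
    rw [doubleForm_apply]
    exact sub_eq_zero.2 (hg x).symm
  · rintro ⟨u, v⟩ h
    refine ⟨u, Prod.ext rfl ?_⟩
    refine sub_eq_zero.1 (hQ.eq_zero fun w => ?_)
    have h1 := h _ ⟨g⁻¹ w, rfl⟩
    have h2 : Q.polarBilin (g⁻¹ w) u - Q.polarBilin (g (g⁻¹ w)) v = 0 := by
      rw [← h1]; exact (polarBilin_doubleForm (Q := Q) (g⁻¹ w, g (g⁻¹ w)) (u, v)).symm
    rw [← hg.polarBilin_map (g⁻¹ w) u, ← map_sub] at h2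
    rw [polarBilin_comm]
    have h3 : g (g⁻¹ w) = w := g.apply_symm_apply w
    rwa [h3] at h2

theorem IsLagrangian.prod {L : Submodule K V} (hL : IsLagrangian Q L) :
    IsLagrangian (doubleForm Q) (L.prod L) := by
  refine ⟨?_, ?_⟩
  · rintro ⟨x, y⟩ ⟨hx, hy⟩
    rw [doubleForm_apply, hL.1 x hx, hL.1 y hy, sub_zero]
  · rintro ⟨u, v⟩ h
    refine ⟨hL.2 fun a ha => ?_, hL.2 fun a ha => ?_⟩
    · have h1 := h (a, 0) ⟨ha, L.zero_mem⟩
      change (doubleForm Q).polarBilin _ _ = 0 at h1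
      simpa only [polarBilin_doubleForm, map_zero, LinearMap.zero_apply, sub_zero] using h1
    · have h1 := h (0, a) ⟨L.zero_mem, ha⟩
      change (doubleForm Q).polarBilin _ _ = 0 at h1
      simpa only [polarBilin_doubleForm, map_zero, LinearMap.zero_apply, zero_sub,
        neg_eq_zero] using h1

theorem finrank_graph_inf_graph (g h : V →ₗ[K] V) :
    finrank K ↥(LinearMap.range (LinearMap.id.prod g) ⊓ LinearMap.range (LinearMap.id.prod h))
      = finrank K (LinearMap.ker (g - h)) := by
  rw [← finrank_map_of_injective (id_prod_injective g)]
  refine congrArg (fun S : Submodule K (V × V) => finrank K S) ?_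
  ext ⟨x, y⟩
  constructor
  · rintro ⟨⟨a, ha⟩, ⟨b, hb⟩⟩
    obtain ⟨rfl, rfl⟩ := Prod.mk.inj ha
    obtain ⟨h1, h2⟩ := Prod.mk.inj hb
    obtain rfl : b = a := h1
    refine ⟨b, ?_, rfl⟩
    exact sub_eq_zero.2 h2.symm
  · rintro ⟨a, ha, hxy⟩
    obtain ⟨rfl, rfl⟩ := Prod.mk.inj hxy
    refine ⟨⟨a, rfl⟩, ⟨a, Prod.ext rfl ?_⟩⟩
    exact (sub_eq_zero.1 ha).symm

theorem InO.dicksonInv_mul [FiniteDimensional K V] (hQ : Nondefective Q) {g h : V ≃ₗ[K] V}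
    (hg : InO Q g) (hh : InO Q h) : dicksonInv (g * h) = dicksonInv g + dicksonInv h := by
  have hone : InO Q (1 : V ≃ₗ[K] V) := fun _ => rfl
  have key := (hg.isLagrangian_graph hQ).even_finrank_inf hQ.doubleForm (hone.isLagrangian_graph hQ)
    ((hg.mul hh).isLagrangian_graph hQ)
  have hh0 : LinearMap.ker (g.toLinearMap - (g * h).toLinearMap)
      = LinearMap.ker (h.toLinearMap - LinearMap.id) := by
    ext x
    change g x - g (h x) = 0 ↔ h x - x = 0
    rw [← map_sub, LinearEquiv.map_eq_zero_iff, sub_eq_zero, sub_eq_zero, eq_comm]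
  have hgh0 : LinearMap.ker ((1 : V ≃ₗ[K] V).toLinearMap - (g * h).toLinearMap)
      = LinearMap.ker ((g * h).toLinearMap - LinearMap.id) := by
    ext x
    change x - g (h x) = 0 ↔ g (h x) - x = 0
    rw [sub_eq_zero, sub_eq_zero, eq_comm]
  rw [finrank_graph_inf_graph, finrank_graph_inf_graph, finrank_graph_inf_graph, hh0, hgh0,
    LinearMap.finrank_range_of_inj (id_prod_injective _), ← ZMod.natCast_eq_zero_iff_even] at key
  push_cast at key
  rw [dicksonInv_eq_add, dicksonInv_eq_add, dicksonInv_eq_add]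
  rw [show (1 : V ≃ₗ[K] V).toLinearMap = LinearMap.id from rfl] at key
  have h2 : (2 : ZMod 2) = 0 := rfl
  linear_combination key - (finrank K V + finrank K (LinearMap.ker (g.toLinearMap - LinearMap.id))
    + finrank K (LinearMap.ker (h.toLinearMap - LinearMap.id)) : ZMod 2) * h2

/-- An isometry that preserves a Lagrangian has trivial Dickson invariant. -/
theorem IsLagrangian.dicksonInv_eq_zero [FiniteDimensional K V] (hQ : Nondefective Q)
    {L : Submodule K V} (hL : IsLagrangian Q L) {g : V ≃ₗ[K] V} (hg : InO Q g)
    (hgL : ∀ x ∈ L, g x ∈ L) : dicksonInv g = 0 := by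
  have hone : InO Q (1 : V ≃ₗ[K] V) := fun _ => rfl
  have key := (hg.isLagrangian_graph hQ).even_finrank_inf hQ.doubleForm (hone.isLagrangian_graph hQ)
    hL.prod
  have hgr : ∀ h : V ≃ₗ[K] V, (∀ x ∈ L, h x ∈ L) →
      finrank K ↥(LinearMap.range (LinearMap.id.prod h.toLinearMap) ⊓ L.prod L) = finrank K L := by
    intro h hh
    rw [← finrank_map_of_injective (id_prod_injective h.toLinearMap) L]
    refine congrArg (fun S : Submodule K (V × V) => finrank K S) ?_
    ext ⟨x, y⟩
    constructor
    · rintro ⟨⟨a, ha⟩, h1, h2⟩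
      obtain ⟨rfl, rfl⟩ := Prod.mk.inj ha
      exact ⟨_, h1, rfl⟩
    · rintro ⟨a, ha, hxy⟩
      obtain ⟨rfl, rfl⟩ := Prod.mk.inj hxy
      exact ⟨⟨a, rfl⟩, ha, hh a ha⟩
  rw [finrank_graph_inf_graph, hgr g hgL, hgr 1 (fun _ h => h),
    LinearMap.finrank_range_of_inj (id_prod_injective _)] at key
  rw [dicksonInv, ZMod.natCast_eq_zero_iff_even]
  have h := LinearMap.finrank_range_add_finrank_ker (g.toLinearMap - LinearMap.id)
  rw [show (1 : V ≃ₗ[K] V).toLinearMap = LinearMap.id from rfl] at key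
  rw [Nat.even_iff] at key ⊢
  omega

/-- The Cayley-type argument: if `-1` is not an eigenvalue of an isometry, its Dickson invariant
is trivial. -/
theorem InO.dicksonInv_eq_zero_of_ker_add [FiniteDimensional K V] (hQ : Nondefective Q)
    {g : V ≃ₗ[K] V} (hg : InO Q g) (h : ∀ x, g x + x = 0 → x = 0) : dicksonInv g = 0 := by
  let N : V →ₗ[K] V := g.toLinearMap - LinearMap.id
  let N' : V →ₗ[K] V := g.toLinearMap + LinearMap.id
  have hN'inj : Function.Injective N' := (injective_iff_map_eq_zero N').2 h
  have hN' : Function.Surjective N' := LinearMap.injective_iff_surjective.1 hN'inj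
  let ω : V →ₗ[K] V →ₗ[K] K := Q.polarBilin.compl₁₂ N N'
  have hω : ω.IsAlt := by
    intro x
    change Q.polarBilin (g x - x) (g x + x) = 0
    rw [map_sub, LinearMap.sub_apply, map_add, map_add, polarBilin_comm Q x (g x),
      hg.polarBilin_map]
    ring
  have hker : LinearMap.ker ω = LinearMap.ker N := by
    ext x
    constructor
    · intro hx
      refine LinearMap.mem_ker.2 (hQ.eq_zero fun w => ?_)
      obtain ⟨w', rfl⟩ := hN' w
      exact LinearMap.congr_fun (LinearMap.mem_ker.1 hx) w'
    · intro hx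
      refine LinearMap.mem_ker.2 (LinearMap.ext fun w => ?_)
      change Q.polarBilin (N x) (N' w) = 0
      rw [LinearMap.mem_ker.1 hx, map_zero, LinearMap.zero_apply]
  have h1 := LinearMap.finrank_range_add_finrank_ker ω
  have h2 := LinearMap.finrank_range_add_finrank_ker N
  have h3 := hω.even_finrank_range
  rw [hker] at h1
  rw [dicksonInv, ZMod.natCast_eq_zero_iff_even]
  change Even (finrank K (LinearMap.range N))
  rwa [show finrank K (LinearMap.range N) = finrank K (LinearMap.range ω) by omega]

/-- In characteristic two, an isometry commuting with a map `C` whose adjoint is `-1 - C` has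
trivial Dickson invariant. -/
theorem InO.dicksonInv_eq_zero_of_commute [FiniteDimensional K V] (hQ : Nondefective Q)
    (h2 : (2 : K) = 0) {g : V ≃ₗ[K] V} (hg : InO Q g) (C : V →ₗ[K] V)
    (hC : ∀ x y, Q.polarBilin (C x) y = -Q.polarBilin x y - Q.polarBilin x (C y))
    (hgC : ∀ x, g (C x) = C (g x)) : dicksonInv g = 0 := by
  let N : V →ₗ[K] V := g.toLinearMap - LinearMap.id
  have hNapp : ∀ x, N x = g x - x := fun _ => rfl
  have hNC : ∀ x, N (C x) = C (N x) := fun x => by rw [hNapp, hNapp, map_sub, hgC]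
  let I := LinearMap.range N
  obtain ⟨κ, hκ⟩ := LinearMap.exists_rightInverse_of_surjective N.rangeRestrict
    N.range_rangeRestrict
  have hκ' : ∀ u : I, N (κ u) = u := fun u => congrArg Subtype.val (LinearMap.congr_fun hκ u)
  have hperp : ∀ k, N k = 0 → ∀ v, Q.polarBilin k (N v) = 0 := by
    intro k hk v
    rw [hNapp, sub_eq_zero] at hk
    rw [hNapp, map_sub]
    nth_rewrite 1 [← hk]
    rw [hg.polarBilin_map, sub_self]
  let CI : I →ₗ[K] I := C.restrict (p := I) (q := I) (by
    rintro _ ⟨x, rfl⟩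
    exact ⟨C x, hNC x⟩)
  have hCI : ∀ u : I, ((CI u : I) : V) = C u := fun _ => rfl
  let χ : I →ₗ[K] Dual K I := Q.polarBilin.compl₁₂ κ I.subtype
  have hχ : ∀ u v : I, χ u v = Q.polarBilin (κ u) v := fun _ _ => rfl
  have hinj : Function.Injective χ := by
    refine (injective_iff_map_eq_zero χ).2 fun u hu => ?_
    have h1 : N (κ u) = 0 := by
      rw [hNapp, sub_eq_zero]
      refine (sub_eq_zero.1 (hQ.eq_zero fun w => ?_)).symm
      obtain ⟨v, rfl⟩ : ∃ v, g v = w := ⟨g.symm w, g.apply_symm_apply w⟩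
      have h3 : χ u ⟨N v, v, rfl⟩ = 0 := by rw [hu]; rfl
      rw [hχ] at h3
      change Q.polarBilin (κ u) (g v - v) = 0 at h3
      rw [map_sub] at h3
      rw [map_sub, LinearMap.sub_apply, hg.polarBilin_map]
      exact h3
    rw [hκ'] at h1
    exact Subtype.ext h1
  let e : I ≃ₗ[K] Dual K I := LinearEquiv.ofInjectiveOfFinrankEq χ hinj
    (Subspace.dual_finrank_eq).symm
  have he : ∀ u, e u = χ u := fun _ => rfl
  have hconj : e.conj CI = Dual.transpose (-LinearMap.id - CI) := by
    refine LinearMap.ext fun f => ?_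
    obtain ⟨u, rfl⟩ := e.surjective f
    rw [LinearEquiv.conj_apply_apply, LinearEquiv.symm_apply_apply]
    refine LinearMap.ext fun v => ?_
    rw [he, hχ]
    change _ = χ u (-v - CI v)
    rw [map_sub, map_neg, hχ, hχ, hCI, ← hC]
    have h3 : N (κ (CI u) - C (κ u)) = 0 := by
      rw [map_sub, hκ', hNC, hκ', hCI, sub_self]
    obtain ⟨w, hw⟩ := v.2
    have h4 := hperp _ h3 w
    rwa [hw, map_sub, LinearMap.sub_apply, sub_eq_zero] at h4
  have htr := LinearMap.trace_conj' CI e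
  rw [hconj, LinearMap.trace_transpose', map_sub, map_neg, LinearMap.trace_id] at htr
  have hdim : ((finrank K I : ℕ) : K) = 0 := by
    linear_combination -htr - (LinearMap.trace K I CI) * h2
  rw [dicksonInv, ZMod.natCast_eq_zero_iff_even]
  change Even (finrank K I)
  have hchar : CharP K 2 := CharTwo.of_one_ne_zero_of_two_eq_zero one_ne_zero h2
  exact even_iff_two_dvd.2 ((CharP.cast_eq_zero_iff K 2 _).1 hdim)

end Dickson

section Gluing

variable [Field K] [AddCommGroup V] [Module K V] {Q : QuadraticForm K V}

/-- `σ` is an isometric involution that conjugates `φ` to its inverse. -/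
structure IsReverser (Q : QuadraticForm K V) (φ σ : V ≃ₗ[K] V) : Prop where
  inO : InO Q σ
  invol : ∀ x, σ (σ x) = x
  rev : ∀ x, σ (φ (σ (φ x))) = x

/-- `φ` is reversed by an isometric involution of Dickson invariant `d`. -/
def HasReverser (Q : QuadraticForm K V) (φ : V ≃ₗ[K] V) (d : ZMod 2) : Prop :=
  ∃ σ, IsReverser Q φ σ ∧ dicksonInv σ = d

/-- The restriction of a quadratic form to a subspace. -/
noncomputable abbrev formOn (Q : QuadraticForm K V) (W : Submodule K V) : QuadraticForm K W :=
  Q.comp W.subtype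

theorem nondefective_formOn {W : Submodule K V}
    (h : ∀ u ∈ W, (∀ w ∈ W, Q.polarBilin u w = 0) → u = 0) : Nondefective (formOn Q W) :=
  fun u hu => Subtype.ext (h u u.2 fun w hw => hu ⟨w, hw⟩)

/-- The restriction of an automorphism to an invariant subspace. -/
noncomputable def restrictEquiv [FiniteDimensional K V] (g : V ≃ₗ[K] V) (W : Submodule K V)
    (h : ∀ x ∈ W, g x ∈ W) : W ≃ₗ[K] W :=
  LinearEquiv.ofInjectiveEndo (g.toLinearMap.restrict h) fun _ _ hxy =>
    Subtype.ext (g.injective (congrArg Subtype.val hxy))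

theorem coe_restrictEquiv [FiniteDimensional K V] (g : V ≃ₗ[K] V) (W : Submodule K V)
    (h : ∀ x ∈ W, g x ∈ W) (x : W) : (restrictEquiv g W h x : V) = g x := rfl

theorem Nondefective.nondegenerate_left (hQ : Nondefective Q) {W W' : Submodule K V}
    (hc : IsCompl W W') (ho : ∀ w ∈ W, ∀ w' ∈ W', Q.polarBilin w w' = 0) :
    ∀ u ∈ W, (∀ w ∈ W, Q.polarBilin u w = 0) → u = 0 := by
  refine fun u hu h => hQ.eq_zero fun v => ?_
  obtain ⟨w, hw, w', hw', rfl⟩ := Submodule.mem_sup.1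
    (show v ∈ W ⊔ W' by rw [hc.sup_eq_top]; trivial)
  rw [map_add, h w hw, ho u hu w' hw', add_zero]

theorem Nondefective.nondefective_formOn_left (hQ : Nondefective Q) {W W' : Submodule K V}
    (hc : IsCompl W W') (ho : ∀ w ∈ W, ∀ w' ∈ W', Q.polarBilin w w' = 0) :
    Nondefective (formOn Q W) :=
  nondefective_formOn (hQ.nondegenerate_left hc ho)

theorem exists_glue {W W' : Submodule K V} (hc : IsCompl W W') (σ : W ≃ₗ[K] W)
    (σ' : W' ≃ₗ[K] W') :
    ∃ g : V ≃ₗ[K] V, (∀ w : W, g w = σ w) ∧ ∀ w : W', g w = σ' w := by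
  let e := Submodule.prodEquivOfIsCompl W W' hc
  refine ⟨e.symm ≪≫ₗ (σ.prodCongr σ') ≪≫ₗ e, fun w => ?_, fun w => ?_⟩
  · have h : e.symm w = (w, 0) := by
      rw [LinearEquiv.symm_apply_eq]
      simp [e]
    simp [h, e]
  · have h : e.symm w = (0, w) := by
      rw [LinearEquiv.symm_apply_eq]
      simp [e]
    simp [h, e]

variable [FiniteDimensional K V]

theorem mem_of_map_mem {g : V ≃ₗ[K] V} {W : Submodule K V} (h : ∀ x ∈ W, g x ∈ W) {x : V}
    (hx : g x ∈ W) : x ∈ W := by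
  obtain ⟨y, hy⟩ := (restrictEquiv g W h).surjective ⟨g x, hx⟩
  have h1 : g y = g x := congrArg Subtype.val hy
  rw [← g.injective h1]
  exact y.2

theorem InO.inO_restrictEquiv {g : V ≃ₗ[K] V} (hg : InO Q g) {W : Submodule K V}
    (h : ∀ x ∈ W, g x ∈ W) : InO (formOn Q W) (restrictEquiv g W h) :=
  fun v => hg v

theorem InO.polarOrth_invariant {g : V ≃ₗ[K] V} (hg : InO Q g) {W : Submodule K V}
    (h : ∀ x ∈ W, g x ∈ W) : ∀ x ∈ polarOrth Q W, g x ∈ polarOrth Q W := by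
  intro x hx w hw
  change Q.polarBilin w (g x) = 0
  have h1 : g (g.symm w) = w := g.apply_symm_apply w
  rw [← h1, hg.polarBilin_map]
  exact hx _ (mem_of_map_mem h (by rwa [h1]))

theorem Nondefective.isCompl_polarOrth (hQ : Nondefective Q) {W : Submodule K V}
    (h : ∀ u ∈ W, (∀ w ∈ W, Q.polarBilin u w = 0) → u = 0) : IsCompl W (polarOrth Q W) := by
  have hdisj : W ⊓ polarOrth Q W = ⊥ := by
    rw [eq_bot_iff]
    rintro x ⟨hx, hx'⟩
    refine (Submodule.mem_bot K).2 (h x hx fun w hw => ?_)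
    rw [polarBilin_comm]
    exact hx' w hw
  refine ⟨disjoint_iff.2 hdisj, codisjoint_iff.2 ?_⟩
  apply Submodule.eq_top_of_finrank_eq
  have h1 := Submodule.finrank_sup_add_finrank_inf_eq W (polarOrth Q W)
  have h2 := hQ.finrank_polarOrth W
  rw [hdisj, finrank_bot] at h1
  omega

theorem dicksonInv_eq_restrictEquiv_add {W W' : Submodule K V} (hc : IsCompl W W')
    (g : V ≃ₗ[K] V) (h : ∀ x ∈ W, g x ∈ W) (h' : ∀ x ∈ W', g x ∈ W') :
    dicksonInv g = dicksonInv (restrictEquiv g W h) + dicksonInv (restrictEquiv g W' h') := by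
  let A := (LinearMap.range ((restrictEquiv g W h).toLinearMap - LinearMap.id)).map W.subtype
  let A' := (LinearMap.range ((restrictEquiv g W' h').toLinearMap - LinearMap.id)).map W'.subtype
  have hA : A ≤ W := Submodule.map_subtype_le _ _
  have hA' : A' ≤ W' := Submodule.map_subtype_le _ _
  have hr : LinearMap.range (g.toLinearMap - LinearMap.id) = A ⊔ A' := by
    apply le_antisymm
    · rintro _ ⟨v, rfl⟩
      obtain ⟨w, hw, w', hw', rfl⟩ := Submodule.mem_sup.1
        (show v ∈ W ⊔ W' by rw [hc.sup_eq_top]; trivial)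
      rw [map_add]
      exact Submodule.add_mem_sup ⟨_, ⟨⟨w, hw⟩, rfl⟩, rfl⟩ ⟨_, ⟨⟨w', hw'⟩, rfl⟩, rfl⟩
    · refine sup_le ?_ ?_
      · rintro _ ⟨_, ⟨w, rfl⟩, rfl⟩
        exact ⟨w, rfl⟩
      · rintro _ ⟨_, ⟨w, rfl⟩, rfl⟩
        exact ⟨w, rfl⟩
  have hd : A ⊓ A' = ⊥ := by
    rw [eq_bot_iff, ← hc.inf_eq_bot]
    exact inf_le_inf hA hA'
  have hf := Submodule.finrank_sup_add_finrank_inf_eq A A'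
  rw [hd, finrank_bot, add_zero, ← hr, finrank_map_of_injective W.injective_subtype,
    finrank_map_of_injective W'.injective_subtype] at hf
  rw [dicksonInv, hf, Nat.cast_add]
  rfl

theorem HasReverser.glue {W W' : Submodule K V} (hc : IsCompl W W')
    (ho : ∀ w ∈ W, ∀ w' ∈ W', Q.polarBilin w w' = 0) {φ : V ≃ₗ[K] V}
    {h : ∀ x ∈ W, φ x ∈ W} {h' : ∀ x ∈ W', φ x ∈ W'} {d d' : ZMod 2}
    (hd : HasReverser (formOn Q W) (restrictEquiv φ W h) d)
    (hd' : HasReverser (formOn Q W') (restrictEquiv φ W' h') d') :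
    HasReverser Q φ (d + d') := by
  obtain ⟨σ, hσ, rfl⟩ := hd
  obtain ⟨σ', hσ', rfl⟩ := hd'
  obtain ⟨g, hg, hg'⟩ := exists_glue hc σ σ'
  have hgW : ∀ x ∈ W, g x ∈ W := fun x hx => by rw [hg ⟨x, hx⟩]; exact (σ ⟨x, hx⟩).2
  have hgW' : ∀ x ∈ W', g x ∈ W' := fun x hx => by rw [hg' ⟨x, hx⟩]; exact (σ' ⟨x, hx⟩).2
  have dec : ∀ v, ∃ (w : W) (w' : W'), v = (w : V) + w' := by
    intro v
    obtain ⟨w, hw, w', hw', rfl⟩ := Submodule.mem_sup.1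
      (show v ∈ W ⊔ W' by rw [hc.sup_eq_top]; trivial)
    exact ⟨⟨w, hw⟩, ⟨w', hw'⟩, rfl⟩
  have hφ : ∀ w : W, φ w = restrictEquiv φ W h w := fun _ => rfl
  have hφ' : ∀ w : W', φ w = restrictEquiv φ W' h' w := fun _ => rfl
  refine ⟨g, ⟨?_, ?_, ?_⟩, ?_⟩
  · intro v
    obtain ⟨w, w', rfl⟩ := dec v
    have e1 : Q (σ w) = Q w := hσ.inO w
    have e2 : Q (σ' w') = Q w' := hσ'.inO w'
    rw [map_add, hg, hg', map_add_polarBilin, map_add_polarBilin, ho _ w.2 _ w'.2,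
      ho _ (σ w).2 _ (σ' w').2, e1, e2]
  · intro v
    obtain ⟨w, w', rfl⟩ := dec v
    rw [map_add, map_add, hg, hg, hg', hg', hσ.invol, hσ'.invol]
  · intro v
    obtain ⟨w, w', rfl⟩ := dec v
    rw [map_add, map_add, map_add, map_add, hφ, hφ', hg, hg', hφ, hφ', hg, hg', hσ.rev, hσ'.rev]
  · rw [dicksonInv_eq_restrictEquiv_add hc g hgW hgW']
    congr 2
    · exact LinearEquiv.ext fun w => Subtype.ext (hg w)
    · exact LinearEquiv.ext fun w => Subtype.ext (hg' w)

/-- An involution of a parameter space that preserves the pulled back form descends to an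
isometric involution of a nondegenerate image. -/
theorem exists_isReverser_range {φ : V ≃ₗ[K] V} {M : Type*} [AddCommGroup M] [Module K M]
    (π : M →ₗ[K] V) (J S : M →ₗ[K] M) {W : Submodule K V} (hW : LinearMap.range π = W)
    (hnd : ∀ u ∈ W, (∀ w ∈ W, Q.polarBilin u w = 0) → u = 0)
    (hJ : ∀ m, π (J (J m)) = π m) (hJQ : ∀ m, Q (π (J m)) = Q (π m))
    (hS : ∀ m, π (S m) = φ (π m)) (hSJ : ∀ m, π (J (S (J (S m)))) = π m)
    (hφ : ∀ x ∈ W, φ x ∈ W) :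
    ∃ σ, IsReverser (formOn Q W) (restrictEquiv φ W hφ) σ ∧
      ∀ m (w : W), (w : V) = π m → (σ w : V) = π (J m) := by
  subst hW
  obtain ⟨κ, hκ⟩ := LinearMap.exists_rightInverse_of_surjective π.rangeRestrict
    π.range_rangeRestrict
  have hκ' : ∀ w, π (κ w) = w := fun w => congrArg Subtype.val (LinearMap.congr_fun hκ w)
  have hB : ∀ m n, Q.polarBilin (π (J m)) (π (J n)) = Q.polarBilin (π m) (π n) := by
    intro m n
    have h := hJQ (m + n)
    rw [map_add J, map_add π, map_add π, map_add_polarBilin, map_add_polarBilin, hJQ, hJQ] at h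
    exact add_left_cancel h
  have hker : ∀ m, π m = 0 → π (J m) = 0 := by
    intro m hm
    refine hnd _ ⟨_, rfl⟩ ?_
    rintro _ ⟨n, rfl⟩
    rw [← hJ n, hB, hm, map_zero, LinearMap.zero_apply]
  let s : LinearMap.range π →ₗ[K] LinearMap.range π := π.rangeRestrict ∘ₗ J ∘ₗ κ
  have hs : ∀ m, s (π.rangeRestrict m) = π.rangeRestrict (J m) := by
    intro m
    refine Subtype.ext ?_
    change π (J (κ (π.rangeRestrict m))) = π (J m)
    rw [← sub_eq_zero, ← map_sub, ← map_sub]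
    refine hker _ ?_
    rw [map_sub, hκ', sub_eq_zero]
    rfl
  have hss : ∀ w, s (s w) = w := by
    intro w
    obtain ⟨m, rfl⟩ := π.surjective_rangeRestrict w
    rw [hs, hs]
    exact Subtype.ext (hJ m)
  let σ : LinearMap.range π ≃ₗ[K] LinearMap.range π :=
    LinearEquiv.ofInvolutive s hss
  have hσ : ∀ m, σ (π.rangeRestrict m) = π.rangeRestrict (J m) := hs
  have hφ' : ∀ m, restrictEquiv φ _ hφ (π.rangeRestrict m) = π.rangeRestrict (S m) :=
    fun m => Subtype.ext (hS m).symm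
  refine ⟨σ, ⟨?_, hss, ?_⟩, ?_⟩
  · intro w
    obtain ⟨m, rfl⟩ := π.surjective_rangeRestrict w
    rw [hσ]
    exact hJQ m
  · intro w
    obtain ⟨m, rfl⟩ := π.surjective_rangeRestrict w
    rw [hφ', hσ, hφ', hσ]
    exact Subtype.ext (hSJ m)
  · rintro m ⟨w, hw⟩ rfl
    exact congrArg Subtype.val (hσ m)

end Gluing

section Socle

open LaurentPolynomial

variable [Field K] [AddCommGroup V] [Module K V] {Q : QuadraticForm K V} {φ : V ≃ₗ[K] V}

theorem exists_laurentAct_eq_socle {P : K[T;T⁻¹]} (hP : ∀ r, P ∣ r ∨ IsCoprime r P) {n : ℕ}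
    {x : V} (hx : laurentAct φ (P ^ (n + 1)) x = 0) {r : K[T;T⁻¹]} (hr : laurentAct φ r x ≠ 0) :
    ∃ q, laurentAct φ (q * r) x = laurentAct φ (P ^ n) x := by
  induction n generalizing x r with
  | zero =>
    rcases hP r with ⟨c, rfl⟩ | ⟨a, b, hab⟩
    · rw [mul_comm, laurentAct_mul] at hr
      rw [zero_add, pow_one] at hx
      rw [hx, map_zero] at hr
      exact absurd rfl hr
    · refine ⟨a, ?_⟩
      rw [zero_add, pow_one] at hx
      rw [pow_zero, ← hab, laurentAct_add, laurentAct_mul φ b, hx, map_zero, add_zero]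
  | succ k ih =>
    rcases hP r with ⟨c, rfl⟩ | h
    · rw [mul_comm, laurentAct_mul] at hr
      rw [pow_succ, laurentAct_mul] at hx
      obtain ⟨q, hq⟩ := ih hx hr
      refine ⟨q, ?_⟩
      rw [mul_comm P c, ← mul_assoc, laurentAct_mul, hq, pow_succ, laurentAct_mul]
    · obtain ⟨a, b, hab⟩ := h.pow_right (n := k + 1 + 1)
      refine ⟨P ^ (k + 1) * a, ?_⟩
      have : P ^ (k + 1) * a * r = P ^ (k + 1) - P ^ (k + 1) * b * P ^ (k + 1 + 1) := by
        linear_combination P ^ (k + 1) * hab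
      rw [this, laurentAct_sub, laurentAct_mul φ _ (P ^ (k + 1 + 1)), hx, map_zero, sub_zero]

theorem pow_dvd_of_laurentAct_eq_zero {P : K[T;T⁻¹]} (hP : ∀ r, P ∣ r ∨ IsCoprime r P) {n : ℕ}
    {x : V} (hx : laurentAct φ (P ^ (n + 1)) x = 0) (hx' : laurentAct φ (P ^ n) x ≠ 0)
    {r : K[T;T⁻¹]} (hr : laurentAct φ r x = 0) : P ^ (n + 1) ∣ r := by
  induction n generalizing x r with
  | zero =>
    rcases hP r with h | ⟨a, b, hab⟩
    · simpa using h
    · rw [zero_add, pow_one] at hx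
      rw [pow_zero, ← hab, laurentAct_add, laurentAct_mul φ b, hx, laurentAct_mul, hr, map_zero,
        map_zero, add_zero] at hx'
      exact absurd rfl hx'
  | succ k ih =>
    rcases hP r with ⟨c, rfl⟩ | h
    · rw [mul_comm, laurentAct_mul] at hr
      rw [pow_succ, laurentAct_mul] at hx hx'
      rw [pow_succ']
      exact mul_dvd_mul_left P (ih hx hx' hr)
    · obtain ⟨a, b, hab⟩ := h.pow_right (n := k + 1 + 1)
      have h1 : x = 0 := by
        rw [← laurentAct_one φ x, ← hab, laurentAct_add, laurentAct_mul φ a, laurentAct_mul φ b,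
          hx, hr, map_zero, map_zero, add_zero]
      rw [h1, map_zero] at hx'
      exact absurd rfl hx'

/-- The map `(r, w) ↦ r • x + w • z`. -/
noncomputable def pairMap (φ : V ≃ₗ[K] V) (x z : V) : K[T;T⁻¹] × K[T;T⁻¹] →ₗ[K] V :=
  ((laurentAct φ).toLinearMap.flip x).coprod ((laurentAct φ).toLinearMap.flip z)

theorem pairMap_apply (x z : V) (r w : K[T;T⁻¹]) :
    pairMap φ x z (r, w) = laurentAct φ r x + laurentAct φ w z := rfl

theorem pairMap_invariant (x z : V) :
    ∀ v ∈ LinearMap.range (pairMap φ x z), φ v ∈ LinearMap.range (pairMap φ x z) := by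
  rintro _ ⟨⟨r, w⟩, rfl⟩
  refine ⟨(T 1 * r, T 1 * w), ?_⟩
  rw [pairMap_apply, pairMap_apply, laurentAct_mul, laurentAct_mul, laurentAct_T_one,
    laurentAct_T_one, map_add]

theorem laurentAct_mem_range_pairMap (x z : V) (r : K[T;T⁻¹]) :
    laurentAct φ r x ∈ LinearMap.range (pairMap φ x z) :=
  ⟨(r, 0), by rw [pairMap_apply, laurentAct_zero, add_zero]⟩

theorem laurentAct_mem_range_pairMap' (x z : V) (r : K[T;T⁻¹]) :
    laurentAct φ r z ∈ LinearMap.range (pairMap φ x z) :=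
  ⟨(0, r), by rw [pairMap_apply, laurentAct_zero, zero_add]⟩

/-- Multiplication by `T` on both components. -/
noncomputable def pairShift (K : Type*) [Field K] :
    K[T;T⁻¹] × K[T;T⁻¹] →ₗ[K] K[T;T⁻¹] × K[T;T⁻¹] :=
  (LinearMap.mulLeft K (T 1)).prodMap (LinearMap.mulLeft K (T 1))

theorem pairShift_apply (r w : K[T;T⁻¹]) : pairShift K (r, w) = (T 1 * r, T 1 * w) := by
  rw [pairShift, LinearMap.prodMap_apply, LinearMap.mulLeft_apply, LinearMap.mulLeft_apply]

theorem pairMap_pairShift (x z : V) (m : K[T;T⁻¹] × K[T;T⁻¹]) :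
    pairMap φ x z (pairShift K m) = φ (pairMap φ x z m) := by
  obtain ⟨r, w⟩ := m
  rw [pairShift_apply, pairMap_apply, pairMap_apply, laurentAct_mul, laurentAct_mul,
    laurentAct_T_one, laurentAct_T_one, map_add]

theorem T_one_mul_invert_T_one_mul (r : K[T;T⁻¹]) : T 1 * invert (T 1 * r) = invert r := by
  rw [map_mul, invert_T, ← mul_assoc, ← T_add, add_neg_cancel, T_zero, one_mul]

variable [FiniteDimensional K V]

/-- A reverser fixing `z` and sending `x` to `e • x`, on a nondegenerate space generated by two
vectors. -/
theorem InO.exists_isReverser_pair (hφ : InO Q φ) {x z : V} (e : K[T;T⁻¹]) {W : Submodule K V}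
    (hW : LinearMap.range (pairMap φ x z) = W)
    (hnd : ∀ u ∈ W, (∀ w ∈ W, Q.polarBilin u w = 0) → u = 0)
    (he : laurentAct φ (e * invert e) x = x)
    (hQe : ∀ r, Q (laurentAct φ (e * invert r) x) = Q (laurentAct φ r x))
    (hℓ : ∀ r, Q.polarBilin (laurentAct φ (e * invert r) x) z = Q.polarBilin (laurentAct φ r x) z)
    (hφW : ∀ v ∈ W, φ v ∈ W) :
    ∃ σ, IsReverser (formOn Q W) (restrictEquiv φ W hφW) σ ∧
      ∀ r w (v : W), (v : V) = laurentAct φ r x + laurentAct φ w z →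
        (σ v : V) = laurentAct φ (e * invert r) x + laurentAct φ (invert w) z := by
  let J : K[T;T⁻¹] × K[T;T⁻¹] →ₗ[K] K[T;T⁻¹] × K[T;T⁻¹] :=
    (LinearMap.mulLeft K e ∘ₗ (invert (R := K)).toLinearMap).prodMap (invert (R := K)).toLinearMap
  have hJ : ∀ r w, J (r, w) = (e * invert r, invert w) := fun _ _ => rfl
  have hee : ∀ r, laurentAct φ (e * invert (e * invert r)) x = laurentAct φ r x := by
    intro r
    rw [map_mul invert, invert_invert_apply, show e * (invert e * r) = r * (e * invert e) by ring,
      laurentAct_mul, he]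
  have hSJ : ∀ r w, pairShift K (J (pairShift K (r, w))) = (e * invert r, invert w) := by
    intro r w
    rw [pairShift_apply, hJ, pairShift_apply, mul_left_comm, T_one_mul_invert_T_one_mul,
      T_one_mul_invert_T_one_mul]
  refine (exists_isReverser_range (φ := φ) (Q := Q) (pairMap φ x z) J (pairShift K) hW hnd ?_ ?_
    (pairMap_pairShift x z) ?_ hφW).imp fun σ h => ⟨h.1, fun r w v hv => h.2 (r, w) v hv⟩
  · rintro ⟨r, w⟩
    rw [hJ, hJ, pairMap_apply, pairMap_apply, hee, invert_invert_apply]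
  · rintro ⟨r, w⟩
    rw [hJ, pairMap_apply, pairMap_apply, map_add_polarBilin, map_add_polarBilin, hQe,
      hφ.map_laurentAct_invert_self, hφ.polarBilin_laurentAct_laurentAct,
      hφ.polarBilin_laurentAct_laurentAct, invert_invert_apply]
    congr 1
    rw [← hℓ (r * invert w), map_mul invert, invert_invert_apply, mul_assoc]
  · rintro ⟨r, w⟩
    rw [hSJ, hJ, pairMap_apply, pairMap_apply, hee, invert_invert_apply]

/-- A reverser exchanging the two generators. -/
theorem InO.exists_isReverser_swap (hφ : InO Q φ) {x z : V} {W : Submodule K V}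
    (hW : LinearMap.range (pairMap φ x z) = W)
    (hnd : ∀ u ∈ W, (∀ w ∈ W, Q.polarBilin u w = 0) → u = 0)
    (hxz : ∀ r, Q (laurentAct φ (invert r) x) = Q (laurentAct φ r z))
    (hφW : ∀ v ∈ W, φ v ∈ W) :
    ∃ σ, IsReverser (formOn Q W) (restrictEquiv φ W hφW) σ ∧
      ∀ r w (v : W), (v : V) = laurentAct φ r x + laurentAct φ w z →
        (σ v : V) = laurentAct φ (invert w) x + laurentAct φ (invert r) z := by
  let J : K[T;T⁻¹] × K[T;T⁻¹] →ₗ[K] K[T;T⁻¹] × K[T;T⁻¹] :=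
    ((invert (R := K)).toLinearMap ∘ₗ LinearMap.snd K _ _).prod
      ((invert (R := K)).toLinearMap ∘ₗ LinearMap.fst K _ _)
  have hJ : ∀ r w, J (r, w) = (invert w, invert r) := fun _ _ => rfl
  have hSJ : ∀ r w, pairShift K (J (pairShift K (r, w))) = (invert w, invert r) := by
    intro r w
    rw [pairShift_apply, hJ, pairShift_apply, T_one_mul_invert_T_one_mul,
      T_one_mul_invert_T_one_mul]
  refine (exists_isReverser_range (φ := φ) (Q := Q) (pairMap φ x z) J (pairShift K) hW hnd ?_ ?_
    (pairMap_pairShift x z) ?_ hφW).imp fun σ h => ⟨h.1, fun r w v hv => h.2 (r, w) v hv⟩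
  · rintro ⟨r, w⟩
    rw [hJ, hJ, invert_invert_apply, invert_invert_apply]
  · rintro ⟨r, w⟩
    rw [hJ, pairMap_apply, pairMap_apply, map_add_polarBilin, map_add_polarBilin, hxz,
      ← hxz (invert r), invert_invert_apply, hφ.polarBilin_laurentAct_laurentAct,
      hφ.polarBilin_laurentAct_laurentAct, invert_invert_apply, mul_comm (invert w),
      add_comm (Q (laurentAct φ w z))]
  · rintro ⟨r, w⟩
    rw [hSJ, hJ, invert_invert_apply, invert_invert_apply]

end Socle

section Frobenius

open LaurentPolynomial

variable [Field K]

/-- The truncated ring `K[T;T⁻¹] / (T - 1) ^ (n + 1)` is a Frobenius algebra: any functional that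
does not vanish on the socle generates the dual. -/
theorem exists_eq_apply_mul {ℓ : K[T;T⁻¹] →ₗ[K] K} {n : ℕ}
    (hℓ : ∀ r, ℓ ((T 1 - 1) ^ (n + 1) * r) = 0) (hn : ℓ ((T 1 - 1) ^ n) ≠ 0)
    {μ : K[T;T⁻¹] →ₗ[K] K} (hμ : ∀ r, μ ((T 1 - 1) ^ (n + 1) * r) = 0) :
    ∃ w, ∀ r, μ r = ℓ (w * r) := by
  suffices h : ∀ j ≤ n + 1, ∀ μ : K[T;T⁻¹] →ₗ[K] K, (∀ r, μ ((T 1 - 1) ^ j * r) = 0) →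
      ∃ w, ∀ r, μ r = ℓ (w * r) from h _ le_rfl μ hμ
  intro j
  induction j with
  | zero =>
    intro _ μ hμ
    exact ⟨0, fun r => by simpa using hμ r⟩
  | succ j ih =>
    intro hj μ hμ
    set c := μ ((T 1 - 1) ^ j) / ℓ ((T 1 - 1) ^ n) with hc
    have hpow : ((T 1 - 1 : K[T;T⁻¹])) ^ (n - j) * (T 1 - 1) ^ j = (T 1 - 1) ^ n := by
      rw [← pow_add, Nat.sub_add_cancel (by omega)]
    obtain ⟨w, hw⟩ := ih (by omega)
      (μ - c • (ℓ ∘ₗ LinearMap.mulLeft K ((T 1 - 1) ^ (n - j)))) (by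
        intro r
        obtain ⟨a, d, hd⟩ := T_sub_one_dvd_sub_C r
        have hr : (T 1 - 1 : K[T;T⁻¹]) ^ j * r = a • (T 1 - 1) ^ j + (T 1 - 1) ^ (j + 1) * d := by
          rw [LaurentPolynomial.smul_eq_C_mul]
          linear_combination (T 1 - 1 : K[T;T⁻¹]) ^ j * hd
        have h2 : (T 1 - 1 : K[T;T⁻¹]) ^ (n - j) * ((T 1 - 1) ^ j * r)
            = a • (T 1 - 1) ^ n + (T 1 - 1) ^ (n + 1) * d := by
          rw [hr, mul_add, mul_smul_comm, hpow, pow_succ _ n, ← hpow]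
          ring
        rw [LinearMap.sub_apply, LinearMap.smul_apply, LinearMap.comp_apply,
          LinearMap.mulLeft_apply, h2, hr, map_add, map_add, hμ, hℓ, map_smul, map_smul, hc,
          smul_eq_mul, smul_eq_mul, smul_eq_mul]
        field_simp
        ring)
    refine ⟨w + c • (T 1 - 1) ^ (n - j), fun r => ?_⟩
    have := hw r
    rw [LinearMap.sub_apply, LinearMap.smul_apply, LinearMap.comp_apply,
      LinearMap.mulLeft_apply, sub_eq_iff_eq_add] at this
    rw [this, add_mul, map_add, smul_mul_assoc, map_smul]

variable [AddCommGroup V] [Module K V] {Q : QuadraticForm K V} {φ : V ≃ₗ[K] V}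

/-- The functional `r ↦ B(r • x, z)`. -/
noncomputable def pairing (Q : QuadraticForm K V) (φ : V ≃ₗ[K] V) (x z : V) :
    K[T;T⁻¹] →ₗ[K] K :=
  Q.polarBilin.flip z ∘ₗ (laurentAct φ).toLinearMap.flip x

theorem pairing_apply (x z : V) (r : K[T;T⁻¹]) :
    pairing Q φ x z r = Q.polarBilin (laurentAct φ r x) z := rfl

/-- Any functional killed by `(T - 1) ^ (n + 1)` is represented by a vector paired with `x`. -/
theorem InO.exists_polarBilin_eq (hφ : InO Q φ) {n : ℕ} {x z₀ : V}
    (hx : laurentAct φ ((T 1 - 1) ^ (n + 1)) x = 0)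
    (hz₀ : laurentAct φ ((T 1 - 1) ^ (n + 1)) z₀ = 0)
    (hxz : Q.polarBilin (laurentAct φ ((T 1 - 1) ^ n) x) z₀ ≠ 0) {μ : K[T;T⁻¹] →ₗ[K] K}
    (hμ : ∀ r, μ ((T 1 - 1) ^ (n + 1) * r) = 0) :
    ∃ z, laurentAct φ ((T 1 - 1) ^ (n + 1)) z = 0 ∧
      ∀ r, Q.polarBilin (laurentAct φ r x) z = μ r := by
  obtain ⟨w, hw⟩ := exists_eq_apply_mul (ℓ := pairing Q φ x z₀) (n := n)
    (fun r => by rw [pairing_apply, mul_comm, laurentAct_mul, hx, map_zero, map_zero,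
      LinearMap.zero_apply]) hxz hμ
  refine ⟨laurentAct φ (invert w) z₀, ?_, fun r => ?_⟩
  · rw [laurentAct_comm, hz₀, map_zero]
  · rw [hw, pairing_apply, mul_comm, hφ.polarBilin_laurentAct_laurentAct, invert_invert_apply]

theorem polarBilin_socle_mul {n : ℕ} {x : V} (hx : laurentAct φ ((T 1 - 1) ^ (n + 1)) x = 0)
    (a : K) (d : K[T;T⁻¹]) (y : V) :
    Q.polarBilin (laurentAct φ ((T 1 - 1) ^ n * (LaurentPolynomial.C a + (T 1 - 1) * d)) x) y
      = a * Q.polarBilin (laurentAct φ ((T 1 - 1) ^ n) x) y := by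
  have h : (T 1 - 1 : K[T;T⁻¹]) ^ n * (LaurentPolynomial.C a + (T 1 - 1) * d)
      = a • (T 1 - 1) ^ n + d * (T 1 - 1) ^ (n + 1) := by
    rw [LaurentPolynomial.smul_eq_C_mul]
    ring
  rw [h, laurentAct_add, laurentAct_mul, hx, map_zero, add_zero, laurentAct_smul, map_smul,
    LinearMap.smul_apply, smul_eq_mul]

theorem invert_T_sub_one : invert (T 1 - 1 : K[T;T⁻¹]) = (T 1 - 1) * -T (-1) := by
  rw [map_sub, invert_T, map_one]
  have h : (T 1 * T (-1) : K[T;T⁻¹]) = 1 := by rw [← T_add]; simp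
  linear_combination h

theorem exists_invert_T_sub_one_pow (b : ℕ) : ∃ d : K[T;T⁻¹],
    invert ((T 1 - 1) ^ b) = (T 1 - 1) ^ b * (LaurentPolynomial.C ((-1) ^ b) + (T 1 - 1) * d) := by
  obtain ⟨d, hd⟩ := sub_dvd_pow_sub_pow (-T (-1) : K[T;T⁻¹]) (-1) b
  refine ⟨T (-1) * d, ?_⟩
  have h : (T 1 * T (-1) : K[T;T⁻¹]) = 1 := by rw [← T_add]; simp
  rw [map_pow, invert_T_sub_one, mul_pow]
  congr 1
  rw [map_pow, map_neg, map_one]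
  linear_combination hd - d * h

theorem InO.polarBilin_pow_pow (hφ : InO Q φ) {a b : ℕ} {x : V}
    (hx : laurentAct φ ((T 1 - 1) ^ (a + b + 1)) x = 0) (y : V) :
    Q.polarBilin (laurentAct φ ((T 1 - 1) ^ a) x) (laurentAct φ ((T 1 - 1) ^ b) y)
      = (-1) ^ b * Q.polarBilin (laurentAct φ ((T 1 - 1) ^ (a + b)) x) y := by
  obtain ⟨d, hd⟩ := exists_invert_T_sub_one_pow (K := K) b
  rw [hφ.polarBilin_laurentAct_laurentAct, hd, ← mul_assoc, ← pow_add, polarBilin_socle_mul hx]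

/-- The socle pairing of `x` and `z` is symmetric up to sign. -/
theorem InO.polarBilin_socle_comm (hφ : InO Q φ) {n : ℕ} {x : V}
    (hx : laurentAct φ ((T 1 - 1) ^ (n + 1)) x = 0) (z : V) :
    Q.polarBilin (laurentAct φ ((T 1 - 1) ^ n) z) x
      = (-1) ^ n * Q.polarBilin (laurentAct φ ((T 1 - 1) ^ n) x) z := by
  have := hφ.polarBilin_pow_pow (a := 0) (b := n) (by rwa [zero_add]) z
  rwa [pow_zero, laurentAct_one, zero_add, polarBilin_comm] at this

theorem InO.nondegenerate_bicyclic (hφ : InO Q φ) {n : ℕ} {x z : V}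
    (hx : laurentAct φ ((T 1 - 1) ^ (n + 1)) x = 0)
    (hz : laurentAct φ ((T 1 - 1) ^ (n + 1)) z = 0)
    (hxx : Q.polarBilin (laurentAct φ ((T 1 - 1) ^ n) x) x = 0)
    (hzz : Q.polarBilin (laurentAct φ ((T 1 - 1) ^ n) z) z = 0)
    (hxz : Q.polarBilin (laurentAct φ ((T 1 - 1) ^ n) x) z ≠ 0) :
    ∀ u ∈ LinearMap.range (pairMap φ x z),
      (∀ w ∈ LinearMap.range (pairMap φ x z), Q.polarBilin u w = 0) → u = 0 := by
  rintro _ ⟨⟨q, w⟩, rfl⟩ hu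
  rw [pairMap_apply] at hu ⊢
  have hzx : Q.polarBilin (laurentAct φ ((T 1 - 1) ^ n) z) x ≠ 0 := by
    rw [hφ.polarBilin_socle_comm hx]
    exact mul_ne_zero (pow_ne_zero _ (neg_ne_zero.2 one_ne_zero)) hxz
  suffices h : ∀ j ≤ n + 1, (T 1 - 1) ^ j ∣ q ∧ (T 1 - 1) ^ j ∣ w by
    obtain ⟨⟨q', rfl⟩, ⟨w', rfl⟩⟩ := h _ le_rfl
    rw [mul_comm, mul_comm _ w', laurentAct_mul, laurentAct_mul, hx, hz, map_zero, map_zero,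
      add_zero]
  intro j
  induction j with
  | zero => simp
  | succ j ih =>
    intro hj
    obtain ⟨⟨q', hq'⟩, ⟨w', hw'⟩⟩ := ih (by omega)
    obtain ⟨a, d, hd⟩ := T_sub_one_dvd_sub_C q'
    obtain ⟨b, e, he⟩ := T_sub_one_dvd_sub_C w'
    rw [sub_eq_iff_eq_add'] at hd he
    have hpow : ((T 1 - 1 : K[T;T⁻¹])) ^ j * (T 1 - 1) ^ (n - j) = (T 1 - 1) ^ n := by
      rw [← pow_add, Nat.add_sub_cancel' (by omega)]
    have key : ∀ y, laurentAct φ (invert ((T 1 - 1) ^ (n - j))) y ∈ LinearMap.range (pairMap φ x z)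
        → a * Q.polarBilin (laurentAct φ ((T 1 - 1) ^ n) x) y
          + b * Q.polarBilin (laurentAct φ ((T 1 - 1) ^ n) z) y = 0 := by
      intro y hy
      have := hu _ hy
      rw [map_add, LinearMap.add_apply, hφ.polarBilin_laurentAct_laurentAct,
        hφ.polarBilin_laurentAct_laurentAct, invert_invert_apply, hq', hw', mul_right_comm, hpow,
        mul_right_comm, hpow, hd, he, polarBilin_socle_mul hx, polarBilin_socle_mul hz] at this
      exact this
    have hb := key x (laurentAct_mem_range_pairMap x z _)
    have ha := key z (laurentAct_mem_range_pairMap' x z _)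
    rw [hxx, mul_zero, zero_add] at hb
    rw [hzz, mul_zero, add_zero] at ha
    have ha' : a = 0 := (mul_eq_zero.1 ha).resolve_right hxz
    have hb' : b = 0 := (mul_eq_zero.1 hb).resolve_right hzx
    rw [ha', map_zero, zero_add] at hd
    rw [hb', map_zero, zero_add] at he
    exact ⟨⟨d, by rw [hq', hd, pow_succ, mul_assoc]⟩, ⟨e, by rw [hw', he, pow_succ, mul_assoc]⟩⟩

theorem InO.nondegenerate_cyclic (hφ : InO Q φ) {P : K[T;T⁻¹]} (hP : ∀ r, P ∣ r ∨ IsCoprime r P)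
    {n : ℕ} {x : V} (hx : laurentAct φ (P ^ (n + 1)) x = 0) {t : K[T;T⁻¹]}
    (hxx : Q.polarBilin (laurentAct φ (P ^ n) x) (laurentAct φ t x) ≠ 0) :
    ∀ u ∈ LinearMap.range (pairMap φ x 0),
      (∀ w ∈ LinearMap.range (pairMap φ x 0), Q.polarBilin u w = 0) → u = 0 := by
  rintro _ ⟨⟨r, w⟩, rfl⟩ hu
  rw [pairMap_apply, map_zero, add_zero] at hu ⊢
  by_contra hr
  obtain ⟨q, hq⟩ := exists_laurentAct_eq_socle hP hx hr
  apply hxx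
  rw [← hq, mul_comm, laurentAct_mul, laurentAct_comm, hφ.polarBilin_laurentAct, ← laurentAct_mul]
  exact hu _ (laurentAct_mem_range_pairMap x 0 _)

theorem InO.nondegenerate_swap (hφ : InO Q φ) {P : K[T;T⁻¹]} (hP : ∀ r, P ∣ r ∨ IsCoprime r P)
    (hP' : ∀ r, invert P ∣ r ∨ IsCoprime r (invert P))
    {n : ℕ} {x z : V} (hx : laurentAct φ (P ^ (n + 1)) x = 0)
    (hz : laurentAct φ (invert P ^ (n + 1)) z = 0)
    (hzz : ∀ r, Q.polarBilin (laurentAct φ r z) z = 0)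
    (hxz : Q.polarBilin (laurentAct φ (P ^ n) x) z ≠ 0) :
    ∀ u ∈ LinearMap.range (pairMap φ x z),
      (∀ w ∈ LinearMap.range (pairMap φ x z), Q.polarBilin u w = 0) → u = 0 := by
  rintro _ ⟨⟨q, w⟩, rfl⟩ hu
  rw [pairMap_apply] at hu ⊢
  have hq : laurentAct φ q x = 0 := by
    by_contra hq
    obtain ⟨a, ha⟩ := exists_laurentAct_eq_socle hP hx hq
    apply hxz
    have := hu _ (laurentAct_mem_range_pairMap' x z (invert a))
    rwa [map_add, LinearMap.add_apply, hφ.polarBilin_laurentAct_laurentAct,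
      hφ.polarBilin_laurentAct_laurentAct, hzz, add_zero, invert_invert_apply, mul_comm, ha] at this
  rw [hq, zero_add] at hu ⊢
  by_contra hw
  obtain ⟨a, ha⟩ := exists_laurentAct_eq_socle hP' hz hw
  apply hxz
  have := hu _ (laurentAct_mem_range_pairMap x z (invert a))
  rwa [hφ.polarBilin_laurentAct_laurentAct, invert_invert_apply, mul_comm, ha, ← map_pow,
    ← hφ.polarBilin_laurentAct_comm] at this

theorem InO.exists_laurentAct_eq_of_orth [FiniteDimensional K V] (hQ : Nondefective Q)
    (hφ : InO Q φ) {P : K[T;T⁻¹]} {u : V}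
    (h : ∀ z, laurentAct φ (invert P) z = 0 → Q.polarBilin u z = 0) :
    ∃ y, laurentAct φ P y = u := by
  suffices hu : u ∈ LinearMap.range (laurentAct φ P) from hu
  rw [← hQ.polarOrth_polarOrth (LinearMap.range (laurentAct φ P))]
  intro z hz
  rw [polarBilin_comm]
  refine h z (hQ.eq_zero fun y => ?_)
  rw [hφ.polarBilin_laurentAct, invert_invert_apply, polarBilin_comm]
  exact hz _ ⟨y, rfl⟩

theorem InO.exists_socle [FiniteDimensional K V] (hQ : Nondefective Q) (hφ : InO Q φ)
    {P : K[T;T⁻¹]} (hP : ∃ v, v ≠ 0 ∧ laurentAct φ P v = 0) :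
    ∃ n, (∃ x, laurentAct φ (P ^ (n + 1)) x = 0 ∧ laurentAct φ (P ^ n) x ≠ 0) ∧
      ∀ x, laurentAct φ (P ^ (n + 1)) x = 0 → laurentAct φ (P ^ n) x ≠ 0 →
        ∃ z, laurentAct φ (invert P ^ (n + 1)) z = 0 ∧
          Q.polarBilin (laurentAct φ (P ^ n) x) z ≠ 0 := by
  classical
  have hex : ∃ k, LinearMap.ker (laurentAct φ P ^ k) = LinearMap.ker (laurentAct φ P ^ k.succ) := by
    obtain ⟨k, -, hk⟩ := Module.End.exists_ker_pow_eq_ker_pow_succ (laurentAct φ P)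
    exact ⟨k, hk⟩
  obtain ⟨v, hv, hPv⟩ := hP
  have h0 : Nat.find hex ≠ 0 := by
    intro h0
    have h := Nat.find_spec hex
    rw [h0, pow_zero, Nat.succ_eq_add_one, zero_add, pow_one] at h
    have : v ∈ LinearMap.ker (1 : Module.End K V) := h ▸ hPv
    exact hv this
  obtain ⟨n, hn⟩ := Nat.exists_eq_succ_of_ne_zero h0
  have hlt := Nat.find_min hex (m := n) (by omega)
  have hsp := Nat.find_spec hex
  rw [hn] at hsp
  refine ⟨n, ?_, ?_⟩
  · by_contra! hcon
    apply hlt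
    apply le_antisymm
    · intro x hx
      rw [LinearMap.mem_ker] at hx ⊢
      rw [pow_succ', Module.End.mul_apply, hx, map_zero]
    · intro x hx
      rw [LinearMap.mem_ker, ← map_pow] at hx ⊢
      exact hcon x hx
  · intro x hx hx'
    by_contra! hcon
    apply hx'
    obtain ⟨y, hy⟩ := hφ.exists_laurentAct_eq_of_orth hQ (P := P ^ (n + 1))
      fun z hz => hcon z (by rwa [← map_pow])
    have h1 : y ∈ LinearMap.ker (laurentAct φ P ^ (n + 1).succ) := by
      rw [LinearMap.mem_ker, ← map_pow, Nat.succ_eq_add_one, pow_succ', laurentAct_mul, hy,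
        ← laurentAct_mul, ← pow_succ', hx]
    have h2 : y ∈ LinearMap.ker (laurentAct φ P ^ n.succ) := by
      rw [hsp]
      exact h1
    rw [LinearMap.mem_ker, ← map_pow] at h2
    rw [← hy]
    exact h2

end Frobenius

section Blocks

open LaurentPolynomial

/-- The functional `T ^ i ↦ Ring.choose i n`. -/
noncomputable def chooseFunctional (K : Type*) [Field K] (n : ℕ) : K[T;T⁻¹] →ₗ[K] K :=
  Finsupp.linearCombination K (fun i : ℤ => ((Ring.choose i n : ℤ) : K)) ∘ₗ
    (AddMonoidAlgebra.coeffLinearEquiv K).toLinearMap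

variable [Field K]

theorem chooseFunctional_C_mul_T (n : ℕ) (a : K) (i : ℤ) :
    chooseFunctional K n (LaurentPolynomial.C a * T i) = a * ((Ring.choose i n : ℤ) : K) := by
  rw [← single_eq_C_mul_T]
  exact Finsupp.linearCombination_single K a i

theorem chooseFunctional_succ (n : ℕ) (r : K[T;T⁻¹]) :
    chooseFunctional K (n + 1) ((T 1 - 1) * r) = chooseFunctional K n r := by
  induction r using LaurentPolynomial.induction_on' with
  | add p q hp hq => rw [mul_add, map_add, map_add, hp, hq]
  | C_mul_T i a =>
    rw [show (T 1 - 1) * (LaurentPolynomial.C a * T i)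
      = LaurentPolynomial.C a * T (i + 1) - LaurentPolynomial.C a * T i by rw [T_add]; ring,
      map_sub, chooseFunctional_C_mul_T, chooseFunctional_C_mul_T, chooseFunctional_C_mul_T,
      Ring.choose_succ_succ, Int.cast_add]
    ring

theorem chooseFunctional_zero (r : K[T;T⁻¹]) : chooseFunctional K 0 ((T 1 - 1) * r) = 0 := by
  induction r using LaurentPolynomial.induction_on' with
  | add p q hp hq => rw [mul_add, map_add, hp, hq, add_zero]
  | C_mul_T i a =>
    rw [show (T 1 - 1) * (LaurentPolynomial.C a * T i)
      = LaurentPolynomial.C a * T (i + 1) - LaurentPolynomial.C a * T i by rw [T_add]; ring,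
      map_sub, chooseFunctional_C_mul_T, chooseFunctional_C_mul_T, Ring.choose_zero_right,
      Ring.choose_zero_right, sub_self]

theorem chooseFunctional_pow (n : ℕ) (r : K[T;T⁻¹]) :
    chooseFunctional K n ((T 1 - 1) ^ (n + 1) * r) = 0 := by
  induction n with
  | zero => rw [zero_add, pow_one, chooseFunctional_zero]
  | succ n ih => rw [pow_succ', mul_assoc, chooseFunctional_succ, ih]

theorem chooseFunctional_socle (n : ℕ) : chooseFunctional K n ((T 1 - 1) ^ n) = 1 := by
  induction n with
  | zero =>
    have := chooseFunctional_C_mul_T 0 (1 : K) 0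
    rw [map_one, T_zero, one_mul, Ring.choose_zero_right, Int.cast_one, mul_one] at this
    rw [pow_zero, this]
  | succ n ih => rw [pow_succ', chooseFunctional_succ, ih]

theorem chooseFunctional_invert (n : ℕ) (r : K[T;T⁻¹]) :
    chooseFunctional K n (LaurentPolynomial.C ((-1) ^ n) * T (n - 1) * invert r)
      = chooseFunctional K n r := by
  induction r using LaurentPolynomial.induction_on' with
  | add p q hp hq => rw [map_add invert, mul_add, map_add, map_add, hp, hq]
  | C_mul_T i a =>
    rw [map_mul invert, invert_C, invert_T,
      show LaurentPolynomial.C ((-1) ^ n) * T (n - 1) * (LaurentPolynomial.C a * T (-i))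
        = LaurentPolynomial.C ((-1) ^ n * a) * (T (-(i - n + 1)) : K[T;T⁻¹]) by
          rw [show -(i - (n : ℤ) + 1) = (n - 1) + -i by ring, T_add, map_mul]; ring,
      chooseFunctional_C_mul_T, chooseFunctional_C_mul_T, Ring.choose_neg,
      show i - (n : ℤ) + 1 + n - 1 = i by ring, Units.smul_def, Int.coe_negOnePow_natCast,
      smul_eq_mul, Int.cast_mul, Int.cast_pow, Int.cast_neg, Int.cast_one]
    rw [show (-1 : K) ^ n * a * ((-1) ^ n * (Ring.choose i n : ℤ))
      = ((-1) ^ n * (-1) ^ n) * (a * (Ring.choose i n : ℤ)) by ring, ← mul_pow]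
    simp

variable [AddCommGroup V] [Module K V] {Q : QuadraticForm K V} {φ : V ≃ₗ[K] V}

theorem laurentAct_invert_T_sub_one_pow {k : ℕ} {z : V}
    (h : laurentAct φ (invert (T 1 - 1) ^ k) z = 0) : laurentAct φ ((T 1 - 1) ^ k) z = 0 := by
  have h1 : (T 1 - 1 : K[T;T⁻¹]) = -T 1 * invert (T 1 - 1) := by
    rw [invert_T_sub_one]
    have h : (T 1 * T (-1) : K[T;T⁻¹]) = 1 := by rw [← T_add]; simp
    linear_combination (1 - T 1) * h
  rw [h1, mul_pow, laurentAct_mul, h, map_zero]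

theorem exists_irreducible_laurentAct_eq_zero {a : K[T;T⁻¹]} (ha : a ≠ 0) {x : V} (hx : x ≠ 0)
    (hax : laurentAct φ a x = 0) : ∃ P, Irreducible P ∧ ∃ v, v ≠ 0 ∧ laurentAct φ P v = 0 := by
  have := laurent_isPrincipalIdealRing (K := K)
  induction a using WfDvdMonoid.induction_on_irreducible with
  | zero => exact absurd rfl ha
  | unit u hu =>
    obtain ⟨b, hb⟩ := hu.exists_left_inv
    rw [← laurentAct_one φ x, ← hb, laurentAct_mul, hax, map_zero] at hx
    exact absurd rfl hx
  | mul a i ha' hi ih =>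
    by_cases h : laurentAct φ a x = 0
    · exact ih ha' h
    · exact ⟨i, hi, _, h, by rwa [← laurentAct_mul]⟩

theorem laurentAct_toLaurent (φ : V ≃ₗ[K] V) (p : K[X]) :
    laurentAct φ (toLaurent p) = aeval φ.toLinearMap p := by
  have h : (laurentAct φ).comp toLaurentAlg = aeval φ.toLinearMap := by
    refine Polynomial.algHom_ext ?_
    rw [AlgHom.comp_apply, toLaurentAlg_apply, toLaurent_X, aeval_X]
    exact LinearMap.ext fun x => laurentAct_T_one φ x
  exact DFunLike.congr_fun h p

variable [FiniteDimensional K V]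

/-- A nonzero invariant nondegenerate subspace on which `φ` is reversed by an involution. -/
def HasBlock (Q : QuadraticForm K V) (φ : V ≃ₗ[K] V) : Prop :=
  ∃ W : Submodule K V, W ≠ ⊥ ∧ (∀ u ∈ W, (∀ w ∈ W, Q.polarBilin u w = 0) → u = 0) ∧
    ∃ (h : ∀ x ∈ W, φ x ∈ W) (σ : W ≃ₗ[K] W), IsReverser (formOn Q W) (restrictEquiv φ W h) σ

theorem hasBlock_of_isReverser {x z : V} {φ : V ≃ₗ[K] V} (hx : x ≠ 0)
    (hnd : ∀ u ∈ LinearMap.range (pairMap φ x z),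
      (∀ w ∈ LinearMap.range (pairMap φ x z), Q.polarBilin u w = 0) → u = 0)
    (h : ∃ σ, IsReverser (formOn Q (LinearMap.range (pairMap φ x z)))
      (restrictEquiv φ _ (pairMap_invariant x z)) σ) : HasBlock Q φ := by
  refine ⟨_, ?_, hnd, _, h⟩
  intro hbot
  have := laurentAct_mem_range_pairMap (φ := φ) x z 1
  rw [hbot, laurentAct_one] at this
  exact hx this

theorem InO.hasBlock_cyclic (hφ : InO Q φ) {P : K[T;T⁻¹]} (hP : ∀ r, P ∣ r ∨ IsCoprime r P)
    {n : ℕ} {x : V} (hx : laurentAct φ (P ^ (n + 1)) x = 0) {t : K[T;T⁻¹]}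
    (hxx : Q.polarBilin (laurentAct φ (P ^ n) x) (laurentAct φ t x) ≠ 0) : HasBlock Q φ := by
  have hnd := hφ.nondegenerate_cyclic hP hx hxx
  refine hasBlock_of_isReverser (x := x) (z := 0) ?_ hnd ?_
  · rintro rfl
    rw [map_zero, map_zero] at hxx
    exact hxx rfl
  · obtain ⟨σ, hσ, -⟩ := hφ.exists_isReverser_pair (x := x) (z := 0) 1 rfl hnd
      (by rw [map_one, one_mul, laurentAct_one])
      (fun r => by rw [one_mul, hφ.map_laurentAct_invert_self])
      (fun r => by rw [map_zero, map_zero]) (pairMap_invariant x 0)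
    exact ⟨σ, hσ⟩

theorem InO.hasBlock_of_fixed (hQ : Nondefective Q) (hφ : InO Q φ)
    (h : ∃ v, v ≠ 0 ∧ φ v = v) : HasBlock Q φ := by
  obtain ⟨n, ⟨x, hx, hx'⟩, hz⟩ := hφ.exists_socle hQ (P := T 1 - 1) (by
    obtain ⟨v, hv, hv'⟩ := h
    exact ⟨v, hv, by rw [laurentAct_sub, laurentAct_T_one, laurentAct_one, hv', sub_self]⟩)
  by_cases hc : ∃ x, laurentAct φ ((T 1 - 1) ^ (n + 1)) x = 0 ∧
      Q.polarBilin (laurentAct φ ((T 1 - 1) ^ n) x) x ≠ 0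
  · obtain ⟨x, hx, hxx⟩ := hc
    exact hφ.hasBlock_cyclic T_sub_one_dvd_or_isCoprime (t := 1) hx (by rwa [laurentAct_one])
  · push Not at hc
    obtain ⟨z₀, hz₀, hxz₀⟩ := hz x hx hx'
    obtain ⟨z, hz, hxz⟩ := hφ.exists_polarBilin_eq hx (laurentAct_invert_T_sub_one_pow hz₀) hxz₀
      (chooseFunctional_pow n)
    have hnd := hφ.nondegenerate_bicyclic hx hz (hc x hx) (hc z hz)
      (by rw [hxz, chooseFunctional_socle]; exact one_ne_zero)
    refine hasBlock_of_isReverser (x := x) (z := z) ?_ hnd ?_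
    · rintro rfl
      rw [map_zero] at hx'
      exact hx' rfl
    · refine (hφ.exists_isReverser_pair (x := x) (z := z)
        (LaurentPolynomial.C ((-1) ^ n) * T (n - 1)) rfl hnd ?_ ?_ ?_
        (pairMap_invariant x z)).imp fun σ hσ => hσ.1
      · rw [map_mul invert, invert_C, invert_T, mul_mul_mul_comm, ← map_mul, ← T_add, ← mul_pow]
        simp
      · intro r
        rw [laurentAct_mul, laurentAct_C_mul_T, QuadraticMap.map_smul, hφ.zpow,
          hφ.map_laurentAct_invert_self, ← mul_pow]
        simp
      · intro r
        rw [hxz, hxz, chooseFunctional_invert]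

theorem InO.hasBlock_of_neg (hQ : Nondefective Q) (hφ : InO Q φ)
    (h : ∃ v, v ≠ 0 ∧ φ v = -v) : HasBlock Q φ := by
  let ψ : V ≃ₗ[K] V := φ.trans (LinearEquiv.neg K)
  have hψ : ∀ v, ψ v = -φ v := fun _ => rfl
  obtain ⟨W, hW, hnd, hψW, σ, hσ⟩ := InO.hasBlock_of_fixed (Q := Q) (φ := ψ) hQ
    (fun v => by rw [hψ, QuadraticMap.map_neg, hφ])
    (by
      obtain ⟨v, hv, hv'⟩ := h
      exact ⟨v, hv, by rw [hψ, hv', neg_neg]⟩)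
  have hφW : ∀ x ∈ W, φ x ∈ W := fun x hx => by
    have := hψW x hx
    rwa [hψ, W.neg_mem_iff] at this
  have hr : ∀ w, restrictEquiv φ W hφW w = -restrictEquiv ψ W hψW w := fun w =>
    Subtype.ext (by
      rw [coe_restrictEquiv, Submodule.coe_neg, coe_restrictEquiv, hψ, neg_neg])
  refine ⟨W, hW, hnd, hφW, σ, hσ.inO, hσ.invol, fun w => ?_⟩
  rw [hr, hr, map_neg σ, map_neg σ, map_neg (restrictEquiv ψ W hψW), map_neg σ, neg_neg]
  exact hσ.rev w

theorem exists_laurentAct_eq {r P : K[T;T⁻¹]} (hr : ∀ v, laurentAct φ r v = 0 → v = 0) {u : V}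
    (hu : laurentAct φ P u = 0) : ∃ e, laurentAct φ r e = u ∧ laurentAct φ P e = 0 := by
  have hinj : Function.Injective (laurentAct φ r) := by
    rw [← LinearMap.ker_eq_bot, eq_bot_iff]
    exact fun v hv => hr v hv
  obtain ⟨e, he⟩ := (LinearMap.injective_iff_surjective.1 hinj) u
  refine ⟨e, he, hr _ ?_⟩
  rw [laurentAct_comm, he, hu]

theorem InO.map_eq_zero_of_isCoprime (hφ : InO Q φ) (h1 : ∀ v, φ v = v → v = 0)
    {P : K[T;T⁻¹]} (hP : IsCoprime (invert P) P) {u : V} (hu : laurentAct φ P u = 0) :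
    Q u = 0 := by
  have hB : ∀ u v, laurentAct φ P u = 0 → laurentAct φ P v = 0 → Q.polarBilin u v = 0 := by
    intro u v hu hv
    obtain ⟨a, b, hab⟩ := hP
    rw [← laurentAct_one φ u, ← hab, laurentAct_add, laurentAct_mul φ b, hu, map_zero, add_zero,
      hφ.polarBilin_laurentAct, map_mul, invert_invert_apply, laurentAct_mul, hv, map_zero,
      map_zero]
  obtain ⟨e, rfl, he⟩ := exists_laurentAct_eq (φ := φ) (r := T 1 - 1) (fun v hv => h1 v (by
    rwa [laurentAct_sub, laurentAct_T_one, laurentAct_one, sub_eq_zero] at hv)) hu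
  have he' : laurentAct φ P (φ e) = 0 := by
    rw [← laurentAct_T_one, laurentAct_comm, he, map_zero]
  rw [laurentAct_sub, laurentAct_T_one, laurentAct_one, sub_eq_add_neg, map_add_polarBilin,
    map_neg (Q.polarBilin _), hB _ _ he' he, QuadraticMap.map_neg, hφ, ← two_mul,
      ← polarBilin_self_two,
    hB _ _ he he, neg_zero, add_zero]

theorem InO.hasBlock_of_regular [Nontrivial V] (hQ : Nondefective Q) (hφ : InO Q φ)
    (h1 : ∀ v, φ v = v → v = 0) (h2 : ∀ v, φ v = -v → v = 0) : HasBlock Q φ := by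
  obtain ⟨x₀, hx₀⟩ := exists_ne (0 : V)
  obtain ⟨P, hPi, hPv⟩ := exists_irreducible_laurentAct_eq_zero (φ := φ)
    (a := toLaurent φ.toLinearMap.charpoly)
    (toLaurent_ne_zero.2 φ.toLinearMap.charpoly_monic.ne_zero) hx₀
    (by rw [laurentAct_toLaurent, LinearMap.aeval_self_charpoly, LinearMap.zero_apply])
  have hP := irreducible_dvd_or_isCoprime hPi
  obtain ⟨n, ⟨x, hx, hx'⟩, hz⟩ := hφ.exists_socle hQ hPv
  obtain ⟨z, hz, hxz⟩ := hz x hx hx'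
  have hx0 : x ≠ 0 := by
    rintro rfl
    rw [map_zero] at hx'
    exact hx' rfl
  rcases hP (invert P) with ⟨u, hu⟩ | hcop
  · by_cases hc : ∃ x t, laurentAct φ (P ^ (n + 1)) x = 0 ∧
      Q.polarBilin (laurentAct φ (P ^ n) x) (laurentAct φ t x) ≠ 0
    · obtain ⟨x, t, hx, hxx⟩ := hc
      exact hφ.hasBlock_cyclic hP hx hxx
    · push Not at hc
      exfalso
      have hPz : laurentAct φ (P ^ (n + 1)) z = 0 := by
        have : P = invert u * invert P := by
          have := congrArg invert hu
          rw [invert_invert_apply, map_mul] at this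
          rw [mul_comm]
          exact this
        rw [this, mul_pow, laurentAct_mul, hz, map_zero]
      have hc' : ∀ y r, laurentAct φ (P ^ (n + 1)) y = 0 →
          Q.polarBilin (laurentAct φ (r * P ^ n) y) y = 0 := by
        intro y r hy
        rw [mul_comm, laurentAct_mul, laurentAct_comm, hφ.polarBilin_laurentAct]
        exact hc y _ hy
      have hpol : ∀ y r, laurentAct φ (P ^ (n + 1)) y = 0 →
          Q.polarBilin (laurentAct φ ((r + invert r * u ^ n) * P ^ n) y) z = 0 := by
        intro y r hy
        have := hc' (y + z) r (by rw [map_add, hy, hPz, add_zero])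
        rw [map_add, map_add, map_add, LinearMap.add_apply, LinearMap.add_apply, hc' y r hy,
          hc' z r hPz, zero_add, add_zero, hφ.polarBilin_laurentAct_comm _ z, map_mul, map_pow,
          hu, add_comm] at this
        rw [add_mul, laurentAct_add, map_add, LinearMap.add_apply, ← this, mul_pow, mul_assoc,
          mul_comm (u ^ n)]
      obtain ⟨y, hy, hPy⟩ := exists_laurentAct_eq (φ := φ) (r := T 1 - T (-1)) (P := P ^ (n + 1))
        (fun v hv => by
          rw [laurentAct_sub, sub_eq_zero] at hv
          have h3 : φ (φ v) = v := by
            rw [← laurentAct_T_one φ v, hv, ← laurentAct_T_one, ← laurentAct_mul, ← T_add,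
              add_neg_cancel, T_zero, laurentAct_one]
          have h4 : φ (φ v + v) = φ v + v := by rw [map_add, h3, add_comm]
          exact h2 v (eq_neg_of_add_eq_zero_left (h1 _ h4))) hx
      apply hxz
      rw [← hy, ← laurentAct_mul]
      have e1 := hpol y (T 1) hPy
      have e2 := hpol (laurentAct φ (T (-1)) y) 1 (by rw [laurentAct_comm, hPy, map_zero])
      rw [← laurentAct_mul] at e2
      rw [show P ^ n * (T 1 - T (-1)) = (T 1 + invert (T 1) * u ^ n) * P ^ n
        - (1 + invert 1 * u ^ n) * P ^ n * T (-1) by rw [map_one, invert_T]; ring,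
        laurentAct_sub, map_sub, LinearMap.sub_apply, e1, e2, sub_self]
  · have hP' : ∀ r, invert P ∣ r ∨ IsCoprime r (invert P) :=
      irreducible_dvd_or_isCoprime ((MulEquiv.irreducible_iff (invert (R := K))).2 hPi)
    have hQP : ∀ y, laurentAct φ (P ^ (n + 1)) y = 0 → Q y = 0 := fun y =>
      hφ.map_eq_zero_of_isCoprime h1 (by rw [map_pow]; exact hcop.pow)
    have hQP' : ∀ y, laurentAct φ (invert P ^ (n + 1)) y = 0 → Q y = 0 := fun y =>
      hφ.map_eq_zero_of_isCoprime h1 (by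
        rw [map_pow, invert_invert_apply]
        exact hcop.symm.pow)
    have hxr : ∀ r, laurentAct φ (P ^ (n + 1)) (laurentAct φ r x) = 0 := fun r => by
      rw [laurentAct_comm, hx, map_zero]
    have hzr : ∀ r, laurentAct φ (invert P ^ (n + 1)) (laurentAct φ r z) = 0 := fun r => by
      rw [laurentAct_comm, hz, map_zero]
    have hnd := hφ.nondegenerate_swap hP hP' hx hz (fun r =>
      polarBilin_eq_zero_of_singular (A := LinearMap.ker (laurentAct φ (invert P ^ (n + 1))))
        (fun a ha => hQP' a ha) (hzr r) hz) hxz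
    refine hasBlock_of_isReverser hx0 hnd ?_
    obtain ⟨σ, hσ, -⟩ := hφ.exists_isReverser_swap (x := x) (z := z) rfl hnd
      (fun r => by rw [hQP _ (hxr _), hQP' _ (hzr _)]) (pairMap_invariant x z)
    exact ⟨σ, hσ⟩

theorem InO.hasBlock [Nontrivial V] (hQ : Nondefective Q) (hφ : InO Q φ) : HasBlock Q φ := by
  by_cases h1 : ∃ v, v ≠ 0 ∧ φ v = v
  · exact hφ.hasBlock_of_fixed hQ h1
  by_cases h2 : ∃ v, v ≠ 0 ∧ φ v = -v
  · exact hφ.hasBlock_of_neg hQ h2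
  push Not at h1 h2
  exact hφ.hasBlock_of_regular hQ (fun v hv => by_contra fun h => h1 v h hv)
    (fun v hv => by_contra fun h => h2 v h hv)

/-- Every isometry of a nondefective quadratic space is reversed by an isometric involution. -/
theorem InO.exists_hasReverser (hQ : Nondefective Q) (hφ : InO Q φ) :
    ∃ d, HasReverser Q φ d := by
  suffices h : ∀ (n : ℕ) {V : Type _} [AddCommGroup V] [Module K V] [FiniteDimensional K V]
      {Q : QuadraticForm K V} {φ : V ≃ₗ[K] V}, Nondefective Q → InO Q φ → finrank K V = n →
      ∃ d, HasReverser Q φ d from h _ hQ hφ rfl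
  intro n
  induction n using Nat.strong_induction_on with
  | _ n ih =>
    intro V _ _ _ Q φ hQ hφ hn
    rcases subsingleton_or_nontrivial V with hV | hV
    · exact ⟨_, 1, ⟨fun _ => rfl, fun _ => rfl, fun _ => Subsingleton.elim _ _⟩, rfl⟩
    · obtain ⟨W, hW, hnd, hφW, σ, hσ⟩ := hφ.hasBlock hQ
      have hc := hQ.isCompl_polarOrth hnd
      have ho : ∀ w ∈ W, ∀ w' ∈ polarOrth Q W, Q.polarBilin w w' = 0 := fun w hw w' hw' =>
        hw' w hw
      have hφW' := hφ.polarOrth_invariant hφW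
      have hlt : finrank K (polarOrth Q W) < n := by
        have := Submodule.finrank_add_eq_of_isCompl hc
        have := Submodule.one_le_finrank_iff.2 hW
        omega
      obtain ⟨d', hd'⟩ := ih _ hlt (hQ.nondefective_formOn_left hc.symm
        fun w hw w' hw' => by rw [polarBilin_comm]; exact ho w' hw' w hw)
        (hφ.inO_restrictEquiv hφW') rfl
      exact ⟨_, HasReverser.glue hc ho ⟨σ, hσ, rfl⟩ hd'⟩

/-- A reverser on a nondegenerate invariant subspace extends, with a shift of the Dickson invariant
that depends only on the subspace. -/
theorem InO.exists_hasReverser_add (hQ : Nondefective Q) (hφ : InO Q φ) {W : Submodule K V}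
    (hnd : ∀ u ∈ W, (∀ w ∈ W, Q.polarBilin u w = 0) → u = 0) (hφW : ∀ x ∈ W, φ x ∈ W)
    (h : ∀ d, HasReverser (formOn Q W) (restrictEquiv φ W hφW) d) (d : ZMod 2) :
    HasReverser Q φ d := by
  have hc := hQ.isCompl_polarOrth hnd
  have ho : ∀ w ∈ W, ∀ w' ∈ polarOrth Q W, Q.polarBilin w w' = 0 := fun w hw w' hw' => hw' w hw
  have hφW' := hφ.polarOrth_invariant hφW
  obtain ⟨d', hd'⟩ := (hφ.inO_restrictEquiv hφW').exists_hasReverser (hQ.nondefective_formOn_left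
    hc.symm fun w hw w' hw' => by rw [polarBilin_comm]; exact ho w' hw' w hw)
  have := HasReverser.glue hc ho (h (d - d')) hd'
  rwa [sub_add_cancel] at this

end Blocks

/-- A functional vanishing on the kernel of `f` factors through `f`. -/
theorem exists_dual_comp_eq [Field K] [AddCommGroup V] [Module K V] {M : Type*} [AddCommGroup M]
    [Module K M] {f : M →ₗ[K] V} {θ : M →ₗ[K] K} (h : ∀ m, f m = 0 → θ m = 0) :
    ∃ ℓ : V →ₗ[K] K, ∀ m, ℓ (f m) = θ m := by
  have hmem : θ ∈ LinearMap.range f.dualMap := by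
    rw [LinearMap.range_dualMap_eq_dualAnnihilator_ker, Submodule.mem_dualAnnihilator]
    exact fun m hm => h m hm
  obtain ⟨ℓ, hℓ⟩ := hmem
  exact ⟨ℓ, fun m => by rw [← hℓ]; rfl⟩

section LaurentChar2

open LaurentPolynomial

variable [Field K]

/-- The part of a Laurent polynomial with exponents at least `m`. -/
noncomputable def laurentTrunc (K : Type*) [Field K] (m : ℤ) : K[T;T⁻¹] →ₗ[K] K[T;T⁻¹] :=
  Finsupp.linearCombination K (fun i : ℤ => if m ≤ i then (T i : K[T;T⁻¹]) else 0) ∘ₗ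
    (AddMonoidAlgebra.coeffLinearEquiv K).toLinearMap

theorem laurentTrunc_C_mul_T (m : ℤ) (a : K) (i : ℤ) :
    laurentTrunc K m (LaurentPolynomial.C a * T i) =
      if m ≤ i then LaurentPolynomial.C a * T i else 0 := by
  rw [← LaurentPolynomial.single_eq_C_mul_T]
  simp only [laurentTrunc, LinearMap.comp_apply, LinearEquiv.coe_coe,
    AddMonoidAlgebra.coeffLinearEquiv_apply, AddMonoidAlgebra.coeff_single,
    Finsupp.linearCombination_single]
  split_ifs
  · rw [LaurentPolynomial.smul_eq_C_mul, LaurentPolynomial.single_eq_C_mul_T]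
  · simp

theorem laurentTrunc_zero_add (t : K[T;T⁻¹]) :
    laurentTrunc K 0 t + T (-1) * invert (laurentTrunc K 0 (T (-1) * invert t)) = t := by
  induction t using LaurentPolynomial.induction_on' with
  | add p q hp hq =>
    rw [map_add invert, mul_add, map_add, map_add, map_add invert, mul_add]
    linear_combination hp + hq
  | C_mul_T i a =>
    have h : T (-1) * invert (LaurentPolynomial.C a * T i : K[T;T⁻¹]) =
        LaurentPolynomial.C a * T (-1 - i) := by
      rw [map_mul invert, invert_C, invert_T, mul_left_comm, ← T_add]; ring_nf
    rw [h, laurentTrunc_C_mul_T, laurentTrunc_C_mul_T]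
    rcases le_or_gt 0 i with hi | hi
    · rw [if_pos hi, if_neg (by omega)]; simp
    · rw [if_neg (by omega), if_pos (by omega), map_mul invert, invert_C, invert_T, mul_left_comm,
        ← T_add, zero_add]
      ring_nf

theorem exists_laurentTrunc_one_add (t : K[T;T⁻¹]) :
    ∃ c, laurentTrunc K 1 t + invert (laurentTrunc K 1 (invert t)) + LaurentPolynomial.C c = t := by
  induction t using LaurentPolynomial.induction_on' with
  | add p q hp hq =>
    obtain ⟨c, hc⟩ := hp
    obtain ⟨d, hd⟩ := hq
    refine ⟨c + d, ?_⟩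
    rw [map_add invert, map_add, map_add, map_add invert, map_add LaurentPolynomial.C]
    linear_combination hc + hd
  | C_mul_T i a =>
    have h : invert (LaurentPolynomial.C a * T i : K[T;T⁻¹]) =
        LaurentPolynomial.C a * T (- i) := by
      rw [map_mul invert, invert_C, invert_T]
    rw [h, laurentTrunc_C_mul_T, laurentTrunc_C_mul_T]
    rcases lt_trichotomy 0 i with hi | hi | hi
    · refine ⟨0, ?_⟩
      rw [if_pos (by omega), if_neg (by omega)]; simp
    · refine ⟨a, ?_⟩
      rw [if_neg (by omega), if_neg (by omega), ← hi]; simp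
    · refine ⟨0, ?_⟩
      rw [if_neg (by omega), if_pos (by omega), map_mul invert, invert_C, invert_T]; simp

theorem laurent_add_self (h2 : (2 : K) = 0) (r : K[T;T⁻¹]) : r + r = 0 := by
  rw [← two_smul K, h2, zero_smul]

theorem invert_T_sub_one_pow (h2 : (2 : K) = 0) (k : ℕ) :
    invert ((T 1 - 1 : K[T;T⁻¹]) ^ k) = (T 1 - 1) ^ k * T (-k) := by
  have h : invert (T 1 - 1 : K[T;T⁻¹]) = (T 1 - 1) * T (-1) := by
    rw [invert_T_sub_one]
    linear_combination -laurent_add_self h2 ((T 1 - 1) * T (-1))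
  rw [map_pow invert, h, mul_pow, T_pow]
  congr 2; ring

theorem T_sub_one_ne_zero : (T 1 - 1 : K[T;T⁻¹]) ≠ 0 := by
  intro h
  have := chooseFunctional_socle (K := K) 1
  rw [h] at this
  simp at this

theorem chooseFunctional_zero_invert (r : K[T;T⁻¹]) :
    chooseFunctional K 0 (invert r) = chooseFunctional K 0 r := by
  induction r using LaurentPolynomial.induction_on' with
  | add p q hp hq => rw [map_add invert, map_add, map_add, hp, hq]
  | C_mul_T i a =>
    rw [map_mul invert, invert_C, invert_T, chooseFunctional_C_mul_T, chooseFunctional_C_mul_T,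
      Ring.choose_zero_right, Ring.choose_zero_right]

/-- In characteristic two, a trace divisible by an odd power of `T 1 - 1` is the trace of such a
multiple. -/
theorem exists_trace_eq (h2 : (2 : K) = 0) {j : ℕ} {r t : K[T;T⁻¹]}
    (h : r + invert r = (T 1 - 1) ^ (2 * j + 1) * t) :
    ∃ u, (T 1 - 1) ^ (2 * j + 1) * t =
      (T 1 - 1) ^ (2 * j + 1) * u + invert ((T 1 - 1) ^ (2 * j + 1) * u) := by
  have ht : t = T (-(2 * j + 1 : ℕ)) * invert t := by
    refine mul_left_cancel₀ (pow_ne_zero (2 * j + 1) (T_sub_one_ne_zero (K := K))) ?_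
    have := congrArg invert h
    rw [map_add invert, invert_invert_apply, add_comm, h, map_mul invert,
      invert_T_sub_one_pow h2] at this
    rw [this]; ring
  set t' := T j * t with ht'
  have hsym : T (-1) * invert t' = t' := by
    rw [ht', map_mul invert, invert_T]
    conv_rhs => rw [ht]
    rw [← mul_assoc, ← mul_assoc, ← T_add, ← T_add]
    congr 2; push_cast; ring
  have hu := laurentTrunc_zero_add t'
  rw [hsym] at hu
  set u' := laurentTrunc K 0 t'
  refine ⟨T (-j) * u', ?_⟩
  have htt : t = T (-j) * t' := by rw [ht', ← mul_assoc, ← T_add]; simp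
  rw [map_mul invert, invert_T_sub_one_pow h2, map_mul invert, invert_T, htt, ← hu]
  have hT : (T (-(2 * j + 1 : ℕ)) * T (- -(j : ℤ)) : K[T;T⁻¹]) = T (-j) * T (-1) := by
    rw [← T_add, ← T_add]; congr 1; push_cast; ring
  linear_combination -(T 1 - 1) ^ (2 * j + 1) * invert u' * hT

end LaurentChar2

section HalfForm

open LaurentPolynomial

variable [Field K] [AddCommGroup V] [Module K V] {Q : QuadraticForm K V} {φ : V ≃ₗ[K] V}

theorem InO.polarBilin_eq_zero_of_invert_eq (hφ : InO Q φ) (h2 : (2 : K) = 0) (x : V)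
    {a : K[T;T⁻¹]} (ha : invert a = a) : Q.polarBilin (laurentAct φ a x) x = 0 := by
  obtain ⟨c, hc⟩ := exists_laurentTrunc_one_add a
  rw [ha] at hc
  rw [← hc, laurentAct_add, laurentAct_add, laurentAct_C, map_add, map_add, LinearMap.add_apply,
    LinearMap.add_apply, hφ.polarBilin_laurentAct (laurentTrunc K 1 a) x x, polarBilin_comm Q x,
    map_smul, LinearMap.smul_apply, polarBilin_self_two, h2, zero_mul, smul_zero, add_zero,
    ← two_mul, h2, zero_mul]

/-- In characteristic two, the quadratic form on a cyclic unipotent module of odd exponent is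
`r ↦ ℓ (r * invert r)` for some functional `ℓ`. -/
theorem InO.exists_halfForm (hφ : InO Q φ) (h2 : (2 : K) = 0) {j : ℕ} {x : V}
    (hx : laurentAct φ ((T 1 - 1) ^ (2 * j + 1)) x = 0) :
    ∃ ℓ : K[T;T⁻¹] →ₗ[K] K, (∀ r, ℓ ((T 1 - 1) ^ (2 * j + 1) * r) = 0) ∧
      (∀ r, ℓ r + ℓ (invert r) = Q.polarBilin (laurentAct φ r x) x) ∧
      ∀ r, ℓ (r * invert r) = Q (laurentAct φ r x) := by
  set S : K[T;T⁻¹] := (T 1 - 1) ^ (2 * j + 1) with hS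
  let inv : K[T;T⁻¹] →ₗ[K] K[T;T⁻¹] := invert.toLinearMap
  let f : K[T;T⁻¹] × K × K[T;T⁻¹] →ₗ[K] K[T;T⁻¹] :=
    (LinearMap.id + inv).coprod
      ((LinearMap.toSpanSingleton K _ 1).coprod (LinearMap.mulLeft K S))
  let θ : K[T;T⁻¹] × K × K[T;T⁻¹] →ₗ[K] K :=
    (pairing Q φ x x).coprod ((LinearMap.toSpanSingleton K _ (Q x)).coprod 0)
  have hf : ∀ r c t, f (r, c, t) = r + invert r + (LaurentPolynomial.C c + S * t) := by
    intro r c t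
    simp [f, inv, LaurentPolynomial.smul_eq_C_mul]
  have hθ : ∀ r c t, θ (r, c, t) = Q.polarBilin (laurentAct φ r x) x + c * Q x := by
    intro r c t
    simp [θ, pairing_apply]
  obtain ⟨ℓ, hℓ⟩ := exists_dual_comp_eq (f := f) (θ := θ) (by
    rintro ⟨r, c, t⟩ h0
    rw [hf] at h0
    rw [hθ]
    have hc : c = 0 := by
      have h := congrArg (chooseFunctional K 0) h0
      have h1 := chooseFunctional_C_mul_T 0 c 0
      rw [T_zero, mul_one, Ring.choose_zero_right, Int.cast_one, mul_one] at h1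
      rw [hS, pow_succ', mul_assoc, map_add, map_add, map_add, chooseFunctional_zero,
        chooseFunctional_zero_invert, h1, ← two_mul, h2, map_zero] at h
      linear_combination h
    subst hc
    have htr : r + invert r = S * t := by
      rw [map_zero, zero_add] at h0
      linear_combination h0 - laurent_add_self h2 (S * t)
    obtain ⟨u, hu⟩ := exists_trace_eq h2 htr
    rw [← hS] at hu
    have ha : invert (r + S * u) = r + S * u := by
      rw [map_add invert]
      linear_combination htr + hu - laurent_add_self h2 r + laurent_add_self h2 (invert (S * u))
    have := hφ.polarBilin_eq_zero_of_invert_eq h2 x ha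
    rw [laurentAct_add, mul_comm S, laurentAct_mul, hx, map_zero, add_zero] at this
    rw [this]; simp)
  have h1 : ∀ r, ℓ r + ℓ (invert r) = Q.polarBilin (laurentAct φ r x) x := fun r => by
    have := hℓ (r, 0, 0)
    rw [hf, hθ] at this
    simpa using this
  have h3 : ∀ c, ℓ (LaurentPolynomial.C c) = c * Q x := fun c => by
    have := hℓ (0, c, 0)
    rw [hf, hθ] at this
    simpa using this
  refine ⟨ℓ, fun r => ?_, h1, fun r => ?_⟩
  · have := hℓ (0, 0, r)
    rw [hf, hθ] at this
    simpa using this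
  · induction r using LaurentPolynomial.induction_on' with
    | add p q hp hq =>
      have h4 : (p + q) * invert (p + q) =
          p * invert p + q * invert q + (p * invert q + invert (p * invert q)) := by
        rw [map_add invert, map_mul invert, invert_invert_apply]; ring
      rw [h4, map_add, map_add, map_add, hp, hq, h1, laurentAct_add, map_add_polarBilin,
        hφ.polarBilin_laurentAct_laurentAct]
    | C_mul_T i a =>
      rw [laurentAct_C_mul_T, QuadraticMap.map_smul, hφ.zpow i x, smul_eq_mul, ← h3]
      congr 1
      rw [map_mul invert, invert_C, invert_T, map_mul LaurentPolynomial.C]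
      have : (T i * T (-i) : K[T;T⁻¹]) = 1 := by rw [← T_add]; simp
      linear_combination LaurentPolynomial.C a * LaurentPolynomial.C a * this

end HalfForm

section BothParities

open LaurentPolynomial

variable [Field K] [AddCommGroup V] [Module K V] {Q : QuadraticForm K V} {φ : V ≃ₗ[K] V}

theorem HasReverser.of_both {d : ZMod 2} (h : HasReverser Q φ d) (h' : HasReverser Q φ (d + 1))
    (d' : ZMod 2) : HasReverser Q φ d' := by
  have : d' = d ∨ d' = d + 1 := by clear h h'; revert d d'; decide
  rcases this with rfl | rfl <;> assumption

theorem laurentAct_T_sub_one (v : V) : laurentAct φ (T 1 - 1) v = φ v - v := by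
  rw [laurentAct_sub, laurentAct_T_one, laurentAct_one]

theorem mem_range_pairMap_zero {x v : V} :
    v ∈ LinearMap.range (pairMap φ x 0) ↔ ∃ r, laurentAct φ r x = v := by
  constructor
  · rintro ⟨⟨r, w⟩, rfl⟩
    exact ⟨r, by rw [pairMap_apply, map_zero, add_zero]⟩
  · rintro ⟨r, rfl⟩
    exact laurentAct_mem_range_pairMap x 0 r

theorem InO.map_T_sub_one (hφ : InO Q φ) (y : V) :
    Q (laurentAct φ (T 1 - 1) y) = -Q.polarBilin (laurentAct φ (T 1 - 1) y) y := by
  have h := map_add_polarBilin Q (laurentAct φ (T 1 - 1) y) y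
  have h' : laurentAct φ (T 1 - 1) y + y = φ y := by rw [laurentAct_T_sub_one]; abel
  rw [h', hφ y] at h
  linear_combination -h

variable [FiniteDimensional K V]

theorem HasReverser.mul_self (hQ : Nondefective Q) (hφ : InO Q φ) {d : ZMod 2}
    (h : HasReverser Q φ d) : HasReverser Q φ (d + dicksonInv φ) := by
  obtain ⟨σ, hσ, rfl⟩ := h
  refine ⟨σ * φ, ⟨hσ.inO.mul hφ, fun x => hσ.rev x, fun x => ?_⟩, hσ.inO.dicksonInv_mul hQ hφ⟩
  change σ (φ (φ (σ (φ (φ x))))) = x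
  have h1 : φ (σ (φ (φ x))) = σ (φ x) := by
    rw [← hσ.rev (φ x), hσ.invol, hσ.rev]
  rw [h1, hσ.rev]

theorem finrank_range_pairMap_zero_succ {n : ℕ} {x : V}
    (hx : laurentAct φ ((T 1 - 1) ^ (n + 1)) x = 0)
    (hx' : laurentAct φ ((T 1 - 1) ^ n) x ≠ 0) :
    finrank K (LinearMap.range (pairMap φ x 0)) =
      finrank K (LinearMap.range (pairMap φ (laurentAct φ (T 1 - 1) x) 0)) + 1 := by
  let g := (laurentAct φ (T 1 - 1)).domRestrict (LinearMap.range (pairMap φ x 0))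
  have hrange : LinearMap.range g =
      LinearMap.range (pairMap φ (laurentAct φ (T 1 - 1) x) 0) := by
    ext v
    rw [mem_range_pairMap_zero]
    constructor
    · rintro ⟨⟨w, hw⟩, rfl⟩
      obtain ⟨r, rfl⟩ := mem_range_pairMap_zero.1 hw
      exact ⟨r, laurentAct_comm φ r _ x⟩
    · rintro ⟨r, rfl⟩
      exact ⟨⟨_, laurentAct_mem_range_pairMap x 0 r⟩, laurentAct_comm φ _ r x⟩
  have hker : (LinearMap.ker g).map (Submodule.subtype _) =
      Submodule.span K {laurentAct φ ((T 1 - 1) ^ n) x} := by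
    ext v
    rw [Submodule.mem_span_singleton]
    constructor
    · rintro ⟨⟨w, hw⟩, hwg, rfl⟩
      obtain ⟨r, rfl⟩ := mem_range_pairMap_zero.1 hw
      have h0 : laurentAct φ ((T 1 - 1) * r) x = 0 := by rw [laurentAct_mul]; exact hwg
      have h1 := pow_dvd_of_laurentAct_eq_zero T_sub_one_dvd_or_isCoprime hx hx' h0
      rw [pow_succ', mul_dvd_mul_iff_left T_sub_one_ne_zero] at h1
      obtain ⟨q, rfl⟩ := h1
      obtain ⟨c, d, hd⟩ := T_sub_one_dvd_sub_C q
      refine ⟨c, ?_⟩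
      change c • _ = laurentAct φ ((T 1 - 1) ^ n * q) x
      rw [eq_add_of_sub_eq hd]
      have h2 : (T 1 - 1 : K[T;T⁻¹]) ^ n * ((T 1 - 1) * d + LaurentPolynomial.C c) =
          d * (T 1 - 1) ^ (n + 1) + LaurentPolynomial.C c * (T 1 - 1) ^ n := by ring
      rw [h2, laurentAct_add, laurentAct_mul, hx, map_zero, zero_add, laurentAct_mul,
        laurentAct_C]
    · rintro ⟨c, rfl⟩
      refine Submodule.smul_mem _ c ⟨⟨_, laurentAct_mem_range_pairMap x 0 _⟩, ?_, rfl⟩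
      change laurentAct φ (T 1 - 1) (laurentAct φ ((T 1 - 1) ^ n) x) = 0
      rw [← laurentAct_mul, ← pow_succ', hx]
  rw [← LinearMap.finrank_range_add_finrank_ker g, hrange,
    ← finrank_map_of_injective (Submodule.injective_subtype _) (LinearMap.ker g), hker,
    finrank_span_singleton hx']

theorem finrank_range_pairMap_zero {n : ℕ} {x : V}
    (hx : laurentAct φ ((T 1 - 1) ^ (n + 1)) x = 0)
    (hx' : laurentAct φ ((T 1 - 1) ^ n) x ≠ 0) :
    finrank K (LinearMap.range (pairMap φ x 0)) = n + 1 := by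
  induction n generalizing x with
  | zero =>
    rw [finrank_range_pairMap_zero_succ hx hx']
    rw [zero_add, pow_one] at hx
    have h : LinearMap.range (pairMap φ (0 : V) 0) = ⊥ := by
      rw [LinearMap.range_eq_bot]
      ext <;> simp [pairMap_apply]
    rw [hx, h, finrank_bot]
  | succ n ih =>
    rw [finrank_range_pairMap_zero_succ hx hx', ih]
    · rwa [← laurentAct_mul, ← pow_succ]
    · rwa [← laurentAct_mul, ← pow_succ]

/-- Both parities occur when a Jordan cell of even size carries a non-singular middle vector. -/
theorem InO.hasReverser_of_map_ne_zero (hQ : Nondefective Q) (hφ : InO Q φ) {j : ℕ} {x : V}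
    (hx : laurentAct φ ((T 1 - 1) ^ (2 * j + 2)) x = 0)
    (hQx : Q (laurentAct φ ((T 1 - 1) ^ (j + 1)) x) ≠ 0) (d : ZMod 2) : HasReverser Q φ d := by
  have hxx : Q.polarBilin (laurentAct φ ((T 1 - 1) ^ (2 * j + 1)) x) x ≠ 0 := by
    intro h0
    apply hQx
    have e1 : j + 1 + j = 2 * j + 1 := by ring
    have h := hφ.polarBilin_pow_pow (a := j + 1) (b := j) (by rwa [e1]) x
    rw [e1, h0, mul_zero] at h
    rw [pow_succ', laurentAct_mul, hφ.map_T_sub_one, ← laurentAct_mul, ← pow_succ', h, neg_zero]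
  have hnd := hφ.nondegenerate_cyclic T_sub_one_dvd_or_isCoprime hx (t := 1)
    (by rwa [laurentAct_one])
  have hx' : laurentAct φ ((T 1 - 1) ^ (2 * j + 1)) x ≠ 0 := by
    intro h; rw [h] at hxx; simp at hxx
  have hW := pairMap_invariant (φ := φ) x 0
  refine hφ.exists_hasReverser_add hQ hnd hW ?_ d
  have hφW := hφ.inO_restrictEquiv hW
  have hQW := nondefective_formOn hnd
  obtain ⟨d₀, hd⟩ := hφW.exists_hasReverser hQW
  have hd' := hd.mul_self hQW hφW
  have hD : dicksonInv (restrictEquiv φ _ hW) = 1 := by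
    have hrange : (LinearMap.range ((restrictEquiv φ _ hW).toLinearMap - LinearMap.id)).map
        (Submodule.subtype _) =
        LinearMap.range (pairMap φ (laurentAct φ (T 1 - 1) x) 0) := by
      ext v
      rw [mem_range_pairMap_zero]
      constructor
      · rintro ⟨_, ⟨⟨w, hw⟩, rfl⟩, rfl⟩
        obtain ⟨r, rfl⟩ := mem_range_pairMap_zero.1 hw
        exact ⟨r, by rw [laurentAct_comm, laurentAct_T_sub_one]; rfl⟩
      · rintro ⟨r, rfl⟩
        exact ⟨_, ⟨⟨_, laurentAct_mem_range_pairMap x 0 r⟩, rfl⟩,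
          by rw [laurentAct_comm, laurentAct_T_sub_one]; rfl⟩
    rw [dicksonInv, ← finrank_map_of_injective (Submodule.injective_subtype _), hrange,
      finrank_range_pairMap_zero (n := 2 * j)]
    · push_cast
      rw [show (2 : ZMod 2) = 0 from rfl, zero_mul, zero_add]
    · rwa [← laurentAct_mul, ← pow_succ]
    · rwa [← laurentAct_mul, ← pow_succ]
  rw [hD] at hd'
  exact hd.of_both hd'

theorem InO.hasReverser_of_socle_aux (hQ : Nondefective Q) (hφ : InO Q φ) (h2 : (2 : K) = 0)
    {j : ℕ} {x z₀ : V} (hx : laurentAct φ ((T 1 - 1) ^ (2 * j + 1)) x = 0)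
    (hz₀ : laurentAct φ ((T 1 - 1) ^ (2 * j + 1)) z₀ = 0)
    (hxz₀ : Q.polarBilin (laurentAct φ ((T 1 - 1) ^ (2 * j)) x) z₀ ≠ 0)
    (hQx : Q (laurentAct φ ((T 1 - 1) ^ j) x) ≠ 0) (d : ZMod 2) : HasReverser Q φ d := by
  obtain ⟨ℓ, hℓ, htr, hnorm⟩ := hφ.exists_halfForm h2 hx
  have hself : ∀ v, laurentAct φ ((T 1 - 1) ^ (2 * j + 1)) v = 0 →
      Q.polarBilin (laurentAct φ ((T 1 - 1) ^ (2 * j)) v) v = 0 := fun v hv => by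
    have h := hφ.polarBilin_pow_pow (a := j) (b := j) (by rwa [← two_mul]) v
    rw [polarBilin_self_two, h2, zero_mul, ← two_mul] at h
    simpa using h.symm
  have hn : ℓ ((T 1 - 1) ^ (2 * j)) ≠ 0 := by
    intro h0
    apply hQx
    obtain ⟨t, ht⟩ := exists_invert_T_sub_one_pow (K := K) j
    have h3 : (T 1 - 1 : K[T;T⁻¹]) ^ j * ((T 1 - 1) ^ j *
        (LaurentPolynomial.C ((-1) ^ j) + (T 1 - 1) * t)) =
        LaurentPolynomial.C ((-1) ^ j) * (T 1 - 1) ^ (2 * j) + (T 1 - 1) ^ (2 * j + 1) * t := by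
      ring
    rw [← hnorm, ht, h3, map_add, hℓ, add_zero, ← LaurentPolynomial.smul_eq_C_mul, map_smul, h0,
      smul_zero]
  obtain ⟨z, hz, hxz⟩ := hφ.exists_polarBilin_eq hx hz₀ hxz₀ hℓ
  have hsoc : Q.polarBilin (laurentAct φ ((T 1 - 1) ^ (2 * j)) x) z ≠ 0 := by rwa [hxz]
  have hnd := hφ.nondegenerate_bicyclic hx hz (hself x hx) (hself z hz) hsoc
  have hW := pairMap_invariant (φ := φ) x z
  refine hφ.exists_hasReverser_add hQ hnd hW ?_ d
  have hφW := hφ.inO_restrictEquiv hW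
  have hQW := nondefective_formOn hnd
  obtain ⟨e, he⟩ := exists_eq_apply_mul hℓ hn (μ := ℓ ∘ₗ invert.toLinearMap) fun r => by
    obtain ⟨t, ht⟩ := exists_invert_T_sub_one_pow (K := K) (2 * j + 1)
    change ℓ (invert ((T 1 - 1) ^ (2 * j + 1) * r)) = 0
    rw [map_mul invert, ht, mul_assoc, hℓ]
  replace he : ∀ r, ℓ (invert r) = ℓ (e * r) := he
  have he' : ∀ r, ℓ (e * invert r) = ℓ r := fun r => by rw [← he, invert_invert_apply]
  have hee : ∀ r, ℓ (e * invert e * r) = ℓ r := fun r => by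
    rw [← he' r, mul_assoc, ← he, map_mul invert, invert_invert_apply]
  have heex : laurentAct φ (e * invert e) x = x := by
    by_contra hne
    have h3 : laurentAct φ (e * invert e - 1) x ≠ 0 := by
      rwa [laurentAct_sub, laurentAct_one, sub_ne_zero]
    obtain ⟨q, hq⟩ := exists_laurentAct_eq_socle T_sub_one_dvd_or_isCoprime hx h3
    apply hn
    rw [← hxz, ← hq, hxz, mul_comm, sub_mul, one_mul, map_sub, hee, sub_self]
  obtain ⟨σ, hσ, hσv⟩ := hφ.exists_isReverser_pair e rfl hnd heex
    (fun r => by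
      rw [← hnorm, ← hnorm, map_mul invert, invert_invert_apply, ← hee (r * invert r)]
      congr 1; ring)
    (fun r => by rw [hxz, hxz, he']) hW
  have hyW : LinearMap.range (pairMap φ (z + x) z) = LinearMap.range (pairMap φ x z) := by
    ext v
    constructor
    · rintro ⟨⟨r, w⟩, rfl⟩
      exact ⟨(r, r + w), by simp only [pairMap_apply, LinearMap.add_apply, map_add]; abel⟩
    · rintro ⟨⟨r, w⟩, rfl⟩
      exact ⟨(r, w - r), by simp only [pairMap_apply, laurentAct_sub, map_add]; abel⟩
  have hQy : Q z = Q (z + x) := by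
    have h3 := hxz 1
    have h4 := hnorm 1
    rw [laurentAct_one] at h3 h4
    rw [map_one invert, mul_one] at h4
    rw [map_add_polarBilin, polarBilin_comm, h3, h4]
    linear_combination -Q x * h2
  have hcor : ∀ r, Q.polarBilin (laurentAct φ r z) z =
      Q.polarBilin (laurentAct φ r (z + x)) (z + x) := fun r => by
    have h3 := hxz r
    have h4 := hxz (invert r)
    have h5 := htr r
    rw [← hφ.polarBilin_laurentAct_comm r z x] at h4
    simp only [map_add, LinearMap.add_apply]
    linear_combination -h3 - h4 + h5 - h2 * (ℓ r + ℓ (invert r))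
  obtain ⟨σ', hσ', hσv'⟩ := hφ.exists_isReverser_swap hyW hnd
    (fun r => hφ.map_laurentAct_invert hQy hcor r) hW
  have hprod : ∀ r w (v : LinearMap.range (pairMap φ x z)),
      (v : V) = laurentAct φ r x + laurentAct φ w z →
      (((σ' * σ) v : LinearMap.range (pairMap φ x z)) : V) =
        laurentAct φ (w - invert (e * invert r)) x + laurentAct φ w z := fun r w v hv => by
    have h3 := hσv r w v hv
    have h4 := hσv' (e * invert r) (invert w - e * invert r) (σ v) (by
      rw [h3, map_add, laurentAct_sub]; abel)
    change ((σ' (σ v) : LinearMap.range (pairMap φ x z)) : V) = _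
    rw [h4, map_sub invert, invert_invert_apply, map_add]
    simp only [laurentAct_sub]
    abel
  have hD : dicksonInv (σ' * σ) = 1 := by
    have hrange : (LinearMap.range ((σ' * σ).toLinearMap - LinearMap.id)).map
        (Submodule.subtype _) = LinearMap.range (pairMap φ x 0) := by
      ext v
      rw [mem_range_pairMap_zero]
      constructor
      · rintro ⟨_, ⟨⟨_, ⟨r, w⟩, rfl⟩, rfl⟩, rfl⟩
        have h3 := hprod r w ⟨pairMap φ x z (r, w), _, rfl⟩ (pairMap_apply x z r w)
        refine ⟨w - invert (e * invert r) - r, ?_⟩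
        rw [laurentAct_sub]
        change _ = (((σ' * σ) _ : LinearMap.range (pairMap φ x z)) : V) - pairMap φ x z (r, w)
        rw [h3, pairMap_apply]
        abel
      · rintro ⟨w, rfl⟩
        have h3 := hprod 0 w ⟨pairMap φ x z (0, w), _, rfl⟩ (pairMap_apply x z 0 w)
        refine ⟨_, ⟨⟨pairMap φ x z (0, w), _, rfl⟩, rfl⟩, ?_⟩
        change (((σ' * σ) _ : LinearMap.range (pairMap φ x z)) : V) - pairMap φ x z (0, w) = _
        rw [h3, pairMap_apply]
        simp
    rw [dicksonInv, ← finrank_map_of_injective (Submodule.injective_subtype _), hrange,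
      finrank_range_pairMap_zero hx fun h => hxz₀ (by rw [h]; simp)]
    push_cast
    rw [show (2 : ZMod 2) = 0 from rfl, zero_mul, zero_add]
  rw [hσ'.inO.dicksonInv_mul hQW hσ.inO] at hD
  refine HasReverser.of_both ⟨σ, hσ, rfl⟩ ⟨σ', hσ', ?_⟩
  generalize dicksonInv σ' = a at hD
  generalize dicksonInv σ = b at hD
  revert a b; decide

/-- In characteristic two, both parities occur as soon as the socle form of some odd exponent is
non-zero. -/
theorem InO.hasReverser_of_socle (hQ : Nondefective Q) (hφ : InO Q φ) (h2 : (2 : K) = 0)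
    {j : ℕ} {x z : V} (hx : laurentAct φ ((T 1 - 1) ^ (2 * j + 1)) x = 0)
    (hz : laurentAct φ ((T 1 - 1) ^ (2 * j + 1)) z = 0)
    (hxz : Q.polarBilin (laurentAct φ ((T 1 - 1) ^ (2 * j)) x) z ≠ 0) (d : ZMod 2) :
    HasReverser Q φ d := by
  by_cases hQx : Q (laurentAct φ ((T 1 - 1) ^ j) x) = 0
  swap
  · exact hφ.hasReverser_of_socle_aux hQ h2 hx hz hxz hQx d
  by_cases hQz : Q (laurentAct φ ((T 1 - 1) ^ j) z) = 0
  swap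
  · refine hφ.hasReverser_of_socle_aux hQ h2 hz hx ?_ hQz d
    rw [hφ.polarBilin_socle_comm hx z]
    exact mul_ne_zero (pow_ne_zero _ (neg_ne_zero.2 one_ne_zero)) hxz
  refine hφ.hasReverser_of_socle_aux hQ h2 (x := x + z) (z₀ := z)
    (by rw [map_add, hx, hz, add_zero]) hz ?_ ?_ d
  · have h := hφ.polarBilin_pow_pow (a := j) (b := j) (by rwa [← two_mul]) z
    rw [polarBilin_self_two, h2, zero_mul, ← two_mul] at h
    have h' : Q.polarBilin (laurentAct φ ((T 1 - 1) ^ (2 * j)) z) z = 0 := by simpa using h.symm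
    rwa [map_add, map_add, LinearMap.add_apply, h', add_zero]
  · rw [map_add, map_add_polarBilin, hQx, hQz, zero_add, zero_add,
      hφ.polarBilin_pow_pow (by rwa [← two_mul]), ← two_mul]
    exact mul_ne_zero (pow_ne_zero _ (neg_ne_zero.2 one_ne_zero)) hxz

end BothParities

section Commuting

open LaurentPolynomial

variable [Field K] [AddCommGroup V] [Module K V] {Q : QuadraticForm K V} {φ : V ≃ₗ[K] V}

theorem InO.polarBilin_pow_eq_zero (hφ : InO Q φ) (h2 : (2 : K) = 0) {i j : ℕ} (hij : i ≤ j)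
    {y : V} (hy : laurentAct φ ((T 1 - 1) ^ (2 * i)) y = 0) (x : V) :
    Q.polarBilin (laurentAct φ ((T 1 - 1) ^ j) x) (laurentAct φ ((T 1 - 1) ^ i) y) = 0 := by
  obtain ⟨k, rfl⟩ := Nat.exists_eq_add_of_le hij
  have h : invert ((T 1 - 1 : K[T;T⁻¹]) ^ (i + k)) * (T 1 - 1) ^ i =
      T (-(i + k : ℕ)) * (T 1 - 1) ^ k * (T 1 - 1) ^ (2 * i) := by
    rw [invert_T_sub_one_pow h2]; ring
  rw [hφ.polarBilin_laurentAct, ← laurentAct_mul, h, laurentAct_mul, hy, map_zero, map_zero]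

variable [FiniteDimensional K V]

theorem InO.exists_pow_eq_of_orth (hQ : Nondefective Q) (hφ : InO Q φ) {k : ℕ} {u : V}
    (h : ∀ z, laurentAct φ ((T 1 - 1) ^ k) z = 0 → Q.polarBilin u z = 0) :
    ∃ y, laurentAct φ ((T 1 - 1) ^ k) y = u :=
  hφ.exists_laurentAct_eq_of_orth hQ fun z hz =>
    h z (laurentAct_invert_T_sub_one_pow (by rwa [map_pow invert] at hz))

/-- If no unipotent block yields both parities, there is a Lagrangian stable under the
centralizer of `φ`. -/
theorem InO.exists_isLagrangian (hQ : Nondefective Q) (hφ : InO Q φ) (h2 : (2 : K) = 0) {N : ℕ}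
    (hN : ∀ v, laurentAct φ ((T 1 - 1) ^ N) v = 0)
    (hA : ∀ j x, laurentAct φ ((T 1 - 1) ^ (2 * j + 2)) x = 0 →
      Q (laurentAct φ ((T 1 - 1) ^ (j + 1)) x) = 0)
    (hB : ∀ j x z, laurentAct φ ((T 1 - 1) ^ (2 * j + 1)) x = 0 →
      laurentAct φ ((T 1 - 1) ^ (2 * j + 1)) z = 0 →
      Q.polarBilin (laurentAct φ ((T 1 - 1) ^ (2 * j)) x) z = 0) :
    ∃ L, IsLagrangian Q L ∧
      ∀ g : V →ₗ[K] V, (∀ x, g (φ x) = φ (g x)) → ∀ x ∈ L, g x ∈ L := by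
  let G : Set V := {v | ∃ j x, laurentAct φ ((T 1 - 1) ^ (2 * j)) x = 0 ∧
    laurentAct φ ((T 1 - 1) ^ j) x = v}
  have hGG : ∀ a ∈ G, ∀ b ∈ G, Q.polarBilin a b = 0 := by
    rintro _ ⟨j, x, hx, rfl⟩ _ ⟨i, y, hy, rfl⟩
    rcases le_total i j with hij | hij
    · exact hφ.polarBilin_pow_eq_zero h2 hij hy x
    · rw [polarBilin_comm]
      exact hφ.polarBilin_pow_eq_zero h2 hij hx y
  have hLG : Submodule.span K G ≤ polarOrth Q (Submodule.span K G) := by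
    refine Submodule.span_le.2 fun b hb => mem_polarOrth.2 fun a ha => ?_
    induction ha using Submodule.span_induction with
    | mem a ha => exact hGG a ha b hb
    | zero => simp
    | add a a' _ _ h h' => rw [map_add, LinearMap.add_apply, h, h', add_zero]
    | smul c a _ h => rw [map_smul, LinearMap.smul_apply, h, smul_zero]
  have hQL : ∀ a ∈ Submodule.span K G, Q a = 0 := by
    intro a ha
    induction ha using Submodule.span_induction with
    | mem a ha =>
      obtain ⟨j, x, hx, rfl⟩ := ha
      cases j with
      | zero => rw [mul_zero, pow_zero, laurentAct_one] at hx; simp [hx]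
      | succ j => exact hA j x hx
    | zero => simp
    | add a b ha hb h h' =>
      rw [map_add_polarBilin, h, h', mem_polarOrth.1 (hLG hb) a ha, add_zero, add_zero]
    | smul c a _ h => rw [QuadraticMap.map_smul, h, smul_zero]
  have key : ∀ k y, y ∈ polarOrth Q (Submodule.span K G) →
      laurentAct φ ((T 1 - 1) ^ k) y = 0 → y ∈ Submodule.span K G := by
    intro k
    induction k with
    | zero =>
      intro y _ hy
      rw [pow_zero, laurentAct_one] at hy
      rw [hy]; exact zero_mem _
    | succ k ih =>
      intro y hyo hy
      obtain ⟨w, hw⟩ := hφ.exists_pow_eq_of_orth hQ (k := 2 * k)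
        (u := laurentAct φ ((T 1 - 1) ^ k) y) fun z hz => by
          rw [hφ.polarBilin_laurentAct, invert_T_sub_one_pow h2, laurentAct_mul, polarBilin_comm]
          refine mem_polarOrth.1 hyo _ (Submodule.subset_span ⟨k, _, ?_, rfl⟩)
          rw [laurentAct_comm, hz, map_zero]
      have hw' : laurentAct φ ((T 1 - 1) ^ (2 * k + 1)) w = 0 := by
        rw [pow_succ', laurentAct_mul, hw, ← laurentAct_mul, ← pow_succ', hy]
      obtain ⟨w₁, hw₁⟩ := hφ.exists_pow_eq_of_orth hQ (k := 2 * k + 1) fun z hz => hB k w z hw' hz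
      have hmem : laurentAct φ ((T 1 - 1) ^ (k + 1)) w₁ ∈ Submodule.span K G := by
        refine Submodule.subset_span ⟨k + 1, w₁, ?_, rfl⟩
        rw [mul_add, mul_one, pow_succ', laurentAct_mul, hw₁, ← laurentAct_mul, ← pow_succ', hw']
      have hdiff := ih (y - laurentAct φ ((T 1 - 1) ^ (k + 1)) w₁)
        (Submodule.sub_mem _ hyo (hLG hmem)) (by
          rw [map_sub, ← laurentAct_mul, ← pow_add, ← add_assoc, ← two_mul, hw₁, hw, sub_self])
      simpa using Submodule.add_mem _ hdiff hmem
  refine ⟨Submodule.span K G, ⟨hQL, fun y hy => key N y hy (hN y)⟩, fun g hg x hx => ?_⟩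
  induction hx using Submodule.span_induction with
  | mem a ha =>
    obtain ⟨j, x, hx, rfl⟩ := ha
    refine Submodule.subset_span ⟨j, g x, ?_, (laurentAct_commute φ g hg _ x).symm⟩
    rw [← laurentAct_commute φ g hg, hx, map_zero]
  | zero => rw [map_zero]; exact zero_mem _
  | add a b _ _ h h' => rw [map_add]; exact add_mem h h'
  | smul c a _ h => rw [map_smul]; exact Submodule.smul_mem _ c h

theorem InO.hasReverser_of_unipotent (hQ : Nondefective Q) (hφ : InO Q φ) (h2 : (2 : K) = 0)
    {N : ℕ} (hN : ∀ v, laurentAct φ ((T 1 - 1) ^ N) v = 0) {g : V ≃ₗ[K] V} (hg : InO Q g)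
    (hgφ : ∀ x, g (φ x) = φ (g x)) (hD : dicksonInv g = 1) (d : ZMod 2) :
    HasReverser Q φ d := by
  by_contra hd
  obtain ⟨L, hL, hgL⟩ := hφ.exists_isLagrangian hQ h2 hN
    (fun j x hx => by
      by_contra h
      exact hd (hφ.hasReverser_of_map_ne_zero hQ hx h d))
    (fun j x z hx hz => by
      by_contra h
      exact hd (hφ.hasReverser_of_socle hQ h2 hx hz h d))
  rw [hL.dicksonInv_eq_zero hQ hg (hgL g.toLinearMap hgφ)] at hD
  exact zero_ne_one hD

/-- Orthogonal Fitting decomposition for a Laurent polynomial in an isometry. -/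
theorem InO.exists_fitting (hφ : InO Q φ) {p u : K[T;T⁻¹]} (hp : invert p = p * u) :
    ∃ W W' : Submodule K V, IsCompl W W' ∧ (∀ w ∈ W, ∀ w' ∈ W', Q.polarBilin w w' = 0) ∧
      (∃ N, ∀ w ∈ W, laurentAct φ (p ^ N) w = 0) ∧
      (∀ w ∈ W', laurentAct φ p w = 0 → w = 0) ∧
      ∀ g : V →ₗ[K] V, (∀ x, g (φ x) = φ (g x)) → (∀ x ∈ W, g x ∈ W) ∧ ∀ x ∈ W', g x ∈ W' := by
  obtain ⟨N, hN, hN1⟩ := ((LinearMap.eventually_isCompl_ker_pow_range_pow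
    (laurentAct φ p)).and (Filter.eventually_ge_atTop 1)).exists
  rw [← map_pow] at hN
  refine ⟨_, _, hN, ?_, ⟨N, fun w hw => hw⟩, ?_, fun g hg => ⟨?_, ?_⟩⟩
  · rintro w hw _ ⟨v, rfl⟩
    rw [polarBilin_comm, hφ.polarBilin_laurentAct, map_pow invert, hp, mul_pow, mul_comm,
      laurentAct_mul, LinearMap.mem_ker.1 hw, map_zero, map_zero]
  · intro w hw h0
    obtain ⟨k, rfl⟩ := Nat.exists_eq_add_of_le' hN1
    have : w ∈ LinearMap.ker (laurentAct φ (p ^ (k + 1))) := by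
      rw [LinearMap.mem_ker, pow_succ, laurentAct_mul, h0, map_zero]
    exact (Submodule.mem_bot K).1 (hN.inf_eq_bot ▸ Submodule.mem_inf.2 ⟨this, hw⟩)
  · intro x hx
    rw [LinearMap.mem_ker] at hx ⊢
    rw [← laurentAct_commute φ g hg, hx, map_zero]
  · rintro _ ⟨v, rfl⟩
    exact ⟨g v, (laurentAct_commute φ g hg _ v).symm⟩

theorem HasReverser.neg (hQ : Nondefective Q) (h2 : (2 : K) ≠ 0) {d : ZMod 2}
    (h : HasReverser Q φ d) : HasReverser Q φ (finrank K V + d) := by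
  obtain ⟨σ, hσ, rfl⟩ := h
  have hneg : InO Q (LinearEquiv.neg K : V ≃ₗ[K] V) := fun v => QuadraticMap.map_neg Q v
  refine ⟨LinearEquiv.neg K * σ, ⟨hneg.mul hσ.inO, fun x => ?_, fun x => ?_⟩, ?_⟩
  · change -σ (-σ x) = x
    rw [map_neg σ, neg_neg, hσ.invol]
  · change -σ (φ (-σ (φ x))) = x
    rw [map_neg φ, map_neg σ, neg_neg, hσ.rev]
  · rw [hneg.dicksonInv_mul hQ hσ.inO, dicksonInv_eq_add]
    have : LinearMap.ker ((LinearEquiv.neg K : V ≃ₗ[K] V).toLinearMap - LinearMap.id) = ⊥ := by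
      rw [LinearMap.ker_eq_bot']
      intro x hx
      change -x - x = 0 at hx
      have h3 : (2 : K) • x = 0 := by rw [two_smul, ← neg_eq_zero, neg_add, ← sub_eq_add_neg, hx]
      exact (smul_eq_zero.1 h3).resolve_left h2
    rw [this, finrank_bot, Nat.cast_zero, add_zero]

theorem InO.hasReverser_of_commute_of_two_ne_zero (hQ : Nondefective Q) (hφ : InO Q φ)
    (h2 : (2 : K) ≠ 0) {g : V ≃ₗ[K] V} (hg : InO Q g) (hgφ : ∀ x, g (φ x) = φ (g x))
    (hD : dicksonInv g = 1) (d : ZMod 2) : HasReverser Q φ d := by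
  obtain ⟨W, W', hc, ho, ⟨N, hN⟩, hinj, hinv⟩ := hg.exists_fitting
    (p := T 1 + 1) (u := T (-1)) (by
      rw [map_add invert, map_one invert, invert_T, add_mul, ← T_add]; simp [add_comm])
  obtain ⟨hgW, hgW'⟩ := hinv g.toLinearMap fun x => rfl
  obtain ⟨hφW, hφW'⟩ := hinv φ.toLinearMap fun x => (hgφ x).symm
  have hQW := hQ.nondefective_formOn_left hc ho
  have hQW' := hQ.nondefective_formOn_left hc.symm
    fun w hw w' hw' => by rw [polarBilin_comm]; exact ho w' hw' w hw
  rw [dicksonInv_eq_restrictEquiv_add hc g hgW hgW',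
    (hg.inO_restrictEquiv hgW').dicksonInv_eq_zero_of_ker_add hQW' fun x hx => Subtype.ext
      (hinj x x.2 (by
        rw [laurentAct_add, laurentAct_T_one, laurentAct_one]
        exact congrArg Subtype.val hx)), add_zero, dicksonInv_eq_add] at hD
  have hker : LinearMap.ker ((restrictEquiv g W hgW).toLinearMap - LinearMap.id) = ⊥ := by
    rw [LinearMap.ker_eq_bot']
    intro x hx
    have hx' : g x = x := congrArg Subtype.val (sub_eq_zero.1 hx)
    have hpow : ∀ n, laurentAct g ((T 1 + 1) ^ n) (x : V) = (2 : K) ^ n • (x : V) := fun n => by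
      induction n with
      | zero => rw [pow_zero, laurentAct_one, pow_zero, one_smul]
      | succ n ih =>
        rw [pow_succ', laurentAct_mul, ih, map_smul, laurentAct_add, laurentAct_T_one,
          laurentAct_one, hx', ← two_smul K, smul_smul, pow_succ]
    have h0 := hN x x.2
    rw [hpow] at h0
    exact Subtype.ext ((smul_eq_zero.1 h0).resolve_left (pow_ne_zero N h2))
  rw [hker, finrank_bot, Nat.cast_zero, add_zero] at hD
  refine hφ.exists_hasReverser_add hQ (hQ.nondegenerate_left hc ho) hφW ?_ d
  obtain ⟨d₀, hd⟩ := (hφ.inO_restrictEquiv hφW).exists_hasReverser hQW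
  have hd' := hd.neg hQW h2
  rw [hD, add_comm] at hd'
  exact hd.of_both hd'

theorem InO.dicksonInv_eq_zero_of_commute_of_fixed (hQ : Nondefective Q) (hφ : InO Q φ)
    (h2 : (2 : K) = 0) {g : V ≃ₗ[K] V} (hg : InO Q g) (hgφ : ∀ x, g (φ x) = φ (g x))
    (h1 : ∀ x, φ x = x → x = 0) : dicksonInv g = 0 := by
  let A := φ.toLinearMap - LinearMap.id
  have hA : Function.Injective A := by
    rw [← LinearMap.ker_eq_bot, LinearMap.ker_eq_bot']
    exact fun x hx => h1 x (sub_eq_zero.1 hx)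
  let E := LinearEquiv.ofInjectiveEndo A hA
  have hE : ∀ x, E x = φ x - x := fun x => rfl
  refine hg.dicksonInv_eq_zero_of_commute hQ h2 E.symm.toLinearMap (fun x y => ?_) fun x => ?_
  · obtain ⟨a, rfl⟩ := E.surjective x
    obtain ⟨b, rfl⟩ := E.surjective y
    simp only [LinearEquiv.coe_coe, LinearEquiv.symm_apply_apply]
    simp only [hE, map_sub, LinearMap.sub_apply, hφ.polarBilin_map]
    ring
  · obtain ⟨a, rfl⟩ := E.surjective x
    have : g (E a) = E (g a) := by rw [hE, hE, map_sub g, hgφ]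
    simp only [LinearEquiv.coe_coe, this, LinearEquiv.symm_apply_apply]

theorem coe_laurentAct_restrictEquiv {W : Submodule K V} (h : ∀ x ∈ W, φ x ∈ W) (n : ℕ) (w : W) :
    (laurentAct (restrictEquiv φ W h) ((T 1 - 1) ^ n) w : V) =
      laurentAct φ ((T 1 - 1) ^ n) w := by
  induction n with
  | zero => rw [pow_zero, laurentAct_one, laurentAct_one]
  | succ n ih =>
    rw [pow_succ', laurentAct_mul, laurentAct_T_sub_one, laurentAct_mul,
      laurentAct_T_sub_one, ← ih]
    rfl

theorem InO.hasReverser_of_commute_of_two_eq_zero (hQ : Nondefective Q) (hφ : InO Q φ)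
    (h2 : (2 : K) = 0) {g : V ≃ₗ[K] V} (hg : InO Q g) (hgφ : ∀ x, g (φ x) = φ (g x))
    (hD : dicksonInv g = 1) (d : ZMod 2) : HasReverser Q φ d := by
  obtain ⟨W, W', hc, ho, ⟨N, hN⟩, hinj, hinv⟩ := hφ.exists_fitting invert_T_sub_one
  obtain ⟨hgW, hgW'⟩ := hinv g.toLinearMap hgφ
  obtain ⟨hφW, hφW'⟩ := hinv φ.toLinearMap fun x => rfl
  have hQW := hQ.nondefective_formOn_left hc ho
  have hQW' := hQ.nondefective_formOn_left hc.symm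
    fun w hw w' hw' => by rw [polarBilin_comm]; exact ho w' hw' w hw
  rw [dicksonInv_eq_restrictEquiv_add hc g hgW hgW',
    (hφ.inO_restrictEquiv hφW').dicksonInv_eq_zero_of_commute_of_fixed hQW' h2
      (hg.inO_restrictEquiv hgW') (fun x => Subtype.ext (hgφ x)) fun x hx => Subtype.ext
        (hinj x x.2 (by
          rw [laurentAct_T_sub_one, sub_eq_zero]
          exact congrArg Subtype.val hx)), add_zero] at hD
  exact hφ.exists_hasReverser_add hQ (hQ.nondegenerate_left hc ho) hφW
    ((hφ.inO_restrictEquiv hφW).hasReverser_of_unipotent hQW h2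
      (fun v => Subtype.ext ((coe_laurentAct_restrictEquiv hφW N v).trans (hN v v.2)))
      (hg.inO_restrictEquiv hgW) (fun x => Subtype.ext (hgφ x)) hD) d

/-- If an improper isometry commutes with `φ`, then reversers of both parities exist. -/
theorem InO.hasReverser_of_commute (hQ : Nondefective Q) (hφ : InO Q φ) {g : V ≃ₗ[K] V}
    (hg : InO Q g) (hgφ : ∀ x, g (φ x) = φ (g x)) (hD : dicksonInv g = 1) (d : ZMod 2) :
    HasReverser Q φ d := by
  by_cases h2 : (2 : K) = 0
  · exact hφ.hasReverser_of_commute_of_two_eq_zero hQ h2 hg hgφ hD d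
  · exact hφ.hasReverser_of_commute_of_two_ne_zero hQ h2 hg hgφ hD d

theorem InSO.hasReverser_zero (hQ : Nondefective Q) (hφ : InSO Q φ) {α : V ≃ₗ[K] V}
    (hα : InSO Q α) (hrev : α⁻¹ * φ * α = φ⁻¹) : HasReverser Q φ 0 := by
  obtain ⟨d, σ, hσ, hd⟩ := hφ.1.exists_hasReverser hQ
  rcases (show ∀ d : ZMod 2, d = 0 ∨ d = 1 by clear hd d; decide) d with rfl | rfl
  · exact ⟨σ, hσ, hd⟩
  · refine hφ.1.hasReverser_of_commute hQ (hα.1.mul hσ.inO) (fun x => ?_) ?_ 0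
    · change α (σ (φ x)) = φ (α (σ x))
      have h1 : φ * α = α * φ⁻¹ := by rw [← hrev]; group
      have h3 : φ (α (σ x)) = α (φ⁻¹ (σ x)) := LinearEquiv.congr_fun h1 (σ x)
      rw [h3]
      congr 1
      apply φ.injective
      rw [← hσ.invol (φ (σ (φ x))), hσ.rev]
      exact (LinearEquiv.apply_symm_apply φ (σ x)).symm
    · rw [hα.1.dicksonInv_mul hQ hσ.inO, (inSO_iff.1 hα).2, hd, zero_add]

theorem HasReverser.bireflSO (hQ : Nondefective Q) (hφ : InSO Q φ) (h : HasReverser Q φ 0) :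
    BireflSO Q φ := by
  obtain ⟨σ, hσ, hd⟩ := h
  refine ⟨σ, σ * φ, inSO_iff.2 ⟨hσ.inO, hd⟩, inSO_iff.2 ⟨hσ.inO.mul hφ.1, ?_⟩,
    LinearEquiv.ext hσ.invol, LinearEquiv.ext hσ.rev, LinearEquiv.ext fun x => ?_⟩
  · rw [hσ.inO.dicksonInv_mul hQ hφ.1, hd, (inSO_iff.1 hφ).2, zero_add]
  · exact (hσ.invol (φ x)).symm

end Commuting

theorem stmt4 [Field K] [AddCommGroup V] [Module K V] [FiniteDimensional K V]
    (Q : QuadraticForm K V) (hQ : Nondefective Q)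
    (φ : V ≃ₗ[K] V) (hφ : InSO Q φ)
    (hrev : ∃ α : V ≃ₗ[K] V, InSO Q α ∧ α⁻¹ * φ * α = φ⁻¹) :
    BireflSO Q φ := by
  obtain ⟨α, hα, hαφ⟩ := hrev
  exact (hφ.hasReverser_zero hQ hα hαφ).bireflSO hQ hφ
end

section
/- Suppose char K = 2 and φ ∈ O(V,Q) is of type 1. Then there exists ψ ∈ O(V,Q) with ψ² = φ if and only if φ is of type 1o. -/
open Polynomial Module

variable {K V : Type*}

/-- Multiplication by the unit `t`, with inverse `t'`, is an isometry of `Q`; moreover `n = t + 1`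
and `s = n ^ 2 * t'` is, in characteristic two, the product of `n` and its adjoint. -/
structure IsometricUnit {R : Type*} [Field K] [AddCommGroup V] [Module K V] [CommRing R]
    [Module R V] (Q : QuadraticForm K V) (t t' n s : R) : Prop where
  mul_inv : t * t' = 1
  n_eq : n = t + 1
  s_eq : s = n ^ 2 * t'
  isometry : ∀ x : V, Q (t • x) = Q x

namespace IsometricUnit

open QuadraticMap

variable {R : Type*} [Field K] [AddCommGroup V] [Module K V] [CommRing R] [Module R V]
  {Q : QuadraticForm K V} {t t' n s : R}

theorem isometry_inv (h : IsometricUnit Q t t' n s) (x : V) : Q (t' • x) = Q x := by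
  rw [← h.isometry, smul_smul, h.mul_inv, one_smul]

theorem isometry_inv_pow (h : IsometricUnit Q t t' n s) (j : ℕ) (x : V) :
    Q (t' ^ j • x) = Q x := by
  induction j with
  | zero => simp
  | succ j ih => rw [pow_succ', mul_smul, h.isometry_inv, ih]

theorem polar_smul (h : IsometricUnit Q t t' n s) (x y : V) :
    polar Q (t • x) (t • y) = polar Q x y := by
  simp only [polar, ← smul_add, h.isometry]

theorem polar_adjoint (h : IsometricUnit Q t t' n s) (x y : V) :
    polar Q (t • x) y = polar Q x (t' • y) := by
  rw [← h.polar_smul x, smul_smul, h.mul_inv, one_smul]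

theorem polar_n_pow (h : IsometricUnit Q t t' n s) (k : ℕ) (x y : V) :
    polar Q (n ^ k • x) y = polar Q x ((n * t') ^ k • y) := by
  induction k generalizing x y with
  | zero => simp
  | succ k ih =>
    have hn : n * t' = t' + 1 := by rw [h.n_eq]; linear_combination h.mul_inv
    rw [pow_succ, mul_smul, ih, h.n_eq, add_smul, one_smul, polar_add_left, h.polar_adjoint,
      ← polar_add_right, ← h.n_eq, pow_succ', mul_smul, hn, add_smul, one_smul]

theorem polar_n_pow_n_pow (h : IsometricUnit Q t t' n s) (k : ℕ) (x y : V) :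
    polar Q (n ^ k • x) (n ^ k • y) = polar Q x (s ^ k • y) := by
  rw [h.polar_n_pow, smul_smul, ← mul_pow, h.s_eq]
  congr 2
  ring

theorem polar_s_pow (h : IsometricUnit Q t t' n s) (k : ℕ) (x y : V) :
    polar Q (s ^ k • x) y = polar Q x (s ^ k • y) := by
  rw [← h.polar_n_pow_n_pow, polar_comm, ← h.polar_n_pow_n_pow, polar_comm]

theorem s_pow (h : IsometricUnit Q t t' n s) (k : ℕ) : s ^ k = t' ^ k * n ^ (2 * k) := by
  rw [h.s_eq, mul_pow, pow_mul, mul_comm]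

theorem s_pow_eq_zero (h : IsometricUnit Q t t' n s) {e i : ℕ} (hn : n ^ (2 * e + 1) = 0)
    (hi : e < i) : s ^ i = 0 := by
  rw [h.s_pow, pow_eq_zero_of_le (by omega) hn, mul_zero]

theorem s_pow_mul_n_eq_zero (h : IsometricUnit Q t t' n s) {e i : ℕ} (hn : n ^ (2 * e + 1) = 0)
    (hi : e ≤ i) : s ^ i * n = 0 := by
  rw [h.s_pow, mul_assoc, ← pow_succ, pow_eq_zero_of_le (by omega) hn, mul_zero]

/-- The top nonzero power of `n` absorbs `t'`. -/
theorem n_pow_mul_inv (h : IsometricUnit Q t t' n s) [CharP R 2] {m : ℕ} (hn : n ^ (m + 1) = 0)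
    (k : ℕ) : n ^ m * t' ^ k = n ^ m := by
  induction k with
  | zero => simp
  | succ k ih =>
    have h1 : n ^ m * t = n ^ m := by
      have : n ^ m * n = 0 := by rw [← pow_succ, hn]
      rw [h.n_eq] at this ⊢
      linear_combination this - (t + 1) ^ m * CharTwo.two_eq_zero (R := R)
    linear_combination t' * ih - t' * h1 + n ^ m * h.mul_inv

theorem Q_s_pow (h : IsometricUnit Q t t' n s) (j : ℕ) (x : V) :
    Q (s ^ j • x) = Q (n ^ (2 * j) • x) := by
  rw [h.s_pow, mul_smul, h.isometry_inv_pow]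

theorem polar_self_eq_zero [CharP K 2] (Q : QuadraticForm K V) (x : V) : polar Q x x = 0 := by
  rw [QuadraticMap.polar_self, two_nsmul, CharTwo.add_self_eq_zero]

theorem polar_s_pow_self (h : IsometricUnit Q t t' n s) [CharP K 2] (k : ℕ) (x : V) :
    polar Q x (s ^ k • x) = 0 := by
  rw [← h.polar_n_pow_n_pow, polar_self_eq_zero]

theorem map_add' (Q : QuadraticForm K V) (x y : V) : Q (x + y) = Q x + Q y + polar Q x y :=
  QuadraticMap.map_add Q x y

theorem Q_n (h : IsometricUnit Q t t' n s) [CharP K 2] (x : V) :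
    Q (n • x) = polar Q (n • x) x := by
  rw [h.n_eq, add_smul, one_smul, map_add', h.isometry, polar_add_left, polar_self_eq_zero,
    CharTwo.add_self_eq_zero, zero_add, add_zero]

theorem Q_n_pow_succ (h : IsometricUnit Q t t' n s) [CharP K 2] (k : ℕ) (x : V) :
    Q (n ^ (k + 1) • x) = polar Q x ((s ^ k * n) • x) := by
  rw [pow_succ', mul_smul, h.Q_n, polar_comm, smul_comm, h.polar_n_pow_n_pow, mul_smul]

theorem Q_n_pow_eq_zero (h : IsometricUnit Q t t' n s) [CharP K 2] {e i : ℕ}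
    (hn : n ^ (2 * e + 1) = 0) (hi : e < i) (x : V) : Q (n ^ i • x) = 0 := by
  obtain ⟨i, rfl⟩ : ∃ j, i = j + 1 := ⟨i - 1, by omega⟩
  rw [h.Q_n_pow_succ, h.s_pow_mul_n_eq_zero hn (by omega), zero_smul, polar_zero_right]

/-! ### Nondegenerate submodules -/

/-- If an element of `W` that is orthogonal to `n ^ m • W` always lies in `n • W`, then `W` is
nondegenerate. -/
theorem nondegenerate_of_top (h : IsometricUnit Q t t' n s) [CharP R 2] {m : ℕ}
    (hn : n ^ (m + 1) = 0) (W : Submodule R V)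
    (hW : ∀ y ∈ W, (∀ w ∈ W, polar Q y (n ^ m • w) = 0) → ∃ z ∈ W, y = n • z)
    (x : V) (hx : x ∈ W) (hxW : ∀ w ∈ W, polar Q x w = 0) : x = 0 := by
  have key : ∀ k ≤ m + 1, ∃ y ∈ W, x = n ^ k • y := by
    intro k
    induction k with
    | zero => exact fun _ => ⟨x, hx, by simp⟩
    | succ k ih =>
      intro hk
      obtain ⟨y, hy, rfl⟩ := ih (by omega)
      obtain ⟨z, hz, rfl⟩ := hW y hy fun w hw => by
        have := hxW (n ^ (m - k) • w) (W.smul_mem _ hw)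
        rw [h.polar_n_pow, smul_smul, mul_pow, mul_right_comm, ← pow_add,
          Nat.add_sub_cancel' (by omega), h.n_pow_mul_inv hn] at this
        exact this
      exact ⟨z, hz, by rw [smul_smul, pow_succ]⟩
  obtain ⟨y, -, rfl⟩ := key (m + 1) le_rfl
  rw [hn, zero_smul]

theorem polar_n_smul_n_pow (h : IsometricUnit Q t t' n s) {m : ℕ}
    (hn : n ^ (m + 1) = 0) (x y : V) : polar Q (n • x) (n ^ m • y) = 0 := by
  have := h.polar_n_pow 1 x (n ^ m • y)
  rw [pow_one, pow_one, smul_smul, mul_right_comm, ← pow_succ', hn, zero_mul, zero_smul,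
    polar_zero_right] at this
  exact this

theorem polar_top_comm (h : IsometricUnit Q t t' n s) [CharP R 2] {m : ℕ}
    (hn : n ^ (m + 1) = 0) (x y : V) : polar Q x (n ^ m • y) = polar Q y (n ^ m • x) := by
  rw [polar_comm, h.polar_n_pow, mul_pow, h.n_pow_mul_inv hn]

theorem exists_polar_ne_zero {m : ℕ} (hQ : ∀ x : V, (∀ y, polar Q x y = 0) → x = 0)
    (hm : ∃ x : V, n ^ m • x ≠ 0) : ∃ u v : V, polar Q u (n ^ m • v) ≠ 0 := by
  by_contra! hcon
  obtain ⟨x, hx⟩ := hm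
  exact hx (hQ _ fun y => by rw [polar_comm, hcon])

/-- `Q` admits no proper nonzero nondegenerate `R`-submodule. -/
def Indec (R : Type*) [CommRing R] [Module R V] (Q : QuadraticForm K V) : Prop :=
  ∀ W : Submodule R V, W ≠ ⊥ → (∀ x ∈ W, (∀ w ∈ W, polar Q x w = 0) → x = 0) → W = ⊤

variable [Algebra K R]

theorem exists_eq_algebraMap_add (h : IsometricUnit Q t t' n s) [CharP R 2]
    (hgen : ∀ r : R, ∃ p : K[X], aeval t p = r) (r : R) :
    ∃ (a : K) (r' : R), r = algebraMap K R a + n * r' := by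
  obtain ⟨p, rfl⟩ := hgen r
  obtain ⟨q, hq⟩ := X_sub_C_dvd_sub_C_eval (a := 1) (p := p)
  refine ⟨p.eval 1, aeval t q, ?_⟩
  have := congrArg (aeval t) hq
  simp only [map_sub, map_mul, aeval_C, aeval_X, map_one, CharTwo.sub_eq_add (R := R),
    ← h.n_eq] at this
  linear_combination this - algebraMap K R (p.eval 1) * CharTwo.two_eq_zero (R := R)

theorem functional_ext (h : IsometricUnit Q t t' n s) [CharP R 2]
    (hgen : ∀ r : R, ∃ p : K[X], aeval t p = r) {f g : R →ₗ[K] K}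
    (h₀ : ∀ k, f (s ^ k) = g (s ^ k)) (h₁ : ∀ k, f (s ^ k * n) = g (s ^ k * n)) : f = g := by
  have key : ∀ i k, f (t ^ i * s ^ k) = g (t ^ i * s ^ k) ∧
      f (t ^ i * (s ^ k * n)) = g (t ^ i * (s ^ k * n)) := by
    intro i
    induction i with
    | zero => exact fun k => by simp [h₀, h₁]
    | succ i ih =>
      intro k
      have e₀ : t ^ (i + 1) * s ^ k = t ^ i * s ^ k + t ^ i * (s ^ k * n) := by
        rw [h.n_eq]
        linear_combination -t ^ i * s ^ k * CharTwo.two_eq_zero (R := R)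
      have e₁ : t ^ (i + 1) * (s ^ k * n) =
          t ^ i * (s ^ k * n) + (t ^ i * s ^ (k + 1) + t ^ i * (s ^ (k + 1) * n)) := by
        have h2 : n ^ 2 = s + s * n := by
          linear_combination (-1 - n) * h.s_eq - n ^ 2 * h.mul_inv - n ^ 2 * t' * h.n_eq
            - n ^ 2 * t' * CharTwo.two_eq_zero (R := R)
        rw [pow_succ s]
        linear_combination t ^ i * s ^ k * (h2 - n * h.n_eq - n * CharTwo.two_eq_zero (R := R))
      simp only [e₀, e₁, map_add, ih, and_self]
  ext r
  obtain ⟨p, rfl⟩ := hgen r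
  induction p using Polynomial.induction_on' with
  | add p q hp hq => simp only [map_add, hp, hq]
  | monomial i a =>
    have := (key i 0).1
    rw [pow_zero, mul_one] at this
    rw [aeval_monomial, ← Algebra.smul_def, map_smul, map_smul, this]

variable [IsScalarTower K R V]

theorem exists_smul_eq (h : IsometricUnit Q t t' n s) [CharP R 2]
    (hgen : ∀ r : R, ∃ p : K[X], aeval t p = r) (r : R) (x : V) :
    ∃ (a : K) (r' : R), r • x = a • x + n • (r' • x) := by
  obtain ⟨a, r', hr⟩ := h.exists_eq_algebraMap_add hgen r
  exact ⟨a, r', by rw [hr, add_smul, algebraMap_smul, mul_smul]⟩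

theorem span_singleton_eq_top (h : IsometricUnit Q t t' n s) [CharP R 2]
    (hgen : ∀ r : R, ∃ p : K[X], aeval t p = r) (hind : Indec R Q) {m : ℕ}
    (hn : n ^ (m + 1) = 0) {u : V} (hu : polar Q u (n ^ m • u) ≠ 0) :
    Submodule.span R {u} = ⊤ := by
  refine hind _ ?_ (h.nondegenerate_of_top hn _ ?_)
  · rw [Ne, Submodule.span_singleton_eq_bot]
    rintro rfl
    simp at hu
  · intro y hy hyW
    obtain ⟨r, rfl⟩ := Submodule.mem_span_singleton.1 hy
    obtain ⟨a, r', hr⟩ := h.exists_smul_eq hgen r u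
    have := hyW u (Submodule.mem_span_singleton_self u)
    rw [hr, polar_add_left, h.polar_n_smul_n_pow hn, add_zero, polar_smul_left,
      smul_eq_mul, mul_eq_zero, or_iff_left hu] at this
    exact ⟨r' • u, Submodule.mem_span_singleton.2 ⟨r', rfl⟩, by rw [hr, this, zero_smul, zero_add]⟩

theorem span_pair_eq_top (h : IsometricUnit Q t t' n s) [CharP R 2]
    (hgen : ∀ r : R, ∃ p : K[X], aeval t p = r) (hind : Indec R Q) {m : ℕ}
    (hn : n ^ (m + 1) = 0) (halt : ∀ x, polar Q x (n ^ m • x) = 0) {u v : V}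
    (huv : polar Q u (n ^ m • v) ≠ 0) : Submodule.span R {u, v} = ⊤ := by
  refine hind _ ?_ (h.nondegenerate_of_top hn _ ?_)
  · intro hbot
    have := Submodule.span_eq_bot.1 hbot u (by simp)
    simp [this] at huv
  · intro y hy hyW
    obtain ⟨p, q, rfl⟩ := Submodule.mem_span_pair.1 hy
    obtain ⟨a, p', hp⟩ := h.exists_smul_eq hgen p u
    obtain ⟨b, q', hq⟩ := h.exists_smul_eq hgen q v
    have h1 := hyW v (Submodule.subset_span (by simp))
    have h2 := hyW u (Submodule.subset_span (by simp))
    have hvu := huv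
    rw [h.polar_top_comm hn] at hvu
    simp only [hp, hq, polar_add_left, h.polar_n_smul_n_pow hn, add_zero, polar_smul_left, halt,
      smul_eq_mul, mul_zero, zero_add, mul_eq_zero, huv, hvu, or_false] at h1 h2
    exact ⟨p' • u + q' • v, Submodule.mem_span_pair.2 ⟨p', q', rfl⟩, by
      rw [hp, hq, h1, h2, zero_smul, zero_add, zero_smul, zero_add, smul_add]⟩

/-! ### No square root when the exponent is even -/

theorem not_range_le (M : V →ₗ[R] V) (hM : ∀ x, M (M x) = n • x) {l : ℕ}
    (hn : n ^ (2 * l + 2) = 0) (hm : ∃ x : V, n ^ (2 * l + 1) • x ≠ 0) :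
    ¬ ∀ x, ∃ y, M x = n • y := by
  intro hr
  have key : ∀ k x, ∃ y, M x = n ^ k • y := by
    intro k
    induction k with
    | zero => exact fun x => ⟨M x, by simp⟩
    | succ k ih =>
      intro x
      obtain ⟨y, hy⟩ := hr x
      obtain ⟨z, hz⟩ := ih y
      obtain ⟨w, hw⟩ := hr z
      exact ⟨w, by rw [hy, ← hM, hz, map_smul, hw, smul_smul, pow_succ]⟩
  obtain ⟨x, hx⟩ := hm
  obtain ⟨y, hy⟩ := key (2 * l + 2) x
  rw [hn, zero_smul] at hy
  apply hx
  rw [pow_succ, mul_smul, ← hM, hy, map_zero, smul_zero]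

theorem false_of_sq (h : IsometricUnit Q t t' n s) [CharP K 2] [CharP R 2]
    (hgen : ∀ r : R, ∃ p : K[X], aeval t p = r) (hind : Indec R Q) {l : ℕ}
    (hn : n ^ (2 * l + 2) = 0) (hQ : ∀ x : V, (∀ y, polar Q x y = 0) → x = 0)
    (hm : ∃ x : V, n ^ (2 * l + 1) • x ≠ 0)
    (M : V →ₗ[R] V) (hM : ∀ x, M (M x) = n • x) (hMQ : ∀ x, Q (M x) = polar Q (M x) x) :
    False := by
  have hn' : ∀ x : V, n ^ (2 * l + 1) • n • x = 0 := fun x => by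
    rw [smul_smul, ← pow_succ, hn, zero_smul]
  have hcancel : ∀ (a : K) (x : V), n ^ (2 * l + 1) • x ≠ 0 →
      n ^ (2 * l + 1) • M x = a • n ^ (2 * l + 1) • x → a = 0 := fun a x hx hax => by
    have h1 := congrArg M hax
    have h2 : M (a • n ^ (2 * l + 1) • x) = a • M (n ^ (2 * l + 1) • x) := by
      rw [← algebraMap_smul R a, map_smul, algebraMap_smul]
    rw [h2, map_smul, map_smul, hM, hn', hax, smul_smul, eq_comm, smul_eq_zero] at h1
    simpa [hx] using h1
  have hne : ∀ x y, polar Q x (n ^ (2 * l + 1) • y) ≠ 0 → n ^ (2 * l + 1) • y ≠ 0 :=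
    fun x y hxy h0 => hxy (by rw [h0, polar_zero_right])
  apply not_range_le M hM hn hm
  by_cases halt : ∀ x, polar Q x (n ^ (2 * l + 1) • x) = 0
  · obtain ⟨u, v, huv⟩ := exists_polar_ne_zero hQ hm
    have hs : s ^ l * n = n ^ (2 * l + 1) := by
      rw [h.s_pow, mul_assoc, ← pow_succ, mul_comm, h.n_pow_mul_inv hn]
    have hself : ∀ x, polar Q x (n ^ (2 * l + 1) • M x) = 0 := fun x => by
      have h1 : Q (n ^ (l + 1) • x) = 0 := by rw [h.Q_n_pow_succ, hs, halt]
      rw [pow_succ', mul_smul, ← hM, hMQ, hM, map_smul, smul_comm, h.polar_n_pow_n_pow,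
        polar_comm, h.polar_s_pow, smul_smul, hs, h.polar_top_comm hn] at h1
      exact h1
    have hM0 : ∀ x y, polar Q x (n ^ (2 * l + 1) • y) ≠ 0 → ∃ z, M x = n • z := by
      intro x y hxy
      have hyx := hxy
      rw [h.polar_top_comm hn] at hyx
      have hspan := h.span_pair_eq_top hgen hind hn halt hxy
      obtain ⟨p, q, hpq⟩ := Submodule.mem_span_pair.1 (hspan ▸ Submodule.mem_top : M x ∈ _)
      obtain ⟨a, p', hp⟩ := h.exists_smul_eq hgen p x
      obtain ⟨b, q', hq⟩ := h.exists_smul_eq hgen q y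
      have hMx : n ^ (2 * l + 1) • M x =
          a • n ^ (2 * l + 1) • x + b • n ^ (2 * l + 1) • y := by
        rw [← hpq, hp, hq]
        simp only [smul_add, hn', add_zero]
        rw [smul_comm _ a, smul_comm _ b]
      have hb : b = 0 := by
        have := hself x
        rw [hMx, polar_add_right, polar_smul_right, polar_smul_right, halt, smul_zero, zero_add,
          smul_eq_mul, mul_eq_zero, or_iff_left hxy] at this
        exact this
      have ha : a = 0 := hcancel a x (hne _ _ hyx) (by rw [hMx, hb, zero_smul, add_zero])
      exact ⟨p' • x + q' • y, by
        rw [← hpq, hp, hq, ha, hb, zero_smul, zero_smul, zero_add, zero_add, smul_add]⟩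
    intro x
    have hvu := huv
    rw [h.polar_top_comm hn] at hvu
    obtain ⟨y, hy⟩ := hM0 u v huv
    obtain ⟨z, hz⟩ := hM0 v u hvu
    have hspan := h.span_pair_eq_top hgen hind hn halt huv
    obtain ⟨p, q, rfl⟩ := Submodule.mem_span_pair.1 (hspan ▸ Submodule.mem_top : x ∈ _)
    exact ⟨p • y + q • z, by
      rw [map_add, map_smul, map_smul, hy, hz, smul_add, smul_comm p, smul_comm q]⟩
  · push Not at halt
    obtain ⟨u, hu⟩ := halt
    have hspan := h.span_singleton_eq_top hgen hind hn hu
    obtain ⟨p, hp⟩ := Submodule.mem_span_singleton.1 (hspan ▸ Submodule.mem_top : M u ∈ _)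
    obtain ⟨a, p', hp'⟩ := h.exists_smul_eq hgen p u
    have ha : a = 0 := hcancel a u (hne _ _ hu) (by
      rw [← hp, hp', smul_add, hn', add_zero, smul_comm])
    intro x
    obtain ⟨r, rfl⟩ := Submodule.mem_span_singleton.1 (hspan ▸ Submodule.mem_top : x ∈ _)
    exact ⟨r • p' • u, by
      rw [map_smul, ← hp, hp', ha, zero_smul, zero_add, smul_comm]⟩

/-! ### Construction of a square root when the exponent is odd -/

theorem exists_polar_ne_zero_of_eq (h : IsometricUnit Q t t' n s) {e : ℕ} {u v : V}
    [CharP K 2] (huv : polar Q u (s ^ e • v) ≠ 0) :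
    ∃ u w : V, polar Q u (s ^ e • w) ≠ 0 ∧ Q (n ^ e • u) = Q (n ^ e • w) := by
  have key : ∀ u v : V, polar Q u (s ^ e • v) ≠ 0 → Q (n ^ e • v) ≠ 0 →
      ∃ u w : V, polar Q u (s ^ e • w) ≠ 0 ∧ Q (n ^ e • u) = Q (n ^ e • w) := by
    intro u v huv hv
    set b := polar Q u (s ^ e • v) with hb
    set c := Q (n ^ e • v) with hc
    refine ⟨u, u + (b / c) • v, ?_, ?_⟩
    · rw [smul_add, polar_add_right, h.polar_s_pow_self, zero_add, smul_comm, polar_smul_right,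
        ← hb, smul_eq_mul]
      exact mul_ne_zero (div_ne_zero huv hv) huv
    · rw [smul_add, map_add', smul_comm, QuadraticMap.map_smul, polar_smul_right,
        h.polar_n_pow_n_pow, ← hb, ← hc, smul_eq_mul, smul_eq_mul]
      field_simp
      linear_combination -b ^ 2 * CharTwo.two_eq_zero (R := K)
  by_cases hv : Q (n ^ e • v) = 0
  · by_cases hu : Q (n ^ e • u) = 0
    · exact ⟨u, v, huv, by rw [hu, hv]⟩
    · exact key v u (by rwa [← h.polar_s_pow, polar_comm]) hu
  · exact key u v huv hv

theorem exists_partner (h : IsometricUnit Q t t' n s) [CharP K 2] {e : ℕ}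
    (hn : n ^ (2 * e + 1) = 0) {u v : V} (huv : polar Q u (s ^ e • v) ≠ 0)
    (hQuv : Q (n ^ e • u) = Q (n ^ e • v)) (d : ℕ) (hd : d ≤ e) :
    ∃ w : V, polar Q u (s ^ e • w) ≠ 0 ∧ ∀ i, e ≤ d + i →
      Q (n ^ i • u) = Q (n ^ i • w) ∧ polar Q u ((s ^ i * (n * t')) • w) = 0 := by
  have hsn : ∀ {i}, e ≤ i → s ^ i * n = 0 := h.s_pow_mul_n_eq_zero hn
  have hs : ∀ {i}, e < i → s ^ i = 0 := h.s_pow_eq_zero hn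
  have hQn : ∀ {i}, e < i → ∀ x, Q (n ^ i • x) = 0 := h.Q_n_pow_eq_zero hn
  induction d with
  | zero =>
    refine ⟨v, huv, fun i hi => ⟨?_, ?_⟩⟩
    · obtain rfl | hi := eq_or_lt_of_le (show e ≤ i by omega)
      · exact hQuv
      · rw [hQn hi, hQn hi]
    · rw [← mul_assoc, hsn (by omega), zero_mul, zero_smul, polar_zero_right]
  | succ d ih =>
    obtain ⟨w, hw, hwi⟩ := ih (by omega)
    obtain ⟨k, rfl⟩ : ∃ k, e = k + 1 + d := ⟨e - 1 - d, by omega⟩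
    set c := polar Q u (s ^ (k + 1 + d) • w) with hc
    obtain ⟨w₁, hw₁, hB₁, hA₁⟩ : ∃ w₁ : V, polar Q u (s ^ (k + 1 + d) • w₁) = c ∧
        (∀ i, k ≤ i → polar Q u ((s ^ i * (n * t')) • w₁) = 0) ∧
        ∀ i, k < i → Q (n ^ i • u) = Q (n ^ i • w₁) := by
      set b := polar Q u ((s ^ k * (n * t')) • w) / c with hb
      refine ⟨w + b • (s ^ d * n) • w, ?_, fun i hi => ?_, fun i hi => ?_⟩
      · rw [smul_add, smul_comm _ b, smul_smul, ← mul_assoc, ← pow_add, hsn (by omega), zero_smul,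
          smul_zero, add_zero]
      · have hsd : s ^ i * (n * t') * (s ^ d * n) = s ^ (i + 1 + d) := by
          rw [pow_add, pow_succ s i]
          linear_combination -s ^ i * s ^ d * h.s_eq
        rw [smul_add, smul_comm _ b, smul_smul, hsd, polar_add_right, polar_smul_right]
        obtain rfl | hi := eq_or_lt_of_le hi
        · rw [← hc, hb, smul_eq_mul, div_mul_cancel₀ _ hw, CharTwo.add_self_eq_zero]
        · rw [hs (i := i + 1 + d) (by omega), zero_smul, polar_zero_right, smul_zero, add_zero,
            (hwi i (by omega)).2]
      · rw [smul_add, smul_comm _ b, map_add', QuadraticMap.map_smul, polar_smul_right,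
          show (n ^ i • (s ^ d * n) • w : V) = s ^ d • n ^ (i + 1) • w by
            rw [smul_smul, smul_smul]; congr 1; ring,
          h.Q_s_pow, smul_smul (n ^ (2 * d)), ← pow_add, hQn (i := 2 * d + (i + 1)) (by omega),
          smul_zero, add_zero, pow_succ, mul_smul (n ^ i), smul_comm (s ^ d), h.polar_n_pow_n_pow,
          smul_smul, smul_smul,
          ← pow_add, hsn (by omega), zero_smul, polar_zero_right, smul_zero, add_zero,
          (hwi i (by omega)).1]
    set a := (Q (n ^ k • u) + Q (n ^ k • w₁)) / c with ha
    have hcu : polar Q w₁ (s ^ (k + 1 + d) • u) = c := by rw [← h.polar_s_pow, polar_comm, hw₁]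
    refine ⟨w₁ + a • s ^ (d + 1) • u, ?_, fun i hi => ⟨?_, ?_⟩⟩
    · rw [smul_add, smul_comm _ a, smul_smul, ← pow_add,
        hs (i := k + 1 + d + (d + 1)) (by omega), zero_smul, smul_zero, add_zero, hw₁]
      exact hw
    · rw [smul_add, smul_comm _ a, map_add', QuadraticMap.map_smul, polar_smul_right,
        smul_comm (n ^ i), h.Q_s_pow, smul_smul (n ^ _), ← pow_add,
        hQn (i := 2 * (d + 1) + i) (by omega), smul_zero, add_zero, smul_comm (s ^ _),
        h.polar_n_pow_n_pow, smul_smul, ← pow_add]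
      obtain rfl | hi := eq_or_lt_of_le (show k ≤ i by omega)
      · rw [show k + (d + 1) = k + 1 + d by omega, hcu, ha, smul_eq_mul, div_mul_cancel₀ _ hw]
        linear_combination -Q (n ^ k • w₁) * CharTwo.two_eq_zero (R := K)
      · rw [hs (by omega), zero_smul, polar_zero_right, smul_zero, add_zero, hA₁ i hi]
    · have : s ^ i * (n * t') * s ^ (d + 1) = 0 := by
        have := hsn (i := i + (d + 1)) (by omega)
        rw [pow_add] at this
        linear_combination t' * this
      rw [smul_add, smul_comm _ a, smul_smul, this, zero_smul, smul_zero, add_zero,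
        hB₁ i (by omega)]

theorem exists_adjoint (h : IsometricUnit Q t t' n s)
    (hgen : ∀ r : R, ∃ p : K[X], aeval t p = r) (r : R) :
    ∃ r' : R, ∀ x y : V, polar Q (r • x) y = polar Q x (r' • y) := by
  obtain ⟨p, rfl⟩ := hgen r
  refine ⟨aeval t' p, ?_⟩
  induction p using Polynomial.induction_on' with
  | add p q hp hq =>
    intro x y
    simp only [map_add, add_smul, polar_add_left, polar_add_right, hp, hq]
  | monomial i a =>
    have key : ∀ x y : V, polar Q (t ^ i • x) y = polar Q x (t' ^ i • y) := by
      induction i with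
      | zero => simp
      | succ i ih =>
        intro x y
        rw [pow_succ, mul_smul, ih, h.polar_adjoint, pow_succ', mul_smul]
    intro x y
    simp only [aeval_monomial, ← Algebra.smul_def, smul_assoc, polar_smul_left,
      polar_smul_right, key]

/-- The functional `r ↦ f_Q(x, r • y)`. -/
def polarOrbit (R : Type*) [CommRing R] [Module R V] [Algebra K R] [IsScalarTower K R V]
    (Q : QuadraticForm K V) (x y : V) : R →ₗ[K] K :=
  polarBilin Q x ∘ₗ (LinearMap.toSpanSingleton R V y).restrictScalars K

theorem polarOrbit_apply (x y : V) (r : R) : polarOrbit R Q x y r = polar Q x (r • y) := rfl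

theorem exists_sqrt_of_generators (h : IsometricUnit Q t t' n s) [CharP K 2] [CharP R 2]
    (hgen : ∀ r : R, ∃ p : K[X], aeval t p = r) (hQ : ∀ x : V, (∀ y, polar Q x y = 0) → x = 0)
    {u w : V} (huw : Submodule.span R {u, w} = ⊤)
    (hA : ∀ i, Q (n ^ i • u) = Q (n ^ i • w))
    (hB : ∀ i, polar Q u ((s ^ i * (n * t')) • w) = 0) :
    ∃ ψ : V →ₗ[R] V, (∀ x, Q (ψ x) = Q x) ∧ ∀ x, ψ (ψ x) = t • x := by
  have hself : ∀ r : R, polar Q u (r • u) = polar Q w (r • w) := by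
    refine LinearMap.congr_fun (f := polarOrbit R Q u u) (g := polarOrbit R Q w w)
      (h.functional_ext hgen (fun k => ?_) fun k => ?_)
    · simp only [polarOrbit_apply, h.polar_s_pow_self]
    · simp only [polarOrbit_apply, ← h.Q_n_pow_succ, hA]
  have hcross : ∀ r : R, polar Q u (r • w) = polar Q w (r • t • u) := by
    refine LinearMap.congr_fun (f := polarOrbit R Q u w) (g := polarOrbit R Q w (t • u))
      (h.functional_ext hgen (fun k => ?_) fun k => ?_)
    · have := hB k
      rw [show s ^ k * (n * t') = s ^ k + t' * s ^ k by
        rw [h.n_eq]; linear_combination s ^ k * h.mul_inv, add_smul, polar_add_right,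
        CharTwo.add_eq_zero] at this
      rw [polarOrbit_apply, polarOrbit_apply, ← h.polar_s_pow k w, polar_comm Q _ (t • u),
        h.polar_adjoint, smul_smul, this]
    · have := hB (k + 1)
      rw [show s ^ (k + 1) * (n * t') = s ^ k * n + t' * (n * t') * s ^ k by
          rw [pow_succ]
          linear_combination s ^ k * (n * t' * h.s_eq + n * t' ^ 2 * (n + t + 1) * h.n_eq
            + n * (t * t' + 1) * h.mul_inv + n * t * t' ^ 2 * CharTwo.two_eq_zero (R := R)),
        add_smul, polar_add_right, CharTwo.add_eq_zero] at this
      rw [polarOrbit_apply, polarOrbit_apply, mul_smul _ n (t • u), ← h.polar_s_pow k w,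
        polar_comm Q _ (n • t • u), ← pow_one n, h.polar_n_pow, h.polar_adjoint, pow_one, pow_one,
        smul_smul, smul_smul, this]
  have hpair : ∀ p q : R, polar Q (p • u) (q • u) = polar Q (p • w) (q • w) := fun p q => by
    obtain ⟨p', hp⟩ := h.exists_adjoint hgen p
    rw [hp, hp, smul_smul, smul_smul, hself]
  have hdiag : ∀ r : R, Q (r • u) = Q (r • w) := fun r => by
    obtain ⟨p, rfl⟩ := hgen r
    induction p using Polynomial.induction_on' with
    | add p q hp hq => simp only [map_add, add_smul, map_add', hp, hq, hpair]
    | monomial i a =>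
      have key : ∀ x : V, Q (t ^ i • x) = Q x := by
        induction i with
        | zero => simp
        | succ i ih => exact fun x => by rw [pow_succ, mul_smul, ih, h.isometry]
      have := hA 0
      rw [pow_zero, one_smul, one_smul] at this
      simp only [aeval_monomial, ← Algebra.smul_def, smul_assoc, QuadraticMap.map_smul, key, this]
  let T : R × R →ₗ[R] V :=
    (LinearMap.toSpanSingleton R V u).coprod (LinearMap.toSpanSingleton R V w)
  let T' : R × R →ₗ[R] V :=
    (LinearMap.toSpanSingleton R V w).coprod (LinearMap.toSpanSingleton R V (t • u))
  have hT : ∀ p q, T (p, q) = p • u + q • w := fun p q => by simp [T]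
  have hT' : ∀ p q, T' (p, q) = p • w + q • t • u := fun p q => by simp [T']
  have hTsurj : ∀ x, ∃ a, T a = x := fun x => by
    obtain ⟨p, q, rfl⟩ := Submodule.mem_span_pair.1 (huw ▸ Submodule.mem_top : x ∈ _)
    exact ⟨(p, q), hT p q⟩
  have hT'surj : ∀ x, ∃ a, T' a = x := fun x => by
    obtain ⟨p, q, rfl⟩ := Submodule.mem_span_pair.1 (huw ▸ Submodule.mem_top : x ∈ _)
    refine ⟨(q, p * t'), ?_⟩
    rw [hT', smul_smul, mul_assoc, mul_comm t', h.mul_inv, mul_one, add_comm]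
  have hiso : ∀ a, Q (T' a) = Q (T a) := by
    rintro ⟨p, q⟩
    obtain ⟨p', hp⟩ := h.exists_adjoint hgen p
    rw [hT, hT', map_add', map_add', smul_comm q, h.isometry, ← hdiag, ← hdiag, hp, hp,
      smul_smul p' q w, hcross, smul_comm t q, smul_smul p' q]
  have hker : LinearMap.ker T ≤ LinearMap.ker T' := fun a ha => by
    rw [LinearMap.mem_ker] at ha ⊢
    refine hQ _ fun y => ?_
    obtain ⟨b, rfl⟩ := hT'surj y
    rw [polar, ← map_add, hiso, hiso, hiso, map_add, ha, zero_add, QuadraticMap.map_zero, sub_zero,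
      sub_self]
  let ψ : V →ₗ[R] V := (LinearMap.ker T).liftQ T' hker ∘ₗ
    (T.quotKerEquivOfSurjective hTsurj).symm.toLinearMap
  have hψ : ∀ a, ψ (T a) = T' a := fun a => by
    have : (T.quotKerEquivOfSurjective hTsurj).symm (T a) = (LinearMap.ker T).mkQ a := by
      rw [LinearEquiv.symm_apply_eq]
      rfl
    simp only [ψ, LinearMap.comp_apply, LinearEquiv.coe_coe, this]
    rfl
  refine ⟨ψ, fun x => ?_, fun x => ?_⟩
  · obtain ⟨a, rfl⟩ := hTsurj x
    rw [hψ, hiso]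
  · obtain ⟨⟨p, q⟩, rfl⟩ := hTsurj x
    have : T' (p, q) = T (q * t, p) := by rw [hT, hT', mul_smul, add_comm]
    rw [hψ, this, hψ, hT', hT, smul_add, smul_comm t p, smul_comm t q, mul_smul, smul_comm q, add_comm]

theorem exists_sqrt (h : IsometricUnit Q t t' n s) [CharP K 2] [CharP R 2]
    (hgen : ∀ r : R, ∃ p : K[X], aeval t p = r) (hind : Indec R Q) {e : ℕ}
    (hn : n ^ (2 * e + 1) = 0) (hQ : ∀ x : V, (∀ y, polar Q x y = 0) → x = 0)
    (hm : ∃ x : V, n ^ (2 * e) • x ≠ 0) :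
    ∃ ψ : V →ₗ[R] V, (∀ x, Q (ψ x) = Q x) ∧ ∀ x, ψ (ψ x) = t • x := by
  have hs : n ^ (2 * e) = s ^ e := by rw [h.s_pow, mul_comm (t' ^ e), h.n_pow_mul_inv hn]
  obtain ⟨u₀, v, huv⟩ := exists_polar_ne_zero hQ hm
  rw [hs] at huv
  obtain ⟨u, v, huv, hQuv⟩ := h.exists_polar_ne_zero_of_eq huv
  obtain ⟨w, huw, hw⟩ := h.exists_partner hn huv hQuv e le_rfl
  refine h.exists_sqrt_of_generators hgen hQ (u := u) (w := w)
    (h.span_pair_eq_top hgen hind hn (fun x => ?_) (hs ▸ huw))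
    (fun i => (hw i (by omega)).1) fun i => (hw i (by omega)).2
  rw [hs, h.polar_s_pow_self]

end IsometricUnit

theorem exists_isometricUnit_adjoin [Field K] [AddCommGroup V] [Module K V] [CharP K 2]
    (Q : QuadraticForm K V) (f : Module.End K V) (hf : ∀ x, Q (f x) = Q x) {m : ℕ}
    (hm : (f - 1) ^ m = 0) :
    ∃ t t' n s : Algebra.adjoin K {f}, t.1 = f ∧ n.1 = f - 1 ∧ n ^ m = 0 ∧
      IsometricUnit Q t t' n s := by
  let t : Algebra.adjoin K {f} := ⟨f, Algebra.self_mem_adjoin_singleton K f⟩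
  have hn : (t - 1) ^ m = 0 := Subtype.ext hm
  obtain ⟨t', ht'⟩ : ∃ t', t * t' = 1 := by
    have : IsUnit t := by
      simpa using IsNilpotent.isUnit_add_one ⟨m, hn⟩
    exact this.exists_right_inv
  have htwo : (2 : Algebra.adjoin K {f}) = 0 := by
    rw [← map_ofNat (algebraMap K (Algebra.adjoin K {f})) 2, CharTwo.two_eq_zero, map_zero]
  exact ⟨t, t', t - 1, (t - 1) ^ 2 * t', rfl, rfl, hn, ht',
    by linear_combination -htwo, rfl, hf⟩

theorem exists_aeval_eq_of_mem_adjoin [Field K] [AddCommGroup V] [Module K V]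
    {f : Module.End K V} {t : Algebra.adjoin K {f}} (ht : t.1 = f) (r : Algebra.adjoin K {f}) :
    ∃ p : K[X], aeval t p = r := by
  obtain ⟨r, hr⟩ := r
  have hr' := hr
  rw [Algebra.adjoin_singleton_eq_range_aeval] at hr'
  obtain ⟨p, hp⟩ := hr'
  refine ⟨p, Subtype.ext ?_⟩
  have := Polynomial.aeval_algHom_apply (Algebra.adjoin K {f}).val t p
  rw [Subalgebra.coe_val, ht] at this
  exact this.symm.trans hp

theorem OrthIndec.indec_adjoin [Field K] [AddCommGroup V] [Module K V] [FiniteDimensional K V]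
    {Q : QuadraticForm K V} {f : Module.End K V} (h : OrthIndec Q f) :
    IsometricUnit.Indec (Algebra.adjoin K {f}) Q := by
  intro W hW hnd
  by_contra htop
  refine h ⟨W.restrictScalars K, fun u hu => ?_, ?_, ?_, hnd⟩
  · exact W.smul_mem ⟨f, Algebra.self_mem_adjoin_singleton K f⟩ hu
  · rw [Nat.pos_iff_ne_zero, Ne, Submodule.finrank_eq_zero]
    simpa using hW
  · refine Submodule.finrank_lt ?_
    simpa using htop

theorem exists_pow_ne_zero_of_minpoly [Field K] [AddCommGroup V] [Module K V]
    {f : Module.End K V} {k : ℕ} (hf : minpoly K f = (X - 1) ^ (k + 1)) :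
    (f - 1) ^ (k + 1) = 0 ∧ ∃ x, ((f - 1) ^ k) x ≠ 0 := by
  constructor
  · simpa [hf] using minpoly.aeval K f
  · by_contra! hcon
    have hdvd : minpoly K f ∣ (X - 1) ^ k := minpoly.dvd K f (by
      simpa using LinearMap.ext hcon)
    rw [hf, ← C_1] at hdvd
    have := natDegree_le_of_dvd hdvd (pow_ne_zero _ (X_sub_C_ne_zero 1))
    simp only [natDegree_pow, natDegree_X_sub_C] at this
    omega

theorem isometry_sub_one [Field K] [AddCommGroup V] [Module K V] [CharP K 2]
    {Q : QuadraticForm K V} {f : V → V} (hf : ∀ x, Q (f x) = Q x) (x : V) :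
    Q (f x - x) = QuadraticMap.polar Q (f x - x) x := by
  rw [QuadraticMap.polar, sub_add_cancel, hf, sub_right_comm, sub_self, zero_sub, CharTwo.neg_eq]

theorem stmt7 [Field K] [AddCommGroup V] [Module K V] [FiniteDimensional K V]
    (Q : QuadraticForm K V) (hQ : Nondefective Q)
    (hchar : ringChar K = 2) (φ : V ≃ₗ[K] V) (hO : InO Q φ)
    (m : ℕ) (h1 : IsType1 Q φ.toLinearMap m) :
    (∃ ψ : V ≃ₗ[K] V, InO Q ψ ∧ ψ * ψ = φ) ↔ IsType1o Q φ.toLinearMap := by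
  have : CharP K 2 := ringChar.of_eq hchar
  set f : Module.End K V := φ.toLinearMap with hf
  have key : ∀ k, IsType1 Q f (k + 1) → ∃ t t' n s : Algebra.adjoin K {f},
      CharP (Algebra.adjoin K {f}) 2 ∧ t.1 = f ∧ n.1 = f - 1 ∧ n ^ (k + 1) = 0 ∧
      IsometricUnit Q t t' n s ∧ ∃ x : V, n ^ k • x ≠ 0 := by
    intro k hk
    obtain ⟨hpow, x, hx⟩ := exists_pow_ne_zero_of_minpoly hk.2.2.1
    obtain ⟨t, t', n, s, ht, hn, hnk, h⟩ := exists_isometricUnit_adjoin Q f hO hpow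
    have : Nontrivial V := ⟨_, _, hx⟩
    refine ⟨t, t', n, s, charP_of_injective_algebraMap
      (algebraMap K (Algebra.adjoin K {f})).injective 2, ht, hn, hnk, h, x, ?_⟩
    rwa [← hn] at hx
  constructor
  · rintro ⟨ψ, hψ, hψφ⟩
    refine ⟨m, h1, ?_⟩
    by_contra hm
    obtain ⟨l, rfl⟩ : ∃ l, m = 2 * l + 1 + 1 := by
      obtain ⟨l, rfl⟩ := Nat.not_odd_iff_even.1 hm
      have := h1.2.1
      exact ⟨l - 1, by omega⟩
    obtain ⟨t, t', n, s, hR, ht, hn, hnk, h, hx⟩ := key _ h1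
    have hψf : ∀ x, f x = ψ (ψ x) := fun x => by rw [hf, ← hψφ]; rfl
    have hcomm : ∀ (r : Algebra.adjoin K {f}) (x : V), ψ (r • x) = r • ψ x := by
      intro r x
      have : Commute ψ.toLinearMap r.1 :=
        Algebra.commute_of_mem_adjoin_singleton_of_commute r.2
          (LinearMap.ext fun x => by simp [hψf])
      exact LinearMap.congr_fun this.eq x
    let M : V →ₗ[Algebra.adjoin K {f}] V :=
      { toFun := fun x => ψ x - x
        map_add' := fun x y => by rw [map_add]; abel
        map_smul' := fun r x => by rw [hcomm, RingHom.id_apply, smul_sub] }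
    refine h.false_of_sq (exists_aeval_eq_of_mem_adjoin ht) h1.1.indec_adjoin hnk hQ hx M
      (fun x => ?_) fun x => isometry_sub_one hψ x
    have hnx : n • x = ψ (ψ x) - x := by
      rw [← hψf]
      exact LinearMap.congr_fun hn x
    have h2 : ψ x + ψ x = 0 := by
      rw [← two_smul K, CharTwo.two_eq_zero, zero_smul]
    rw [hnx]
    change ψ (ψ x - x) - (ψ x - x) = _
    rw [map_sub, sub_sub, add_sub, h2, zero_sub, sub_neg_eq_add]
    have h3 : x + x = 0 := by
      rw [← two_smul K, CharTwo.two_eq_zero, zero_smul]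
    rw [eq_sub_iff_add_eq, add_assoc, h3, add_zero]
  · rintro ⟨m, h1, e, rfl⟩
    obtain ⟨t, t', n, s, hR, ht, -, hnk, h, hx⟩ := key _ h1
    obtain ⟨ψ, hψ, hψt⟩ :=
      h.exists_sqrt (exists_aeval_eq_of_mem_adjoin ht) h1.1.indec_adjoin hnk hQ hx
    have hψφ : ∀ x, ψ (ψ x) = φ x := fun x => (hψt x).trans (LinearMap.congr_fun ht x)
    have hbij : Function.Bijective (ψ.restrictScalars K) := by
      refine ⟨fun x y hxy => φ.injective ?_, fun x => ⟨ψ (φ.symm x), ?_⟩⟩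
      · rw [← hψφ, ← hψφ]
        exact congrArg ψ hxy
      · exact (hψφ _).trans (φ.apply_symm_apply x)
    exact ⟨LinearEquiv.ofBijective _ hbij, hψ, LinearEquiv.ext hψφ⟩
end
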